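/- Assume that E(s^{X_0^*}) < ∞ for every real s with 0 ≤ s < m (and P(X_0^* ≥ 2) > 0). Then the free energy F_∞, as a function of p on [0,1], is infinitely differentiable (with one-sided derivatives at the endpoints), and for every integer k ≥ 0 and every p ∈ [0,1], F_∞^{(k)}(p) = (d^k/dp^k)(E(X_0) − 1/(m−1)) + Σ_{n=0}^{∞} m^{−(n+1)} (d^k/dp^k) P(X_n = 0)^m, where the series of k-th derivatives converges uniformly in p ∈ [0,1]. -/

import Mathlib

open Filter

noncomputable section

/-- One step of the Derrida–Retaux recursion on probability mass functions on ℕ: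
the law of `(X_1 + ⋯ + X_m - 1)⁺` for independent `X_i` with mass function `μ`
(the truncated subtraction on `ℕ` realizes the positive part). -/
def drStep (m : ℕ) (μ : ℕ → ℝ) : ℕ → ℝ :=
  fun j => ∑' x : Fin m → ℕ, if (∑ i, x i) - 1 = j then ∏ i, μ (x i) else 0

/-- The mass function of `X_0`, namely `(1 - p)·δ_0 + p·ν`. -/
def mix (ν : ℕ → ℝ) (p : ℝ) : ℕ → ℝ :=
  fun k => (1 - p) * (if k = 0 then 1 else 0) + p * ν k

/-- The mass function of `X_n` in the Derrida–Retaux system started from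
`(1 - p)·δ_0 + p·ν`. -/
def drLaw (m : ℕ) (ν : ℕ → ℝ) (p : ℝ) (n : ℕ) : ℕ → ℝ :=
  (drStep m)^[n] (mix ν p)

section helpers

open Polynomial


/-- One step of the recursion on generating polynomials. -/
def pstep {R : Type*} [CommRing R] (m : ℕ) (f : R[X]) : R[X] :=
  divX (f ^ m) + C ((f ^ m).coeff 0)

lemma pstep_coeff {R : Type*} [CommRing R] (m : ℕ) (f : R[X]) (k : ℕ) :
    (pstep m f).coeff k = (f ^ m).coeff (k + 1) + if k = 0 then (f ^ m).coeff 0 else 0 := by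
  simp [pstep, coeff_C]

lemma X_mul_pstep {R : Type*} [CommRing R] (m : ℕ) (f : R[X]) :
    X * pstep m f = f ^ m + (X - 1) * C ((f ^ m).coeff 0) := by
  have := X_mul_divX_add (f ^ m)
  rw [pstep, mul_add]
  linear_combination this

lemma pstep_map {R S : Type*} [CommRing R] [CommRing S] (φ : R →+* S) (m : ℕ) (f : R[X]) :
    (pstep m f).map φ = pstep m (f.map φ) := by
  ext k
  rw [coeff_map, pstep_coeff, pstep_coeff, ← Polynomial.map_pow, coeff_map, coeff_map, map_add]
  split_ifs <;> simp

lemma pstep_iter_map {R S : Type*} [CommRing R] [CommRing S] (φ : R →+* S) (m : ℕ) (f : R[X])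
    (n : ℕ) : ((pstep m)^[n] f).map φ = (pstep m)^[n] (f.map φ) := by
  induction n generalizing f with
  | zero => rfl
  | succ n ih => rw [Function.iterate_succ_apply, ih, pstep_map, Function.iterate_succ_apply]

/-- Sum of the absolute values of the first `K` coefficients. -/
def lowN {R : Type*} [NormedCommRing R] (f : R[X]) (K : ℕ) : ℝ :=
  ∑ j ∈ Finset.range K, ‖f.coeff j‖

lemma lowN_nonneg {R : Type*} [NormedCommRing R] (f : R[X]) (K : ℕ) : 0 ≤ lowN f K :=
  Finset.sum_nonneg fun _ _ => norm_nonneg _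

lemma lowN_mul {R : Type*} [NormedCommRing R] (f g : R[X]) (K : ℕ) :
    lowN (f * g) K ≤ lowN f K * lowN g K := by
  unfold lowN
  calc ∑ n ∈ Finset.range K, ‖(f * g).coeff n‖
      ≤ ∑ n ∈ Finset.range K, ∑ x ∈ Finset.HasAntidiagonal.antidiagonal n, ‖f.coeff x.1‖ * ‖g.coeff x.2‖ := by
        refine Finset.sum_le_sum fun n _ => ?_
        rw [coeff_mul]
        exact (norm_sum_le _ _).trans (Finset.sum_le_sum fun x _ => norm_mul_le _ _)
    _ = ∑ x ∈ (Finset.range K).sigma (fun n => Finset.HasAntidiagonal.antidiagonal n),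
          ‖f.coeff x.2.1‖ * ‖g.coeff x.2.2‖ := by rw [Finset.sum_sigma]
    _ = ∑ y ∈ ((Finset.range K).sigma (fun n => Finset.HasAntidiagonal.antidiagonal n)).image (fun x => x.2),
          ‖f.coeff y.1‖ * ‖g.coeff y.2‖ := by
        rw [Finset.sum_image]
        rintro ⟨a, b⟩ hx ⟨c, d⟩ hy h
        simp only [Finset.coe_sigma, Set.mem_sigma_iff, Finset.mem_coe, Finset.HasAntidiagonal.mem_antidiagonal] at hx hy
        simp only at h
        subst h
        obtain ⟨_, h1⟩ := hx
        obtain ⟨_, h2⟩ := hy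
        have : a = c := by omega
        subst this
        rfl
    _ ≤ ∑ y ∈ Finset.range K ×ˢ Finset.range K, ‖f.coeff y.1‖ * ‖g.coeff y.2‖ := by
        refine Finset.sum_le_sum_of_subset_of_nonneg ?_ fun _ _ _ => by positivity
        intro y hy
        simp only [Finset.mem_image, Finset.mem_sigma, Finset.mem_range, Finset.HasAntidiagonal.mem_antidiagonal] at hy
        obtain ⟨x, ⟨h1, h2⟩, rfl⟩ := hy
        simp only [Finset.mem_product, Finset.mem_range]
        omega
    _ = _ := by rw [Finset.sum_mul_sum, Finset.sum_product]

lemma lowN_one_le {R : Type*} [NormedCommRing R] [NormOneClass R] (K : ℕ) :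
    lowN (1 : R[X]) K ≤ 1 := by
  unfold lowN
  calc ∑ j ∈ Finset.range K, ‖(1 : R[X]).coeff j‖
      ≤ ∑ j ∈ Finset.range K, if j = 0 then (1 : ℝ) else 0 := by
        refine Finset.sum_le_sum fun j _ => ?_
        rw [coeff_one]; split_ifs <;> simp
    _ ≤ 1 := by
        rw [Finset.sum_ite_eq']; split_ifs <;> simp

lemma lowN_pow {R : Type*} [NormedCommRing R] [NormOneClass R] (f : R[X]) (m K : ℕ) :
    lowN (f ^ m) K ≤ lowN f K ^ m := by
  induction m with
  | zero => simpa using lowN_one_le K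
  | succ m ih =>
    rw [pow_succ, pow_succ]
    exact (lowN_mul _ _ _).trans (mul_le_mul_of_nonneg_right ih (lowN_nonneg _ _))

lemma lowN_pstep_le {R : Type*} [NormedCommRing R] (m : ℕ) (f : R[X]) (k : ℕ) :
    lowN (pstep m f) (k + 1) ≤ lowN (f ^ m) (k + 2) := by
  unfold lowN
  rw [Finset.sum_range_succ' (fun j => ‖(f ^ m).coeff j‖) (k + 1)]
  rw [Finset.sum_range_succ', Finset.sum_range_succ' (fun j => ‖(f ^ m).coeff (j + 1)‖)]
  have h0 : ‖(pstep m f).coeff 0‖ ≤ ‖(f ^ m).coeff (0 + 1)‖ + ‖(f ^ m).coeff 0‖ := by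
    rw [pstep_coeff]; simpa using norm_add_le _ _
  have h1 : ∑ j ∈ Finset.range k, ‖(pstep m f).coeff (j + 1)‖
      = ∑ j ∈ Finset.range k, ‖(f ^ m).coeff (j + 1 + 1)‖ :=
    Finset.sum_congr rfl fun j _ => by rw [pstep_coeff]; simp
  linarith

lemma lowN_pstep {R : Type*} [NormedCommRing R] [NormOneClass R] (m : ℕ) (f : R[X]) (k : ℕ) :
    lowN (pstep m f) (k + 1) ≤ lowN f (k + 2) ^ m :=
  (lowN_pstep_le m f k).trans (lowN_pow f m _)

lemma lowN_iter {R : Type*} [NormedCommRing R] [NormOneClass R] (m : ℕ) (f : R[X]) (l k : ℕ) :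
    lowN ((pstep m)^[l] f) (k + 1) ≤ lowN f (k + 1 + l) ^ (m ^ l) := by
  induction l generalizing k with
  | zero => simp
  | succ l ih =>
    rw [Function.iterate_succ_apply']
    refine (lowN_pstep m _ k).trans ?_
    have := ih (k + 1)
    calc lowN ((pstep m)^[l] f) (k + 2) ^ m ≤ (lowN f (k + 1 + 1 + l) ^ (m ^ l)) ^ m :=
          pow_le_pow_left₀ (lowN_nonneg _ _) this m
      _ = _ := by rw [← pow_mul, ← pow_succ]; congr 2; omega

/-- Probability generating polynomial. -/
def Law (f : ℝ[X]) : Prop := (∀ k, 0 ≤ f.coeff k) ∧ f.eval 1 = 1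

lemma coeff_mul_nonneg' {f g : ℝ[X]} (hf : ∀ k, 0 ≤ f.coeff k) (hg : ∀ k, 0 ≤ g.coeff k) (k : ℕ) :
    0 ≤ (f * g).coeff k := by
  rw [coeff_mul]
  exact Finset.sum_nonneg fun x _ => mul_nonneg (hf _) (hg _)

lemma coeff_pow_nonneg' {f : ℝ[X]} (hf : ∀ k, 0 ≤ f.coeff k) (m k : ℕ) :
    0 ≤ (f ^ m).coeff k := by
  induction m generalizing k with
  | zero => rw [pow_zero, coeff_one]; split_ifs <;> simp
  | succ m ih => rw [pow_succ]; exact coeff_mul_nonneg' ih hf k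

lemma pstep_nonneg {m : ℕ} {f : ℝ[X]} (hf : ∀ k, 0 ≤ f.coeff k) (k : ℕ) :
    0 ≤ (pstep m f).coeff k := by
  rw [pstep_coeff]
  have := coeff_pow_nonneg' hf m
  split_ifs
  · exact add_nonneg (this _) (this _)
  · simpa using this _

lemma pstep_eval_one (m : ℕ) {R : Type*} [CommRing R] (f : R[X]) :
    (pstep m f).eval 1 = f.eval 1 ^ m := by
  have := congrArg (eval 1) (X_mul_pstep m f)
  simpa using this

lemma Law.pstep {m : ℕ} {f : ℝ[X]} (hf : Law f) : Law (pstep m f) :=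
  ⟨pstep_nonneg hf.1, by rw [pstep_eval_one, hf.2, one_pow]⟩

lemma Law.iter {m : ℕ} {f : ℝ[X]} (hf : Law f) (n : ℕ) : Law ((_root_.pstep m)^[n] f) := by
  induction n with
  | zero => exact hf
  | succ n ih => rw [Function.iterate_succ_apply']; exact ih.pstep

lemma eval_one_eq {R : Type*} [CommRing R] (f : R[X]) (N : ℕ) (h : f.natDegree < N) :
    f.eval 1 = ∑ k ∈ Finset.range N, f.coeff k := by
  rw [eval_eq_sum_range' h]; simp

lemma low_le_eval {f : ℝ[X]} (hf : ∀ k, 0 ≤ f.coeff k) (K : ℕ) :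
    ∑ k ∈ Finset.range K, f.coeff k ≤ f.eval 1 := by
  rw [eval_one_eq f (max K (f.natDegree + 1)) (by omega)]
  exact Finset.sum_le_sum_of_subset_of_nonneg (Finset.range_mono (le_max_left _ _)) fun _ _ _ => hf _

lemma lowN_eq {f : ℝ[X]} (hf : ∀ k, 0 ≤ f.coeff k) (K : ℕ) :
    lowN f K = ∑ k ∈ Finset.range K, f.coeff k :=
  Finset.sum_congr rfl fun _ _ => Real.norm_of_nonneg (hf _)

lemma Law.low_le {f : ℝ[X]} (hf : Law f) (K : ℕ) : lowN f K ≤ 1 := by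
  rw [lowN_eq hf.1, ← hf.2]; exact low_le_eval hf.1 K

/-- The tail `P(X ≥ k)`. -/
def tl (f : ℝ[X]) (k : ℕ) : ℝ := 1 - lowN f k

lemma tl_nonneg {f : ℝ[X]} (hf : Law f) (k : ℕ) : 0 ≤ tl f k := by
  unfold tl; linarith [hf.low_le k]

lemma tl_le_one (f : ℝ[X]) (k : ℕ) : tl f k ≤ 1 := by
  unfold tl; linarith [lowN_nonneg f k]

lemma coeff_le_tl {f : ℝ[X]} (hf : Law f) (k : ℕ) : f.coeff k ≤ tl f k := by
  have := hf.low_le (k + 1)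
  rw [lowN_eq hf.1, Finset.sum_range_succ, ← lowN_eq hf.1] at this
  unfold tl; linarith

lemma tl_anti {f : ℝ[X]} {j k : ℕ} (h : j ≤ k) : tl f k ≤ tl f j := by
  unfold tl lowN
  have := Finset.sum_le_sum_of_subset_of_nonneg (f := fun j => ‖f.coeff j‖) (Finset.range_mono h)
    fun _ _ _ => norm_nonneg _
  linarith

/-- tail bound -/
lemma tl_bound {m : ℕ} {f : ℝ[X]} (hf : Law f) (k : ℕ)
    (h : 1 / 4 < lowN ((pstep m)^[k] f) 4) : tl f (4 + k) * (m : ℝ) ^ k ≤ 3 := by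
  have h1 := lowN_iter m f k 3
  have ht0 := tl_nonneg hf (4 + k)
  have ht1 := tl_le_one f (4 + k)
  set t := tl f (4 + k) with ht
  have h2 : lowN f (3 + 1 + k) = 1 - t := by rw [ht, tl]; norm_num
  rw [h2] at h1
  set N := m ^ k
  have h3 : (1 + N * t) * (1 - t) ^ N ≤ 1 := by
    have hb : 1 + (N : ℝ) * t ≤ (1 + t) ^ N := one_add_mul_le_pow (by linarith) N
    calc (1 + N * t) * (1 - t) ^ N ≤ (1 + t) ^ N * (1 - t) ^ N :=
          mul_le_mul_of_nonneg_right hb (pow_nonneg (by linarith) _)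
      _ = (1 - t ^ 2) ^ N := by rw [← mul_pow]; ring
      _ ≤ 1 := pow_le_one₀ (by nlinarith) (by nlinarith)
  have h4 : (N : ℝ) = (m : ℝ) ^ k := by simp [N]
  rw [← h4]
  have h5 : 1 / 4 < (1 - t) ^ N := lt_of_lt_of_le h h1
  have h6 : 0 ≤ (N : ℝ) * t := by positivity
  nlinarith

/-- doubling -/
lemma low_mul_le_left {f g : ℝ[X]} (hf : Law f) (hg : Law g) (K : ℕ) :
    lowN (f * g) K ≤ lowN f K :=
  (lowN_mul f g K).trans (mul_le_of_le_one_right (lowN_nonneg _ _) (hg.low_le K))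

lemma Law.mul {f g : ℝ[X]} (hf : Law f) (hg : Law g) : Law (f * g) :=
  ⟨coeff_mul_nonneg' hf.1 hg.1, by rw [eval_mul, hf.2, hg.2, one_mul]⟩

lemma Law.pow {f : ℝ[X]} (hf : Law f) (m : ℕ) : Law (f ^ m) :=
  ⟨coeff_pow_nonneg' hf.1 m, by rw [eval_pow, hf.2, one_pow]⟩

/-- truncation of a polynomial to degrees `< K` -/
def ptr (f : ℝ[X]) (K : ℕ) : ℝ[X] := ∑ k ∈ Finset.range K, C (f.coeff k) * X ^ k

lemma ptr_coeff (f : ℝ[X]) (K k : ℕ) : (ptr f K).coeff k = if k < K then f.coeff k else 0 := by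
  simp [ptr, finsetSum_coeff, coeff_C_mul, coeff_X_pow]

lemma ptr_eval (f : ℝ[X]) (K : ℕ) : (ptr f K).eval 1 = ∑ k ∈ Finset.range K, f.coeff k := by
  simp [ptr, eval_finsetSum]

lemma ptr_nonneg {f : ℝ[X]} (hf : ∀ k, 0 ≤ f.coeff k) (K k : ℕ) : 0 ≤ (ptr f K).coeff k := by
  rw [ptr_coeff]; split_ifs
  · exact hf k
  · exact le_rfl

lemma low_sq_le {f : ℝ[X]} (hf : Law f) (k : ℕ) : lowN (f * f) (2 * k) ≤ 2 * lowN f k := by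
  have h1 : ∀ n ∈ Finset.range (2 * k), (f * f).coeff n
      ≤ (ptr f k * f + f * ptr f k).coeff n := by
    intro n hn
    rw [coeff_add, coeff_mul, coeff_mul, coeff_mul, ← Finset.sum_add_distrib]
    refine Finset.sum_le_sum fun x hx => ?_
    rw [ptr_coeff, ptr_coeff]
    rw [Finset.HasAntidiagonal.mem_antidiagonal] at hx
    rw [Finset.mem_range] at hn
    have := mul_nonneg (hf.1 x.1) (hf.1 x.2)
    by_cases h : x.1 < k
    · simp only [h, if_true]; split_ifs <;> simp <;> linarith
    · have h' : x.2 < k := by omega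
      simp [h, h']
  rw [lowN_eq (hf.mul hf).1]
  refine (Finset.sum_le_sum h1).trans ?_
  have hp := ptr_nonneg hf.1 k
  refine (low_le_eval (fun n => ?_) _).trans ?_
  · rw [coeff_add]
    exact add_nonneg (coeff_mul_nonneg' hp hf.1 n) (coeff_mul_nonneg' hf.1 hp n)
  · rw [eval_add, eval_mul, eval_mul, hf.2, ptr_eval, ← lowN_eq hf.1]; linarith

lemma low_double {m : ℕ} (hm : 2 ≤ m) {f : ℝ[X]} (hf : Law f) (k : ℕ) :
    lowN (pstep m f) (2 * k + 1) ≤ 2 * lowN f (k + 1) := by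
  refine (lowN_pstep_le m f (2 * k)).trans ?_
  have : f ^ m = f * f * f ^ (m - 2) := by
    rw [← pow_two, ← pow_add]; congr 1; omega
  rw [this]
  refine (low_mul_le_left (hf.mul hf) (hf.pow _) _).trans ?_
  exact low_sq_le hf (k + 1)

/-- two steps -/
lemma low_two {m : ℕ} (hm : 2 ≤ m) {f : ℝ[X]} (hf : Law f) (k : ℕ) (h : lowN f (k + 4) ≤ 1 / 4) :
    lowN ((pstep m)^[2] f) (2 * k + 5) ≤ 1 / 4 := by
  have h1 : lowN (pstep m f) (k + 3) ≤ 1 / 16 := by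
    refine (lowN_pstep m f (k + 2)).trans ?_
    have h0 := lowN_nonneg f (k + 4)
    calc lowN f (k + 4) ^ m ≤ (1 / 4 : ℝ) ^ m := pow_le_pow_left₀ h0 h m
      _ ≤ (1 / 4 : ℝ) ^ 2 := pow_le_pow_of_le_one (by norm_num) (by norm_num) hm
      _ = 1 / 16 := by norm_num
  have h2 := low_double hm (hf.pstep (m := m)) (k + 2)
  have e : (pstep m)^[2] f = pstep m (pstep m f) := rfl
  rw [e]
  have : 2 * (k + 2) + 1 = 2 * k + 5 := by ring
  rw [this] at h2
  have e3 : k + 2 + 1 = k + 3 := rfl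
  rw [e3] at h2
  linarith

lemma low_grow {m : ℕ} (hm : 2 ≤ m) {f : ℝ[X]} (hf : Law f) (h : lowN f 4 ≤ 1 / 4) (l : ℕ) :
    lowN ((pstep m)^[2 * l] f) (2 ^ l + 3) ≤ 1 / 4 := by
  induction l with
  | zero => simpa using h
  | succ l ih =>
    have e : 2 * (l + 1) = 2 + 2 * l := by ring
    rw [e, Function.iterate_add_apply]
    obtain ⟨k, hk⟩ : ∃ k, 2 ^ l = k + 1 := ⟨2 ^ l - 1, by have := Nat.one_le_two_pow (n := l); omega⟩
    have := low_two hm (hf.iter (m := m) (2 * l)) k (by rw [hk] at ih; exact ih)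
    have e2 : 2 ^ (l + 1) + 3 = 2 * k + 5 := by rw [pow_succ, hk]; ring
    rw [e2]; exact this

/-- Euler operator `X d/dX`. -/
def eu (f : ℝ[X]) : ℝ[X] := X * derivative f

lemma eu_coeff (f : ℝ[X]) (k : ℕ) : (eu f).coeff k = k * f.coeff k := by
  unfold eu
  cases k with
  | zero => simp
  | succ k => rw [coeff_X_mul, coeff_derivative]; push_cast; ring

lemma eu_natDegree (f : ℝ[X]) (N : ℕ) (h : f.natDegree < N) : (eu f).natDegree < N := by
  refine lt_of_le_of_lt ?_ h
  rw [natDegree_le_iff_coeff_eq_zero]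
  intro k hk
  rw [eu_coeff, coeff_eq_zero_of_natDegree_lt hk, mul_zero]

def Gs (f : ℝ[X]) (s : ℝ) : ℝ := f.eval s
def Bs (f : ℝ[X]) (s : ℝ) : ℝ := (eu f).eval s
def Vs (f : ℝ[X]) (s : ℝ) : ℝ := (eu (eu f)).eval s
def As (f : ℝ[X]) (s : ℝ) : ℝ := Vs f s + Bs f s
def Ds (f : ℝ[X]) (s : ℝ) : ℝ := Gs f s - (s - 1) * Bs f s

lemma eu_mul (f g : ℝ[X]) : eu (f * g) = eu f * g + f * eu g := by
  unfold eu; rw [derivative_mul]; ring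

lemma eu_pow (f : ℝ[X]) (m : ℕ) : eu (f ^ (m + 1)) = ((m : ℝ[X]) + 1) * f ^ m * eu f := by
  unfold eu; rw [derivative_pow_succ]; push_cast; ring_nf; simp; ring

lemma step_eqs (l : ℕ) (f : ℝ[X]) (s : ℝ) :
    ∃ a, s * Gs (pstep (l + 2) f) s = Gs f s ^ (l + 2) + (s - 1) * a ∧
      s * (Gs (pstep (l + 2) f) s + Bs (pstep (l + 2) f) s)
        = (l + 2) * Gs f s ^ (l + 1) * Bs f s + s * a ∧
      s * (Gs (pstep (l + 2) f) s + 2 * Bs (pstep (l + 2) f) s + Vs (pstep (l + 2) f) s)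
        = (l + 2) * (l + 1) * Gs f s ^ l * Bs f s ^ 2 + (l + 2) * Gs f s ^ (l + 1) * Vs f s + s * a := by
  refine ⟨(f ^ (l + 2)).coeff 0, ?_⟩
  set h := pstep (l + 2) f
  set a := (f ^ (l + 2)).coeff 0
  have e0 : X * h = f ^ (l + 1 + 1) + (X - 1) * C a := X_mul_pstep (l + 2) f
  have e1 : eu (X * h) = eu (f ^ (l + 1 + 1) + (X - 1) * C a) := by rw [e0]
  have add : ∀ p q : ℝ[X], eu (p + q) = eu p + eu q := fun p q => by
    unfold eu; rw [derivative_add]; ring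
  have euX : eu X = X := by simp [eu]
  have euXC : eu ((X - 1) * C a) = X * C a := by simp [eu]
  have euC : eu (X * C a) = X * C a := by simp [eu]
  rw [add, euXC, eu_mul, euX, eu_pow] at e1
  have e2 : eu (X * h + X * eu h) = eu ((((l + 1 : ℕ) : ℝ[X]) + 1) * f ^ (l + 1) * eu f + X * C a) := by
    rw [e1]
  have eucast : eu ((((l + 1 : ℕ) : ℝ[X]) + 1)) = 0 := by simp [eu]
  rw [add, add, euC, eu_mul, eu_mul, euX, eu_mul, eu_mul, eucast, eu_pow] at e2
  have E0 := congrArg (eval s) e0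
  have E1 := congrArg (eval s) e1
  have E2 := congrArg (eval s) e2
  simp only [eval_mul, eval_add, eval_X, eval_pow, eval_sub, eval_one, eval_C, eval_natCast,
    eval_zero] at E0 E1 E2
  push_cast at E1 E2
  unfold Gs Bs Vs
  refine ⟨by linear_combination E0, by linear_combination E1, by linear_combination E2⟩

lemma D_step (l : ℕ) (f : ℝ[X]) (s : ℝ) :
    s * Ds (pstep (l + 2) f) s =
      Gs f s ^ (l + 1) * (s * Ds f s - (s - 1) * (((l : ℝ) + 2) - s) * Bs f s) := by
  obtain ⟨a, h0, h1, h2⟩ := step_eqs l f s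
  unfold Ds
  have : s * (Gs (pstep (l + 2) f) s - (s - 1) * Bs (pstep (l + 2) f) s)
    = s * (s * Gs (pstep (l + 2) f) s) - (s - 1) * (s * (Gs (pstep (l + 2) f) s + Bs (pstep (l + 2) f) s)) := by
    ring
  rw [this, h0, h1]; ring

lemma A_step (l : ℕ) (f : ℝ[X]) (s : ℝ) :
    s * As (pstep (l + 2) f) s =
      (l + 2) * (Gs f s ^ l * ((l + 1) * Bs f s ^ 2 + Gs f s * (Vs f s - Bs f s))) := by
  obtain ⟨a, h0, h1, h2⟩ := step_eqs l f s
  unfold As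
  have : s * (Vs (pstep (l + 2) f) s + Bs (pstep (l + 2) f) s)
    = s * (Gs (pstep (l + 2) f) s + 2 * Bs (pstep (l + 2) f) s + Vs (pstep (l + 2) f) s)
      - (s * (Gs (pstep (l + 2) f) s + Bs (pstep (l + 2) f) s)) := by
    ring
  rw [this, h2, h1]; ring

/-! sum forms -/
def nn (f : ℝ[X]) : ℕ := f.natDegree + 1
def ex (f : ℝ[X]) (φ : ℕ → ℝ) : ℝ := ∑ k ∈ Finset.range (nn f), f.coeff k * φ k

lemma Gs_eq (f : ℝ[X]) (s : ℝ) : Gs f s = ex f (fun k => s ^ k) := by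
  unfold Gs ex; exact eval_eq_sum_range' (Nat.lt_succ_self _) s

lemma Bs_eq (f : ℝ[X]) (s : ℝ) : Bs f s = ex f (fun k => k * s ^ k) := by
  unfold Bs ex; rw [eval_eq_sum_range' (eu_natDegree f (nn f) (Nat.lt_succ_self _)) s]
  refine Finset.sum_congr rfl fun k _ => ?_
  rw [eu_coeff]; ring

lemma Vs_eq (f : ℝ[X]) (s : ℝ) : Vs f s = ex f (fun k => (k:ℝ) ^ 2 * s ^ k) := by
  unfold Vs ex
  rw [eval_eq_sum_range' (eu_natDegree _ (nn f) (eu_natDegree f (nn f) (Nat.lt_succ_self _))) s]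
  refine Finset.sum_congr rfl fun k _ => ?_
  rw [eu_coeff, eu_coeff]; ring

lemma one_eq {f : ℝ[X]} (hf : Law f) : ex f (fun _ => 1) = 1 := by
  have h := hf.2
  rw [eval_one_eq f (nn f) (Nat.lt_succ_self _)] at h
  simpa [ex] using h

lemma ex_le {f : ℝ[X]} (hf : Law f) {φ ψ : ℕ → ℝ} (h : ∀ k, φ k ≤ ψ k) : ex f φ ≤ ex f ψ :=
  Finset.sum_le_sum fun k _ => mul_le_mul_of_nonneg_left (h k) (hf.1 k)

lemma ex_nonneg {f : ℝ[X]} (hf : Law f) {φ : ℕ → ℝ} (h : ∀ k, 0 ≤ φ k) : 0 ≤ ex f φ :=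
  Finset.sum_nonneg fun k _ => mul_nonneg (hf.1 k) (h k)

lemma ex_add (f : ℝ[X]) (φ ψ : ℕ → ℝ) : ex f (fun k => φ k + ψ k) = ex f φ + ex f ψ := by
  unfold ex; rw [← Finset.sum_add_distrib]; exact Finset.sum_congr rfl fun k _ => by ring

lemma ex_sub (f : ℝ[X]) (φ ψ : ℕ → ℝ) : ex f (fun k => φ k - ψ k) = ex f φ - ex f ψ := by
  unfold ex; rw [← Finset.sum_sub_distrib]; exact Finset.sum_congr rfl fun k _ => by ring

lemma ex_mul (f : ℝ[X]) (c : ℝ) (φ : ℕ → ℝ) : ex f (fun k => c * φ k) = c * ex f φ := by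
  unfold ex; rw [Finset.mul_sum]; exact Finset.sum_congr rfl fun k _ => by ring

lemma ex_const {f : ℝ[X]} (hf : Law f) (c : ℝ) : ex f (fun _ => c) = c := by
  have := ex_mul f c (fun _ => 1)
  simpa [one_eq hf] using this

lemma ex_zero {f : ℝ[X]} : ex f (fun k => if k = 0 then 1 else 0) = f.coeff 0 := by
  unfold ex; simp [nn]

def us (f : ℝ[X]) : ℝ := 1 - f.coeff 0
def Zs (f : ℝ[X]) (s : ℝ) : ℝ := ex f (fun k => if 2 ≤ k then s ^ k else 0)
def cs (s : ℝ) (k : ℕ) : ℝ := (s - 1) * k * s ^ k - s ^ k + 1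

lemma us_eq {f : ℝ[X]} (hf : Law f) : us f = ex f (fun k => if k = 0 then 0 else 1) := by
  have : (fun k : ℕ => if k = 0 then (0:ℝ) else 1) = fun k => 1 - (if k = 0 then 1 else 0) := by
    funext k; split_ifs <;> simp
  rw [this, ex_sub, one_eq hf, ex_zero]; rfl

lemma us_nonneg {f : ℝ[X]} (hf : Law f) : 0 ≤ us f := by
  rw [us_eq hf]; exact ex_nonneg hf fun k => by split_ifs <;> norm_num

lemma Z_nonneg {f : ℝ[X]} (hf : Law f) {s : ℝ} (hs : 0 ≤ s) : 0 ≤ Zs f s :=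
  ex_nonneg hf fun k => by split_ifs <;> positivity

lemma cs_nonneg {s : ℝ} (hs : 1 ≤ s) (k : ℕ) : 0 ≤ cs s k := by
  induction k with
  | zero => simp [cs]
  | succ k ih =>
    have : cs s (k + 1) = cs s k + (s - 1) ^ 2 * (k + 1) * s ^ k := by
      unfold cs; push_cast; ring
    rw [this]
    have : 0 ≤ s := by linarith
    positivity

lemma one_sub_D {f : ℝ[X]} (hf : Law f) (s : ℝ) : 1 - Ds f s = ex f (cs s) := by
  have : cs s = fun k : ℕ => ((s - 1) * (k * s ^ k) - s ^ k) + 1 := by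
    funext k; unfold cs; ring
  rw [this, ex_add, ex_sub, ex_mul, one_eq hf, ← Gs_eq, ← Bs_eq]; unfold Ds; ring

lemma D_le_one {f : ℝ[X]} (hf : Law f) {s : ℝ} (hs : 1 ≤ s) : Ds f s ≤ 1 := by
  have := one_sub_D hf s
  have h2 := ex_nonneg hf (cs_nonneg hs)
  linarith

lemma G_le {f : ℝ[X]} (hf : Law f) {s m : ℝ} (hs : 3 / 2 ≤ s) (hsm : s ≤ m) :
    Gs f s ≤ m ^ 4 + (1 - Ds f s) := by
  rw [one_sub_D hf, Gs_eq, ← ex_const hf (m ^ 4), ← ex_add]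
  refine ex_le hf fun k => ?_
  rcases le_or_gt k 4 with h | h
  · have h1 : s ^ k ≤ s ^ 4 := pow_le_pow_right₀ (by linarith) h
    have h2 : s ^ 4 ≤ m ^ 4 := pow_le_pow_left₀ (by linarith) hsm 4
    have := cs_nonneg (by linarith : 1 ≤ s) k
    linarith
  · have h1 : 0 ≤ s ^ k := by positivity
    have hk : (5:ℝ) ≤ k := by exact_mod_cast h
    have hm4 : 0 ≤ m ^ 4 := by positivity
    unfold cs
    have : 2 ≤ (s - 1) * k := by nlinarith
    nlinarith

lemma G_ge {f : ℝ[X]} (hf : Law f) {s : ℝ} (hs : 1 ≤ s) : 1 + (s - 1) * us f ≤ Gs f s := by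
  have h1 := ex_add f (fun _ => 1) (fun k => (s - 1) * (if k = 0 then 0 else 1))
  rw [ex_mul, one_eq hf, ← us_eq hf] at h1
  rw [← h1, Gs_eq]
  refine ex_le hf fun k => ?_
  split_ifs with h
  · simp [h]
  · have : s ^ 1 ≤ s ^ k := pow_le_pow_right₀ hs (by omega)
    linarith

lemma B_nonneg {f : ℝ[X]} (hf : Law f) {s : ℝ} (hs : 0 ≤ s) : 0 ≤ Bs f s := by
  rw [Bs_eq]; exact ex_nonneg hf fun k => by positivity

lemma B_le_V {f : ℝ[X]} (hf : Law f) {s : ℝ} (hs : 0 ≤ s) : Bs f s ≤ Vs f s := by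
  rw [Bs_eq, Vs_eq]
  refine ex_le hf fun k => mul_le_mul_of_nonneg_right ?_ (by positivity)
  rcases Nat.eq_zero_or_pos k with h | h
  · simp [h]
  · have : (1:ℝ) ≤ k := by exact_mod_cast h
    nlinarith

/-! pair inequality -/
def Tp (s : ℝ) (j k : ℕ) : ℝ :=
  (s - 1) * ((s ^ j - 1) * (k ^ 2 * s ^ k) + (s ^ k - 1) * (j ^ 2 * s ^ j))
    - (j * s ^ j * cs s k + k * s ^ k * cs s j)

lemma Tp_symm (s : ℝ) (j k : ℕ) : Tp s j k = Tp s k j := by unfold Tp; ring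

lemma pow_lower {s : ℝ} (hs : 1 ≤ s) (k : ℕ) :
    1 + (s - 1) * (k + 2 : ℕ) ≤ s ^ k * (2 * s - 1) := by
  induction k with
  | zero => simp; linarith
  | succ k ih =>
    have e : s ^ (k + 1) * (2 * s - 1) = s * (s ^ k * (2 * s - 1)) := by ring
    rw [e]
    push_cast at ih ⊢
    have : (0:ℝ) ≤ k := by positivity
    nlinarith [mul_le_mul_of_nonneg_left ih (by linarith : 0 ≤ s), mul_nonneg (sq_nonneg (s-1)) this, sq_nonneg (s-1)]

lemma Tp_ge_aux {s : ℝ} (hs : 1 ≤ s) (j d : ℕ) (hk : 2 ≤ j + d) :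
    (s - 1) ^ 2 / s ^ 2 * j * s ^ j * s ^ (j + d) ≤ Tp s j (j + d) := by
  have h1 : 1 + (j:ℝ) * (s - 1) ≤ s ^ j := by
    have := one_add_mul_le_pow (by linarith : -2 ≤ s - 1) j
    simpa using this
  have h2 := cs_nonneg hs d
  have h3 : (s - 1) ^ 2 / s ^ 2 * s ^ (j + d) ≤ s ^ (j + d) - 1 - (s - 1) * (j + d) := by
    obtain ⟨k, hk'⟩ : ∃ k, j + d = k + 2 := ⟨j + d - 2, by omega⟩
    have hc : (j:ℝ) + d = (k + 2 : ℕ) := by rw [← hk']; push_cast; ring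
    rw [hc, hk', pow_add]
    have := pow_lower hs k
    have e : (s - 1) ^ 2 / s ^ 2 * (s ^ k * s ^ 2) = (s - 1) ^ 2 * s ^ k := by
      field_simp
    rw [e]; linarith
  unfold cs at h2
  unfold Tp cs
  rw [pow_add] at h3 ⊢
  set a := s ^ j
  set b := s ^ d
  have ha : 1 ≤ a := one_le_pow₀ hs
  have hb : 1 ≤ b := one_le_pow₀ hs
  push_cast
  set J := (j:ℝ)
  set E := (d:ℝ)
  have hJ : 0 ≤ J := by positivity
  have hE : 0 ≤ E := by positivity
  set c0 := (s - 1) ^ 2 / s ^ 2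
  set e := s - 1
  have he : 0 ≤ e := by simp only [e]; linarith
  have k1 : 0 ≤ J * a * (a * b - 1 - e * (J + E) - c0 * (a * b)) := by
    apply mul_nonneg (by positivity); linarith
  have k2 : 0 ≤ J * a * (e * E) * (e * E * b - b + 1) := mul_nonneg (by positivity) h2
  have k3 : 0 ≤ (a - 1 - J * e) * (e * E ^ 2 * (a * b) + (J + E) * (a * b)) := by
    apply mul_nonneg (by linarith); positivity
  nlinarith [k1, k2, k3]

lemma Tp_ge {s : ℝ} (hs : 1 ≤ s) (j k : ℕ) (hj : 1 ≤ j) (hk : 2 ≤ k) :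
    (s - 1) ^ 2 / s ^ 2 * s ^ k ≤ Tp s j k := by
  have key : ∀ j k : ℕ, 1 ≤ j → j ≤ k → 2 ≤ k →
      (s - 1) ^ 2 / s ^ 2 * s ^ j * s ^ k ≤ Tp s j k := by
    intro j k hj hjk hk
    obtain ⟨d, rfl⟩ := Nat.exists_eq_add_of_le hjk
    refine le_trans ?_ (Tp_ge_aux hs j d hk)
    have : (1:ℝ) ≤ j := by exact_mod_cast hj
    have h0 : 0 ≤ (s - 1) ^ 2 / s ^ 2 * s ^ j * s ^ (j + d) := by positivity
    nlinarith
  have hc : 0 ≤ (s - 1) ^ 2 / s ^ 2 := by positivity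
  rcases le_total j k with h | h
  · refine le_trans ?_ (key j k hj h hk)
    have : 1 ≤ s ^ j := one_le_pow₀ hs
    have h2 : 0 ≤ s ^ k := by positivity
    nlinarith [mul_nonneg (mul_nonneg hc h2) (sub_nonneg.2 this)]
  · rw [Tp_symm]
    refine le_trans ?_ (key k j (by omega) h (by omega))
    have : 1 ≤ s ^ j := one_le_pow₀ hs
    have h2 : 0 ≤ s ^ k := by positivity
    nlinarith [mul_nonneg (mul_nonneg hc h2) (sub_nonneg.2 this)]

lemma Tp_nonneg {s : ℝ} (hs : 1 ≤ s) (j k : ℕ) : 0 ≤ Tp s j k := by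
  have key : ∀ j k : ℕ, j ≤ k → 0 ≤ Tp s j k := by
    intro j k hjk
    rcases Nat.eq_zero_or_pos j with rfl | hj
    · simp [Tp, cs]
    · rcases Nat.lt_or_ge k 2 with hk | hk
      · have : j = 1 := by omega
        have : k = 1 := by omega
        subst_vars
        simp [Tp, cs]; ring_nf; nlinarith
      · exact le_trans (by positivity) (Tp_ge hs j k hj hk)
  rcases le_total j k with h | h
  · exact key j k h
  · rw [Tp_symm]; exact key k j h

lemma F4 {f : ℝ[X]} (hf : Law f) {s : ℝ} (hs : 1 ≤ s) :
    Bs f s * (1 - Ds f s) + (s - 1) ^ 2 / s ^ 2 / 2 * (us f * Zs f s)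
      ≤ (s - 1) * (Gs f s - 1) * Vs f s := by
  have hx : Gs f s - 1 = ex f (fun k => s ^ k - 1) := by
    rw [ex_sub, one_eq hf, Gs_eq]
  have prod : ∀ φ ψ : ℕ → ℝ, ex f φ * ex f ψ = ∑ j ∈ Finset.range (nn f), ∑ k ∈ Finset.range (nn f),
      f.coeff j * f.coeff k * (φ j * ψ k) := by
    intro φ ψ
    unfold ex
    rw [Finset.sum_mul_sum]
    exact Finset.sum_congr rfl fun j _ => Finset.sum_congr rfl fun k _ => by ring
  have prod' : ∀ φ ψ : ℕ → ℝ, ex f φ * ex f ψ = ∑ j ∈ Finset.range (nn f), ∑ k ∈ Finset.range (nn f),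
      f.coeff j * f.coeff k * (φ k * ψ j) := by
    intro φ ψ
    rw [prod, Finset.sum_comm]
    exact Finset.sum_congr rfl fun j _ => Finset.sum_congr rfl fun k _ => by ring
  have main : 2 * ((s - 1) * (Gs f s - 1) * Vs f s - Bs f s * (1 - Ds f s)) =
      ∑ j ∈ Finset.range (nn f), ∑ k ∈ Finset.range (nn f), f.coeff j * f.coeff k * Tp s j k := by
    have e1 : 2 * ((s - 1) * (Gs f s - 1) * Vs f s - Bs f s * (1 - Ds f s)) =
       (s - 1) * ((Gs f s - 1) * Vs f s + (Gs f s - 1) * Vs f s)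
         - (Bs f s * (1 - Ds f s) + Bs f s * (1 - Ds f s)) := by ring
    rw [e1]
    nth_rw 1 [hx, Vs_eq, prod]
    nth_rw 1 [hx, Vs_eq, prod']
    nth_rw 1 [Bs_eq, one_sub_D hf, prod]
    nth_rw 1 [Bs_eq, one_sub_D hf, prod']
    simp only [Finset.mul_sum, ← Finset.sum_add_distrib, ← Finset.sum_sub_distrib]
    refine Finset.sum_congr rfl fun j _ => Finset.sum_congr rfl fun k _ => ?_
    unfold Tp; ring
  have low : (s - 1) ^ 2 / s ^ 2 * (us f * Zs f s) ≤
      ∑ j ∈ Finset.range (nn f), ∑ k ∈ Finset.range (nn f), f.coeff j * f.coeff k * Tp s j k := by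
    rw [us_eq hf, Zs, prod, Finset.mul_sum]
    refine Finset.sum_le_sum fun j _ => ?_
    rw [Finset.mul_sum]
    refine Finset.sum_le_sum fun k _ => ?_
    have hp : 0 ≤ f.coeff j * f.coeff k := mul_nonneg (hf.1 j) (hf.1 k)
    have : (s - 1) ^ 2 / s ^ 2 * ((if j = 0 then (0:ℝ) else 1) * if 2 ≤ k then s ^ k else 0) ≤ Tp s j k := by
      by_cases hj : j = 0
      · simp [hj, Tp_nonneg hs]
      · by_cases hk : 2 ≤ k
        · simpa [hj, hk] using Tp_ge hs j k (by omega) hk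
        · simp [hk, Tp_nonneg hs]
    nlinarith
  linarith

lemma A_bound {f : ℝ[X]} (hf : Law f) {s M C0 : ℝ} (hs : 0 ≤ s) (hsM : s < M)
    (h : ∀ k, f.coeff k * M ^ k ≤ C0) : As f s ≤ 2 * C0 * M ^ 3 / (M - s) ^ 3 := by
  have hM : 0 < M := lt_of_le_of_lt hs hsM
  have hC0 : 0 ≤ C0 := le_trans (by have := hf.1 0; simpa using this) (h 0)
  set r := s / M
  have hr0 : 0 ≤ r := by positivity
  have hr1 : r < 1 := (div_lt_one hM).2 hsM
  have hS := hasSum_choose_mul_geometric_of_norm_lt_one 2 (r := r) (by rwa [Real.norm_of_nonneg hr0])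
  unfold As
  rw [Vs_eq, Bs_eq, ← ex_add]
  have h1 : ∀ k, f.coeff k * ((k:ℝ) ^ 2 * s ^ k + k * s ^ k) ≤ 2 * C0 * (((k + 2).choose 2 : ℕ) * r ^ k) := by
    intro k
    have e1 : s ^ k = M ^ k * r ^ k := by rw [← mul_pow]; congr 1; simp only [r]; field_simp
    have e2 : (((k + 2).choose 2 : ℕ) : ℝ) = (k + 2) * (k + 1) / 2 := by
      rw [Nat.cast_choose_two]; push_cast; ring
    rw [e1, e2]
    have hrk : 0 ≤ r ^ k := by positivity
    have hk : (0:ℝ) ≤ k := by positivity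
    calc f.coeff k * ((k:ℝ) ^ 2 * (M ^ k * r ^ k) + k * (M ^ k * r ^ k))
        = (f.coeff k * M ^ k) * ((k ^ 2 + k) * r ^ k) := by ring
      _ ≤ C0 * ((k ^ 2 + k) * r ^ k) := mul_le_mul_of_nonneg_right (h k) (by positivity)
      _ ≤ C0 * (((k + 2) * (k + 1)) * r ^ k) := by
          apply mul_le_mul_of_nonneg_left _ hC0
          apply mul_le_mul_of_nonneg_right _ hrk
          nlinarith
      _ = _ := by ring
  calc ex f (fun k => (k:ℝ) ^ 2 * s ^ k + k * s ^ k)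
      ≤ ∑ k ∈ Finset.range (nn f), 2 * C0 * (((k + 2).choose 2 : ℕ) * r ^ k) :=
        Finset.sum_le_sum fun k _ => h1 k
    _ = 2 * C0 * ∑ k ∈ Finset.range (nn f), (((k + 2).choose 2 : ℕ) * r ^ k) := by rw [Finset.mul_sum]
    _ ≤ 2 * C0 * (1 / (1 - r) ^ (2 + 1)) := by
        apply mul_le_mul_of_nonneg_left _ (by positivity)
        exact sum_le_hasSum _ (fun k _ => by positivity) hS
    _ = _ := by
        have : 1 - r = (M - s) / M := by simp only [r]; field_simp
        rw [this, div_pow]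
        have : M - s ≠ 0 := by linarith
        field_simp
        ring

/-- growth factor -/
def fac (η γ : ℝ) (f : ℝ[X]) : ℝ := open Classical in if η ≤ us f then 1 + γ else 1

lemma fac_le_G {f : ℝ[X]} (hf : Law f) {s η γ : ℝ} (hs : 3 / 2 ≤ s) (h : γ ≤ η / 2) (l : ℕ) :
    fac η γ f ≤ Gs f s ^ (l + 1) := by
  have h1 := G_ge hf (by linarith : 1 ≤ s)
  have h2 := us_nonneg hf
  have h3 : 1 + us f / 2 ≤ Gs f s := by nlinarith
  have h4 : Gs f s ^ 1 ≤ Gs f s ^ (l + 1) := pow_le_pow_right₀ (by linarith) (by omega)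
  rw [pow_one] at h4
  unfold fac
  split_ifs with hh <;> linarith

lemma one_le_fac {η γ : ℝ} (h : 0 ≤ γ) (f : ℝ[X]) : 1 ≤ fac η γ f := by
  unfold fac; split_ifs <;> linarith

lemma down_step {f : ℝ[X]} (hf : Law f) {s η γ : ℝ} (l : ℕ) (hs : 3 / 2 ≤ s) (hsM : s ≤ (l:ℝ) + 2)
    (h : γ ≤ η / 2) (hD : Ds f s ≤ 0) : Ds (pstep (l + 2) f) s ≤ fac η γ f * Ds f s := by
  have h1 := D_step l f s
  have h2 := fac_le_G hf hs h l
  have hB := B_nonneg hf (by linarith : 0 ≤ s)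
  have hG : 1 ≤ Gs f s := by
    have h1 := G_ge hf (by linarith : 1 ≤ s)
    have h2 := us_nonneg hf
    nlinarith
  have h3 : s * Ds (pstep (l + 2) f) s ≤ s * (Gs f s ^ (l + 1) * Ds f s) := by
    rw [h1]
    have : 0 ≤ Gs f s ^ (l + 1) * ((s - 1) * (((l : ℝ) + 2) - s) * Bs f s) := by
      apply mul_nonneg (by positivity)
      apply mul_nonneg (mul_nonneg (by linarith) (by linarith)) hB
    nlinarith
  have h4 : Ds (pstep (l + 2) f) s ≤ Gs f s ^ (l + 1) * Ds f s :=
    le_of_mul_le_mul_left h3 (by linarith)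
  nlinarith

lemma up_step {f : ℝ[X]} (hf : Law f) {s CG : ℝ} (l : ℕ) (hs : 3 / 2 ≤ s) (hsM : s ≤ (l:ℝ) + 2)
    (hCG : ((l:ℝ) + 2) ^ 4 + 2 ≤ CG) (hD : 0 ≤ Ds f s) :
    Gs f s ^ (l + 1) * Ds f s - CG ^ (l + 2) * ((l:ℝ) + 2 - s) ≤ Ds (pstep (l + 2) f) s := by
  have h1 := D_step l f s
  have hB := B_nonneg hf (by linarith : 0 ≤ s)
  have hG : 1 ≤ Gs f s := by
    have h1 := G_ge hf (by linarith : 1 ≤ s)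
    have h2 := us_nonneg hf
    nlinarith
  have hGC : Gs f s ≤ CG := by
    have := G_le hf hs hsM; linarith
  have hGp : Gs f s ^ (l + 2) ≤ CG ^ (l + 2) := pow_le_pow_left₀ (by linarith) hGC _
  have hth : 0 ≤ (l:ℝ) + 2 - s := by linarith
  have e : (s - 1) * Bs f s = Gs f s - Ds f s := by unfold Ds; ring
  have h2 : s * Ds (pstep (l + 2) f) s = s * (Gs f s ^ (l + 1) * Ds f s)
      - ((l:ℝ) + 2 - s) * (Gs f s ^ (l + 1) * (Gs f s - Ds f s)) := by
    rw [h1, ← e]; ring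
  have h3 : Gs f s ^ (l + 1) * (Gs f s - Ds f s) ≤ CG ^ (l + 2) := by
    refine le_trans ?_ hGp
    rw [pow_succ (Gs f s) (l + 1)]
    apply mul_le_mul_of_nonneg_left _ (by positivity); linarith
  have h4 : ((l:ℝ) + 2 - s) * (Gs f s ^ (l + 1) * (Gs f s - Ds f s)) ≤
      s * (CG ^ (l + 2) * ((l:ℝ) + 2 - s)) := by
    have h5 : 0 ≤ CG ^ (l + 2) := by
      have : 0 ≤ CG := by linarith
      positivity
    have := mul_le_mul_of_nonneg_left h3 hth
    nlinarith [mul_nonneg h5 hth]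
  have hs0 : 0 < s := by linarith
  refine le_of_mul_le_mul_left ?_ hs0
  rw [h2]; linarith

lemma up_step_fac {f : ℝ[X]} (hf : Law f) {s CG η γ κ : ℝ} (l : ℕ) (hs : 3 / 2 ≤ s)
    (hsM : s ≤ (l:ℝ) + 2) (hCG : ((l:ℝ) + 2) ^ 4 + 2 ≤ CG) (hκ : 0 < κ) (hγ0 : 0 ≤ γ)
    (h : γ ≤ η / 2) (hD : κ / 2 ≤ Ds f s) :
    (1 - 2 * CG ^ (l + 2) * ((l:ℝ) + 2 - s) / κ) * (fac η γ f * Ds f s)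
      ≤ Ds (pstep (l + 2) f) s := by
  refine le_trans ?_ (up_step hf l hs hsM hCG (by linarith))
  have h2 := fac_le_G hf hs h l
  have h3 := one_le_fac (η := η) hγ0 f
  have hD0 : 0 ≤ Ds f s := by linarith
  have hCG0 : 0 ≤ CG := le_trans (by positivity) hCG
  have hth : 0 ≤ (l:ℝ) + 2 - s := by linarith
  set Q := CG ^ (l + 2) * ((l:ℝ) + 2 - s)
  have hQ : 0 ≤ Q := by positivity
  have e : 2 * CG ^ (l + 2) * ((l:ℝ) + 2 - s) / κ = 2 * Q / κ := by simp only [Q]; ring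
  rw [e]
  have h4 : Q ≤ 2 * Q / κ * (fac η γ f * Ds f s) := by
    calc Q = 2 * Q / κ * (1 * (κ / 2)) := by field_simp
      _ ≤ 2 * Q / κ * (fac η γ f * Ds f s) := by gcongr
  nlinarith

lemma ex_two {f : ℝ[X]} (φ : ℕ → ℝ) : ex f φ =
    ∑ k ∈ Finset.range f.natDegree, f.coeff (k + 2) * φ (k + 2) + f.coeff 1 * φ 1 + f.coeff 0 * φ 0 := by
  have : ex f φ = ∑ k ∈ Finset.range (f.natDegree + 1 + 1), f.coeff k * φ k := by
    rw [Finset.sum_range_succ, coeff_eq_zero_of_natDegree_lt (Nat.lt_succ_self _)]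
    simp [ex, nn]
  rw [this, Finset.sum_range_succ', Finset.sum_range_succ']

lemma tl_two {f : ℝ[X]} (hf : Law f) : tl f 2 = ex f (fun k => if 2 ≤ k then 1 else 0) := by
  have h1 := one_eq hf
  rw [ex_two] at h1 ⊢
  unfold tl
  rw [lowN_eq hf.1, Finset.sum_range_succ, Finset.sum_range_one]
  simp at h1 ⊢
  linarith

lemma tl_le_Z {f : ℝ[X]} (hf : Law f) {s : ℝ} (hs : 1 ≤ s) : tl f 2 ≤ Zs f s := by
  rw [tl_two hf]
  refine ex_le hf fun k => ?_
  split_ifs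
  · exact one_le_pow₀ hs
  · exact le_rfl

lemma Z_lower {f : ℝ[X]} (hf : Law f) {s ρ κ V1 : ℝ} (hs : 1 ≤ s) (hs2 : s ≤ 2)
    (hρ : 0 < ρ) (hκ : κ ≤ ρ / 2) (hV1 : 0 < V1) (hV : Vs f s ≤ V1) (hD : Ds f s ≤ κ)
    (hq : ρ ≤ f.coeff 0) : ρ ^ 2 / (16 * V1) ≤ Zs f s := by
  set W := ex f (fun k => if 2 ≤ k then k * s ^ k else 0) with hW
  have hW0 : 0 ≤ W := ex_nonneg hf fun k => by split_ifs <;> positivity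
  have h1 : f.coeff 0 - (s - 1) * W ≤ Ds f s := by
    rw [Ds, Gs_eq, Bs_eq, ← ex_zero, hW, ← ex_mul, ← ex_mul, ← ex_sub, ← ex_sub]
    refine ex_le hf fun k => ?_
    rcases k with _ | _ | k
    · simp
    · simp; nlinarith
    · have : 0 ≤ s ^ (k + 1 + 1) := by positivity
      simp [this]
  have h2 : ρ / 2 ≤ W := by nlinarith
  set lam := ρ / (4 * V1) with hlam
  have hl0 : 0 < lam := by positivity
  have h3 : W ≤ lam * Vs f s + 1 / lam * Zs f s := by
    rw [hW, Vs_eq, Zs, ← ex_mul, ← ex_mul, ← ex_add]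
    refine ex_le hf fun k => ?_
    have hsk : 0 ≤ s ^ k := by positivity
    split_ifs
    · have : (k:ℝ) ≤ lam * k ^ 2 + 1 / lam := by
        have e : lam * (k:ℝ) ^ 2 + 1 / lam - k = ((lam * k - 1) ^ 2 + lam * k) / lam := by field_simp; ring
        have : 0 ≤ ((lam * k - 1) ^ 2 + lam * k) / lam := by positivity
        linarith
      nlinarith
    · have : 0 ≤ lam * ((k:ℝ) ^ 2 * s ^ k) := by positivity
      linarith
  have h4 : lam * Vs f s ≤ ρ / 4 := by
    calc lam * Vs f s ≤ lam * V1 := by gcongr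
      _ = ρ / 4 := by simp only [lam]; field_simp
  have h5 : ρ / 4 ≤ 1 / lam * Zs f s := by linarith
  have h6 : lam * (ρ / 4) ≤ Zs f s := by
    calc lam * (ρ / 4) ≤ lam * (1 / lam * Zs f s) := by gcongr
      _ = Zs f s := by field_simp
  calc ρ ^ 2 / (16 * V1) = lam * (ρ / 4) := by simp only [lam]; field_simp; ring
    _ ≤ _ := h6

lemma c0_lower {s : ℝ} (hs : 3 / 2 ≤ s) (hs2 : s ≤ 2) : 1 / 32 ≤ (s - 1) ^ 2 / s ^ 2 / 2 := by
  rw [div_div, div_le_div_iff₀ (by norm_num) (by positivity)]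
  nlinarith

lemma gam_le {η ρ CG : ℝ} (hη : 0 < η) (hη1 : η ≤ 1) (hρ : 0 < ρ) (hρ1 : ρ ≤ 1) (hCG : 1 ≤ CG) :
    ρ ^ 2 * η ^ 3 / (2 ^ 18 * CG ^ 2) ≤ η ^ 2 / 8 := by
  rw [div_le_div_iff₀ (by positivity) (by norm_num)]
  have h1 : ρ ^ 2 ≤ 1 := pow_le_one₀ hρ.le hρ1
  have h2 : η ^ 3 ≤ η ^ 2 := pow_le_pow_of_le_one hη.le hη1 (by norm_num)
  have h3 : ρ ^ 2 * η ^ 3 ≤ 1 * η ^ 2 := by gcongr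
  have h4 : (1:ℝ) ≤ CG ^ 2 := one_le_pow₀ (by linarith)
  nlinarith [sq_nonneg η]

lemma bern_two {x : ℝ} (hx : 0 ≤ x) (l : ℕ) :
    1 + ((l + 1 : ℕ) + 1 : ℝ) * x + x ^ 2 ≤ (1 + x) ^ (l + 1 + 1) := by
  have := one_add_mul_le_pow (by linarith : -2 ≤ x) l
  have e3 : (1 + x) ^ (l + 1 + 1) = (1 + x) ^ l * (1 + x) ^ 2 := by ring
  rw [e3]
  have hl' : (0:ℝ) ≤ l := by positivity
  have : (1 + (l:ℝ) * x) * (1 + x) ^ 2 ≤ (1 + x) ^ l * (1 + x) ^ 2 :=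
    mul_le_mul_of_nonneg_right this (by positivity)
  refine le_trans ?_ this
  push_cast
  nlinarith [mul_nonneg hl' (pow_nonneg hx 2), mul_nonneg hl' (pow_nonneg hx 3)]

set_option maxHeartbeats 1000000 in
lemma mid_step {f : ℝ[X]} (hf : Law f) {s CG η ρ κ : ℝ} (l : ℕ) (hs : 3 / 2 ≤ s)
    (hsM : s ≤ (l:ℝ) + 2) (hCG : ((l:ℝ) + 2) ^ 4 + 2 ≤ CG) (hκ : 0 < κ) (hκ2 : κ ≤ 1 / 2)
    (hη : 0 < η) (hη1 : η ≤ 1) (hρ : 0 < ρ) (hρ1 : ρ ≤ 1) (hκρ : κ ≤ ρ / 2)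
    (hcond : l = 0 → ρ ≤ f.coeff 0 ∨ ρ ≤ tl f 2) (hD : |Ds f s| ≤ κ) :
    (1 - (1 + CG ^ l) * κ) * (fac η (ρ ^ 2 * η ^ 3 / (2 ^ 18 * CG ^ 2)) f * As f s)
      ≤ As (pstep (l + 2) f) s := by
  set γ := ρ ^ 2 * η ^ 3 / (2 ^ 18 * CG ^ 2) with hγ
  obtain ⟨hD1, hD2⟩ := abs_le.1 hD
  have hs0 : 0 ≤ s := by linarith
  have hs1 : 1 ≤ s := by linarith
  have hl : (0:ℝ) ≤ l := by positivity
  have hCG1 : 18 ≤ CG := by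
    have : (2:ℝ) ^ 4 ≤ ((l:ℝ) + 2) ^ 4 := pow_le_pow_left₀ (by norm_num) (by linarith) 4
    linarith
  have hB := B_nonneg hf hs0
  have hBV := B_le_V hf hs0
  have hV : 0 ≤ Vs f s := hB.trans hBV
  have hu := us_nonneg hf
  have hGg := G_ge hf hs1
  have hG1 : 1 + us f / 2 ≤ Gs f s := by nlinarith
  have hG : 1 ≤ Gs f s := by linarith
  have hGC : Gs f s ≤ CG := by
    have := G_le hf hs hsM; linarith
  have e : (s - 1) * Bs f s = Gs f s - Ds f s := by unfold Ds; ring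
  have hBC : Bs f s ≤ 4 * CG := by nlinarith
  have hGl : Gs f s ^ l ≤ CG ^ l := pow_le_pow_left₀ (by linarith) hGC _
  have hGl1 : 1 ≤ Gs f s ^ l := one_le_pow₀ hG
  -- step
  have st := A_step l f s
  have hbr : Gs f s * Vs f s - κ * Bs f s ≤ (l + 1) * Bs f s ^ 2 + Gs f s * (Vs f s - Bs f s) := by
    have : Bs f s * ((s - 1) * Bs f s) ≤ Bs f s * ((l + 1) * Bs f s) := by
      apply mul_le_mul_of_nonneg_left _ hB
      apply mul_le_mul_of_nonneg_right _ hB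
      linarith
    rw [e] at this
    nlinarith
  have hbr0 : 0 ≤ (l + 1) * Bs f s ^ 2 + Gs f s * (Vs f s - Bs f s) := by
    have : 0 ≤ Vs f s - Bs f s := by linarith
    positivity
  have hA1 : Gs f s ^ l * ((l + 1) * Bs f s ^ 2 + Gs f s * (Vs f s - Bs f s)) ≤ As (pstep (l + 2) f) s := by
    refine le_of_mul_le_mul_left ?_ (by linarith : 0 < s)
    rw [st]
    apply mul_le_mul_of_nonneg_right hsM
    positivity
  have hA2 : Gs f s ^ l * (Gs f s * Vs f s - κ * Bs f s) ≤ As (pstep (l + 2) f) s :=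
    (mul_le_mul_of_nonneg_left hbr (by positivity)).trans hA1
  -- gain
  set gain := (Gs f s ^ (l + 1) - 1) * Vs f s - Bs f s + κ * Bs f s with hgain
  have hA3 : As f s + gain - κ * (1 + CG ^ l) * As f s ≤ As (pstep (l + 2) f) s := by
    refine le_trans ?_ hA2
    have e1 : Gs f s ^ l * (Gs f s * Vs f s - κ * Bs f s) =
       As f s + gain - κ * (1 + Gs f s ^ l) * Bs f s := by
      simp only [hgain, As]; ring
    rw [e1]
    have : κ * (1 + Gs f s ^ l) * Bs f s ≤ κ * (1 + CG ^ l) * As f s := by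
      have : Bs f s ≤ As f s := by unfold As; linarith
      gcongr
    linarith
  have hA0 : 0 ≤ As f s := by unfold As; linarith
  have hA2V : As f s ≤ 2 * Vs f s := by unfold As; linarith
  have hγ0 : 0 ≤ γ := div_nonneg (mul_nonneg (sq_nonneg _) (pow_nonneg hη.le 3))
    (mul_nonneg (by norm_num) (sq_nonneg _))
  set x := Gs f s - 1 with hx
  have hx0 : us f / 2 ≤ x := by simp only [hx]; linarith
  have bern : 1 + ((l:ℝ) + 1) * x ≤ Gs f s ^ (l + 1) := by
    have := one_add_mul_le_pow (by linarith : -2 ≤ x) (l + 1)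
    have e2 : 1 + x = Gs f s := by simp only [hx]; ring
    rw [e2] at this; push_cast at this; exact this
  have f4 := F4 hf hs1
  have hZ := Z_nonneg hf hs0
  have hc0 : 0 ≤ (s - 1) ^ 2 / s ^ 2 / 2 :=
    div_nonneg (div_nonneg (sq_nonneg _) (sq_nonneg _)) (by norm_num)
  have hxV : (s - 1) * x * Vs f s ≤ ((l:ℝ) + 1) * x * Vs f s := by
    apply mul_le_mul_of_nonneg_right _ hV
    apply mul_le_mul_of_nonneg_right (by linarith) (by linarith)
  have hBD : Bs f s * (1 - κ) ≤ Bs f s * (1 - Ds f s) := mul_le_mul_of_nonneg_left (by linarith) hB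
  have key1 : ((l:ℝ) + 1) * x * Vs f s - Bs f s + κ * Bs f s ≥ (s - 1) ^ 2 / s ^ 2 / 2 * (us f * Zs f s) := by
    linarith
  have hg0 : (s - 1) ^ 2 / s ^ 2 / 2 * (us f * Zs f s) ≤ gain := by
    have : ((l:ℝ) + 1) * x * Vs f s ≤ (Gs f s ^ (l + 1) - 1) * Vs f s :=
      mul_le_mul_of_nonneg_right (by linarith) hV
    simp only [hgain]; linarith
  have hcZ : 0 ≤ (s - 1) ^ 2 / s ^ 2 / 2 * (us f * Zs f s) := mul_nonneg hc0 (mul_nonneg hu hZ)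
  have hg00 : 0 ≤ gain := le_trans hcZ hg0
  have hfin : (fac η γ f - 1) * As f s ≤ gain := by
    unfold fac
    split_ifs with hh
    · have hγ1 : γ ≤ η ^ 2 / 8 := by
        exact gam_le hη hη1 hρ hρ1 (by linarith)
      rw [add_sub_cancel_left]
      by_cases hVV : 4 * (4 * CG) / η ≤ Vs f s
      · -- large V
        have h1 : 4 * (4 * CG) ≤ Vs f s * η := by rwa [div_le_iff₀ hη] at hVV
        have h2 : x * Vs f s ≤ (Gs f s ^ (l + 1) - 1) * Vs f s :=
          mul_le_mul_of_nonneg_right (by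
            have := mul_nonneg hl (by linarith : 0 ≤ x)
            linarith) hV
        have h3 : η / 2 * Vs f s ≤ x * Vs f s := mul_le_mul_of_nonneg_right (by linarith) hV
        have h4 : η / 4 * Vs f s ≤ gain := by
          have : 0 ≤ κ * Bs f s := mul_nonneg hκ.le hB
          simp only [hgain]; linarith
        have h5 : γ * As f s ≤ η ^ 2 / 8 * (2 * Vs f s) :=
          mul_le_mul hγ1 hA2V hA0 (by linarith)
        have h6 : η ^ 2 / 8 * (2 * Vs f s) ≤ η / 4 * Vs f s := by
          have : η ^ 2 ≤ η := by rw [pow_two]; exact mul_le_of_le_one_right hη.le hη1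
          have := mul_le_mul_of_nonneg_right this hV
          linarith
        linarith
      · push Not at hVV
        rcases Nat.eq_zero_or_pos l with h0 | hl1
        · -- m = 2
          have hs2 : s ≤ 2 := by rw [h0] at hsM; simpa using hsM
          set V1 := 4 * (4 * CG) / η with hV1
          have hV10 : 0 < V1 := div_pos (by linarith) hη
          have hz : ρ ^ 2 / (16 * V1) ≤ Zs f s := by
            rcases hcond h0 with hq | hr
            · exact Z_lower hf hs1 hs2 hρ hκρ hV10 hVV.le hD2 hq
            · refine le_trans ?_ (hr.trans (tl_le_Z hf hs1))
              have : 1 ≤ V1 := by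
                rw [hV1, le_div_iff₀ hη]; linarith
              rw [div_le_iff₀ (by linarith)]
              have h7 : ρ * ρ ≤ ρ * 1 := mul_le_mul_of_nonneg_left hρ1 hρ.le
              have h8 : ρ * 1 ≤ ρ * V1 := mul_le_mul_of_nonneg_left this hρ.le
              rw [pow_two]; linarith
          have hc : 1 / 32 ≤ (s - 1) ^ 2 / s ^ 2 / 2 := by
            exact c0_lower hs hs2
          have h1 : 1 / 32 * (η * (ρ ^ 2 / (16 * V1))) ≤ gain := by
            refine le_trans ?_ hg0
            exact mul_le_mul hc (mul_le_mul hh hz (div_nonneg (sq_nonneg _) (by linarith)) hu)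
              (mul_nonneg hη.le (div_nonneg (sq_nonneg _) (by linarith))) hc0
          refine le_trans ?_ h1
          have h2 : As f s ≤ 2 * V1 := by linarith
          calc γ * As f s ≤ γ * (2 * V1) := mul_le_mul_of_nonneg_left h2 hγ0
            _ ≤ _ := by
              rw [hγ, hV1]
              have : ρ ^ 2 * η ^ 3 / (2 ^ 18 * CG ^ 2) * (2 * (4 * (4 * CG) / η)) = ρ ^ 2 * η ^ 2 / (2 ^ 13 * CG) := by
                field_simp; norm_num
              rw [this]
              have : 1 / 32 * (η * (ρ ^ 2 / (16 * (4 * (4 * CG) / η)))) = ρ ^ 2 * η ^ 2 / (2 ^ 13 * CG) := by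
                field_simp; norm_num
              rw [this]
        · obtain ⟨l', rfl⟩ : ∃ l', l = l' + 1 := ⟨l - 1, by omega⟩
          have hxsq : 1 + ((l' + 1 : ℕ) + 1 : ℝ) * x + x ^ 2 ≤ Gs f s ^ (l' + 1 + 1) := by
            have e2 : 1 + x = Gs f s := by simp only [hx]; ring
            rw [← e2]; exact bern_two (by linarith) l'
          have h1 : x ^ 2 * Vs f s ≤ gain := by
            have h2 : (((l' + 1 : ℕ) + 1 : ℝ) * x + x ^ 2) * Vs f s ≤ (Gs f s ^ (l' + 1 + 1) - 1) * Vs f s :=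
              mul_le_mul_of_nonneg_right (by linarith) hV
            simp only [hgain]
            linarith
          have h2 : η ^ 2 / 4 ≤ x ^ 2 := by
            have := pow_le_pow_left₀ (by linarith) (by linarith : η / 2 ≤ x) 2
            rw [div_pow] at this; linarith
          have h3 : γ * As f s ≤ η ^ 2 / 8 * (2 * Vs f s) :=
            mul_le_mul hγ1 hA2V hA0 (by linarith)
          have h4 : η ^ 2 / 4 * Vs f s ≤ x ^ 2 * Vs f s := mul_le_mul_of_nonneg_right h2 hV
          linarith
    · simpa using hg00
  have hfac := one_le_fac (η := η) hγ0 f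
  have : 0 ≤ κ * (1 + CG ^ l) * ((fac η γ f - 1) * As f s) := by
    have h1 : 0 ≤ CG ^ l := pow_nonneg (by linarith) l
    have h2 : 0 ≤ fac η γ f - 1 := by linarith
    exact mul_nonneg (mul_nonneg hκ.le (by linarith)) (mul_nonneg h2 hA0)
  linarith

open Classical in
lemma count_growth (y : ℕ → ℝ) (E : ℕ → Prop) {γ e : ℝ} (hγ : 0 ≤ γ) (he1 : e ≤ 1)
    (a b : ℕ) (hab : a ≤ b)
    (h : ∀ i, a ≤ i → i < b → (1 - e) * ((if E i then 1 + γ else 1) * y i) ≤ y (i + 1)) :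
    (1 + γ) ^ ((Finset.Ico a b).filter E).card * (1 - e) ^ (b - a) * y a ≤ y b := by
  induction b, hab using Nat.le_induction with
  | base => simp
  | succ b hab ih =>
    have ih' := ih fun i h1 h2 => h i h1 (by omega)
    have hb := h b hab (by omega)
    refine le_trans ?_ hb
    have e1 : Finset.Ico a (b + 1) = insert b (Finset.Ico a b) := by
      ext x; simp; omega
    have e2 : b + 1 - a = (b - a) + 1 := by omega
    have h1e : 0 ≤ 1 - e := by linarith
    rw [e1, Finset.filter_insert, e2, pow_succ]
    split_ifs with hE
    · rw [Finset.card_insert_of_notMem (by simp), pow_succ]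
      have := mul_le_mul_of_nonneg_left ih' (mul_nonneg h1e (by linarith : 0 ≤ 1 + γ))
      linarith
    · have := mul_le_mul_of_nonneg_left ih' h1e
      linarith

lemma exp_beats (γ δ K : ℝ) (hγ : 0 < γ) (hδ : 0 < δ) (r : ℕ) :
    ∃ τ0 : ℕ, ∀ τ : ℕ, τ0 ≤ τ → ∀ c : ℕ, (1 + γ) ^ c ≤ K * (τ:ℝ) ^ r → (c:ℝ) ≤ δ * τ := by
  set R := (1 + γ) ^ δ with hR
  have hR1 : 1 < R := Real.one_lt_rpow (by linarith) hδ
  have ht := tendsto_pow_const_mul_const_pow_of_abs_lt_one r (r := R⁻¹)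
    (by rw [abs_of_pos (by positivity)]; exact inv_lt_one_of_one_lt₀ hR1)
  have ht2 := ht.const_mul K
  rw [mul_zero] at ht2
  obtain ⟨τ0, h0⟩ := eventually_atTop.1 (ht2.eventually (gt_mem_nhds one_pos))
  refine ⟨τ0, fun τ hτ c hc => ?_⟩
  by_contra hcon
  push Not at hcon
  have h1 := h0 τ hτ
  have hRp : 0 < R ^ τ := by positivity
  have h2 : K * (τ:ℝ) ^ r < R ^ τ := by
    rw [inv_pow, ← mul_assoc, ← div_eq_mul_inv, div_lt_one hRp] at h1; exact h1
  have h3 : R ^ τ ≤ (1 + γ) ^ c := by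
    rw [hR, ← Real.rpow_natCast, ← Real.rpow_mul (by linarith), ← Real.rpow_natCast (1 + γ) c]
    exact Real.rpow_le_rpow_of_exponent_le (by linarith) hcon.le
  linarith

set_option maxHeartbeats 1000000 in
open Classical in
lemma window_core {l : ℕ} {η ρ C0 CG κ ϑ : ℝ} {τ : ℕ} (hη : 0 < η) (hη1 : η ≤ 1) (hρ : 0 < ρ)
    (hρ1 : ρ ≤ 1) (hCG : ((l:ℝ) + 2) ^ 4 + 2 = CG) (hκ : 0 < κ) (hκ2 : κ ≤ 1 / 2) (hκρ : κ ≤ ρ / 2)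
    (hϑ : 0 < ϑ) (hϑ2 : ϑ ≤ 1 / 2) (hκτ : (1 + CG ^ l) * κ * τ ≤ 1 / 2)
    (hϑτ : CG ^ (l + 2) * ϑ * τ ≤ κ / 4) (hτ : 1 ≤ τ)
    {f : ℝ[X]} (hf : Law f)
    (hb : ∀ i ≤ τ, ∀ k, ((pstep (l + 2))^[i] f).coeff k * ((l:ℝ) + 2) ^ k ≤ C0)
    (hcond : l = 0 → ∀ i ≤ τ, ρ ≤ ((pstep (l + 2))^[i] f).coeff 0 ∨ ρ ≤ tl ((pstep (l + 2))^[i] f) 2) :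
    ∃ c1 c2 : ℕ, ((Finset.range τ).filter fun i => η ≤ us ((pstep (l + 2))^[i] f)).card ≤ c1 + c2 ∧
      (1 + ρ ^ 2 * η ^ 3 / (2 ^ 18 * CG ^ 2)) ^ c1 ≤
        4 * ((l:ℝ) + 2) * (2 * C0 * ((l:ℝ) + 2) ^ 3 / ϑ ^ 3) + 1 ∧
      (1 + ρ ^ 2 * η ^ 3 / (2 ^ 18 * CG ^ 2)) ^ c2 ≤
        2 / κ * (((l:ℝ) + 2) * (2 * C0 * ((l:ℝ) + 2) ^ 3 / ϑ ^ 3) + 1) := by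
  obtain ⟨M, hM⟩ : ∃ M, M = (l:ℝ) + 2 := ⟨_, rfl⟩
  obtain ⟨γ, hγ⟩ : ∃ γ, γ = ρ ^ 2 * η ^ 3 / (2 ^ 18 * CG ^ 2) := ⟨_, rfl⟩
  obtain ⟨Am, hAm⟩ : ∃ Am, Am = 2 * C0 * M ^ 3 / ϑ ^ 3 := ⟨_, rfl⟩
  simp only [← hM] at hb hCG ⊢
  rw [← hγ, ← hAm]
  have hl : (0:ℝ) ≤ l := Nat.cast_nonneg l
  have hM2 : 2 ≤ M := by linarith
  have hCG1 : 1 ≤ CG := by rw [← hCG]; have : 0 ≤ M ^ 4 := by positivity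
                           linarith
  obtain ⟨s, hs⟩ : ∃ s, s = M - ϑ := ⟨_, rfl⟩
  have hs32 : 3 / 2 ≤ s := by linarith
  have hsM : s ≤ (l:ℝ) + 2 := by linarith
  have hs0 : 0 ≤ s := by linarith
  have hMs : (l:ℝ) + 2 - s = ϑ := by rw [hs, hM]; ring
  have hCG' : ((l:ℝ) + 2) ^ 4 + 2 = CG := by rw [← hM]; exact hCG
  obtain ⟨g, hg⟩ : ∃ g : ℕ → ℝ[X], ∀ i, (pstep (l + 2))^[i] f = g i := ⟨_, fun _ => rfl⟩
  simp only [hg] at hb hcond ⊢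
  have hgs : ∀ i, g (i + 1) = pstep (l + 2) (g i) := fun i => by
    rw [← hg, ← hg, Function.iterate_succ_apply']
  have hgl : ∀ i, Law (g i) := fun i => hg i ▸ hf.iter i
  have hγ0 : 0 ≤ γ := hγ ▸ div_nonneg (mul_nonneg (sq_nonneg _) (pow_nonneg hη.le 3))
    (mul_nonneg (by norm_num) (sq_nonneg _))
  have hγη : γ ≤ η / 2 := by
    have h1 : γ ≤ η ^ 2 / 8 := hγ ▸ gam_le hη hη1 hρ hρ1 hCG1
    have : η ^ 2 ≤ η := by rw [pow_two]; exact mul_le_of_le_one_right hη.le hη1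
    linarith
  have hA : ∀ i ≤ τ, As (g i) s ≤ Am := fun i hi => by
    have := A_bound (hgl i) hs0 (by linarith : s < M) (hb i hi)
    have e : M - s = ϑ := by rw [hs]; ring
    rw [e] at this; rw [hAm]; exact this
  have hAB : ∀ i, Bs (g i) s ≤ As (g i) s := fun i => by
    have := B_le_V (hgl i) hs0
    have := B_nonneg (hgl i) hs0
    unfold As; linarith
  have hG1 : ∀ i, 1 ≤ Gs (g i) s := fun i => by
    have h1 := G_ge (hgl i) (by linarith : 1 ≤ s)
    have h2 := us_nonneg (hgl i)
    have := mul_nonneg (by linarith : 0 ≤ s - 1) h2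
    linarith
  have hAm0 : 0 ≤ Am := le_trans ((B_nonneg (hgl 0) hs0).trans (hAB 0)) (hA 0 (by omega))
  have hkap : 4 ≤ 2 / κ := by rw [le_div_iff₀ hκ]; linarith
  -- the splitting index
  obtain ⟨b, hbτ, hmid, hend⟩ : ∃ b ≤ τ, (∀ i < b, |Ds (g i) s| ≤ κ) ∧ (b = τ ∨ κ ≤ |Ds (g b) s|) := by
    by_cases hex : ∃ i, i ≤ τ ∧ κ ≤ |Ds (g i) s|
    · refine ⟨Nat.find hex, (Nat.find_spec hex).1, fun i hi => ?_, Or.inr (Nat.find_spec hex).2⟩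
      have := Nat.find_min hex hi
      push Not at this
      exact (this (by have := (Nat.find_spec hex).1; omega)).le
    · push Not at hex
      exact ⟨τ, le_rfl, fun i hi => (hex i hi.le).le, Or.inl rfl⟩
  refine ⟨((Finset.Ico 0 b).filter fun i => η ≤ us (g i)).card,
    ((Finset.Ico b τ).filter fun i => η ≤ us (g i)).card, ?_, ?_, ?_⟩
  · rw [← Finset.card_union_of_disjoint, ← Finset.filter_union]
    · refine Finset.card_le_card (Finset.filter_subset_filter _ ?_)
      intro x hx; simp at hx ⊢; omega
    · refine Finset.disjoint_filter_filter ?_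
      rw [Finset.disjoint_left]; intro x h1 h2; simp at h1 h2; omega
  · -- middle phase
    rcases Nat.eq_zero_or_pos b with h0 | hb0
    · subst h0
      have : 0 ≤ 4 * M * Am := mul_nonneg (by linarith) hAm0
      simp; linarith
    have hC2 : 0 ≤ (1 + CG ^ l) * κ := mul_nonneg (by have := pow_nonneg (by linarith : 0 ≤ CG) l; linarith) hκ.le
    have hτ1 : (1:ℝ) ≤ τ := by exact_mod_cast hτ
    have he1 : (1 + CG ^ l) * κ ≤ 1 / 2 := by
      have := mul_le_mul_of_nonneg_left hτ1 hC2
      linarith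
    have hc := count_growth (fun i => As (g i) s) (fun i => η ≤ us (g i)) hγ0
      (by linarith : (1 + CG ^ l) * κ ≤ 1) 0 b (Nat.zero_le _) (fun i _ hi => by
        have := mid_step (hgl i) l hs32 hsM (le_of_eq hCG') hκ hκ2 hη hη1 hρ hρ1 hκρ
          (fun h0 => hcond h0 i (by omega)) (hmid i hi)
        rw [hgs, hγ]; exact this)
    have hpow : 1 / 2 ≤ (1 - (1 + CG ^ l) * κ) ^ (b - 0) := by
      have h1 := one_add_mul_le_pow (by linarith : -2 ≤ -((1 + CG ^ l) * κ)) (b - 0)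
      have h2 : ((b - 0 : ℕ) : ℝ) ≤ τ := by exact_mod_cast (by omega : b - 0 ≤ τ)
      have h3 := mul_le_mul_of_nonneg_left h2 hC2
      have e : 1 + -((1 + CG ^ l) * κ) = 1 - (1 + CG ^ l) * κ := by ring
      rw [e] at h1
      linarith
    have hA0 : 1 / (2 * M) ≤ As (g 0) s := by
      refine le_trans ?_ (hAB 0)
      rw [div_le_iff₀ (by linarith)]
      have h1 := (abs_le.1 (hmid 0 hb0)).2
      have h2 := hG1 0
      have e : (s - 1) * Bs (g 0) s = Gs (g 0) s - Ds (g 0) s := by unfold Ds; ring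
      have h3 : (s - 1) * Bs (g 0) s ≤ M * Bs (g 0) s :=
        mul_le_mul_of_nonneg_right (by linarith) (B_nonneg (hgl 0) hs0)
      linarith
    obtain ⟨c, hcd⟩ : ∃ c, c = ((Finset.Ico 0 b).filter fun i => η ≤ us (g i)).card := ⟨_, rfl⟩
    rw [← hcd] at hc ⊢
    have hP : 0 ≤ (1 + γ) ^ c := pow_nonneg (by linarith) c
    have h5 : (1 + γ) ^ c * (1 / 2) * (1 / (2 * M)) ≤ Am := by
      refine le_trans ?_ (hc.trans (hA b hbτ))
      apply mul_le_mul (mul_le_mul_of_nonneg_left hpow hP) hA0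
      · exact div_nonneg (by norm_num) (by linarith)
      · exact mul_nonneg hP (by linarith)
    have h6 : (1 + γ) ^ c = (1 + γ) ^ c * (1 / 2) * (1 / (2 * M)) * (4 * M) := by
      field_simp; norm_num
    have h7 := mul_le_mul_of_nonneg_right h5 (by linarith : 0 ≤ 4 * M)
    rw [← h6] at h7
    linarith
  · have hQ1 : 1 ≤ 2 / κ * (M * Am + 1) := by
      have : 0 ≤ M * Am := mul_nonneg (by linarith) hAm0
      nlinarith
    rcases hend with rfl | hbk
    · simpa using hQ1
    obtain ⟨c, hcd⟩ : ∃ c, c = ((Finset.Ico b τ).filter fun i => η ≤ us (g i)).card := ⟨_, rfl⟩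
    rw [← hcd]
    have hP : 0 ≤ (1 + γ) ^ c := pow_nonneg (by linarith) c
    rcases le_abs.1 hbk with hup | hdn
    · -- up phase
      have hth0 : 0 ≤ CG ^ (l + 2) * ϑ := mul_nonneg (pow_nonneg (by linarith) _) hϑ.le
      have hstay : ∀ n, b + n ≤ τ → κ - CG ^ (l + 2) * ϑ * n ≤ Ds (g (b + n)) s := by
        intro n
        induction n with
        | zero => intro _; simpa using hup
        | succ n ih =>
          intro hn
          have h1 := ih (by omega)
          have hnτ : (n:ℝ) ≤ τ := by exact_mod_cast (by omega : n ≤ τ)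
          have h2 := mul_le_mul_of_nonneg_left hnτ hth0
          have hD0 : 0 ≤ Ds (g (b + n)) s := by linarith
          have h3 := up_step (hgl (b + n)) l hs32 hsM (le_of_eq hCG') hD0
          rw [hMs, ← hgs] at h3
          have h4 : 1 * Ds (g (b + n)) s ≤ Gs (g (b + n)) s ^ (l + 1) * Ds (g (b + n)) s :=
            mul_le_mul_of_nonneg_right (one_le_pow₀ (hG1 _)) hD0
          push_cast
          rw [← add_assoc]
          linarith
      have hstay2 : ∀ i, b ≤ i → i ≤ τ → κ / 2 ≤ Ds (g i) s := by
        intro i h1 h2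
        obtain ⟨n, rfl⟩ := Nat.exists_eq_add_of_le h1
        have := hstay n h2
        have hnτ : (n:ℝ) ≤ τ := by exact_mod_cast (by omega : n ≤ τ)
        have h2 := mul_le_mul_of_nonneg_left hnτ hth0
        linarith
      obtain ⟨e, he⟩ : ∃ e, e = 2 * CG ^ (l + 2) * ϑ / κ := ⟨_, rfl⟩
      have he0 : 0 ≤ e := he ▸ div_nonneg (by linarith) hκ.le
      have heτ : e * τ ≤ 1 / 2 := by
        rw [he, div_mul_eq_mul_div, div_le_iff₀ hκ]; linarith
      have hτ1 : (1:ℝ) ≤ τ := by exact_mod_cast hτ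
      have he1 : e ≤ 1 / 2 := by
        have := mul_le_mul_of_nonneg_left hτ1 he0
        linarith
      have hc := count_growth (fun i => Ds (g i) s) (fun i => η ≤ us (g i)) hγ0
        (by linarith : e ≤ 1) b τ hbτ (fun i h1 h2 => by
          have := up_step_fac (hgl i) l hs32 hsM (le_of_eq hCG') hκ hγ0 hγη (hstay2 i h1 h2.le)
          rw [hMs, ← hgs, ← he] at this; exact this)
      rw [← hcd] at hc
      have hpow : 1 / 2 ≤ (1 - e) ^ (τ - b) := by
        have h1 := one_add_mul_le_pow (by linarith : -2 ≤ -e) (τ - b)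
        have h2 : ((τ - b : ℕ) : ℝ) ≤ τ := by exact_mod_cast (by omega : τ - b ≤ τ)
        have h3 := mul_le_mul_of_nonneg_left h2 he0
        have e : 1 + -e = 1 - e := by ring
        rw [e] at h1
        linarith
      have hD1 := D_le_one (hgl τ) (by linarith : 1 ≤ s)
      have h5 : (1 + γ) ^ c * (1 / 2) * κ ≤ 1 := by
        refine le_trans ?_ (hc.trans hD1)
        apply mul_le_mul (mul_le_mul_of_nonneg_left hpow hP) hup hκ.le
        exact mul_nonneg hP (by linarith)
      have h6 : (1 + γ) ^ c ≤ 2 / κ := by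
        rw [le_div_iff₀ hκ]; linarith
      have : 0 ≤ M * Am := mul_nonneg (by linarith) hAm0
      have h8 := mul_nonneg (by linarith : 0 ≤ 2 / κ) this
      linarith
    · -- down phase
      have hstay : ∀ i, b ≤ i → Ds (g i) s ≤ -κ := by
        intro i hi
        induction i, hi using Nat.le_induction with
        | base => linarith
        | succ i hi ih =>
          have h1 := down_step (hgl i) l hs32 hsM hγη (by linarith)
          rw [← hgs] at h1
          have h2 := one_le_fac (η := η) hγ0 (g i)
          have h3 := mul_le_mul_of_nonpos_right h2 (by linarith : Ds (g i) s ≤ 0)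
          linarith
      have hc := count_growth (fun i => -Ds (g i) s) (fun i => η ≤ us (g i)) hγ0
        (by norm_num : (0:ℝ) ≤ 1) b τ hbτ (fun i h1 h2 => by
          have h3 := hstay i h1
          have := down_step (hgl i) l hs32 hsM hγη (by linarith)
          rw [← hgs] at this
          unfold fac at this
          linarith)
      have hlow : -Ds (g τ) s ≤ M * Am := by
        have h1 : (s - 1) * Bs (g τ) s ≤ M * As (g τ) s :=
          mul_le_mul (by linarith) (hAB τ) (B_nonneg (hgl τ) hs0) (by linarith)
        have h2 := mul_le_mul_of_nonneg_left (hA τ le_rfl) (by linarith : 0 ≤ M)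
        have h3 := hG1 τ
        unfold Ds
        linarith
      rw [sub_zero, one_pow, mul_one, ← hcd] at hc
      have h5 : (1 + γ) ^ c * κ ≤ M * Am :=
        (mul_le_mul_of_nonneg_left hdn hP).trans (hc.trans hlow)
      have h6 : (1 + γ) ^ c ≤ M * Am / κ := by rwa [le_div_iff₀ hκ]
      have : 0 ≤ M * Am := mul_nonneg (by linarith) hAm0
      have h7 : M * Am / κ ≤ 2 / κ * (M * Am + 1) := by
        rw [div_mul_eq_mul_div]
        apply div_le_div_of_nonneg_right _ hκ.le
        linarith
      linarith

lemma window_num {γ C0 C1 C2 M t : ℝ} {c1 c2 : ℕ} (hγ : 0 ≤ γ) (hC0 : 0 ≤ C0) (hC1 : 1 ≤ C1)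
    (hC2 : 1 ≤ C2) (hM : 2 ≤ M) (ht : 1 ≤ t)
    (h2 : (1 + γ) ^ c1 ≤ 4 * M * (2 * C0 * M ^ 3 / (1 / (2 * C2 * t) / (4 * C1 * t)) ^ 3) + 1)
    (h3 : (1 + γ) ^ c2 ≤ 2 / (1 / (2 * C2 * t)) *
      (M * (2 * C0 * M ^ 3 / (1 / (2 * C2 * t) / (4 * C1 * t)) ^ 3) + 1)) :
    (1 + γ) ^ (c1 + c2) ≤ (4 * M * (2 * C0 * M ^ 3 * (8 * C1 * C2) ^ 3) + 1) *
      (4 * C2 * (M * (2 * C0 * M ^ 3 * (8 * C1 * C2) ^ 3) + 1)) * t ^ 13 := by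
  have hAm : 2 * C0 * M ^ 3 / (1 / (2 * C2 * t) / (4 * C1 * t)) ^ 3 =
      2 * C0 * M ^ 3 * (8 * C1 * C2) ^ 3 * t ^ 6 := by
    field_simp; norm_num; ring
  have hk : 2 / (1 / (2 * C2 * t)) = 4 * C2 * t := by field_simp; norm_num
  rw [hAm] at h2 h3
  rw [hk] at h3
  have hK0 : 0 ≤ 2 * C0 * M ^ 3 * (8 * C1 * C2) ^ 3 := by positivity
  generalize 2 * C0 * M ^ 3 * (8 * C1 * C2) ^ 3 = K1 at *
  have ht6 : 1 ≤ t ^ 6 := one_le_pow₀ ht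
  have h2' : (1 + γ) ^ c1 ≤ (4 * M * K1 + 1) * t ^ 6 := by
    refine h2.trans ?_
    linarith
  have h3' : (1 + γ) ^ c2 ≤ (4 * C2 * (M * K1 + 1)) * t ^ 7 := by
    refine h3.trans ?_
    have : M * (K1 * t ^ 6) + 1 ≤ (M * K1 + 1) * t ^ 6 := by linarith
    calc 4 * C2 * t * (M * (K1 * t ^ 6) + 1) ≤ 4 * C2 * t * ((M * K1 + 1) * t ^ 6) :=
          mul_le_mul_of_nonneg_left this (by positivity)
      _ = _ := by ring
  rw [pow_add]
  calc (1 + γ) ^ c1 * (1 + γ) ^ c2 ≤ ((4 * M * K1 + 1) * t ^ 6) * ((4 * C2 * (M * K1 + 1)) * t ^ 7) :=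
        mul_le_mul h2' h3' (pow_nonneg (by linarith) _) (by positivity)
    _ = _ := by ring

lemma window_par {ρ C1 C2 t : ℝ} (hρ : 0 < ρ) (hC1 : 1 ≤ C1) (hC2 : 1 ≤ C2) (ht : 1 ≤ t)
    (hτρ : 1 / ρ ≤ t) : 0 < 1 / (2 * C2 * t) ∧ 1 / (2 * C2 * t) ≤ 1 / 2 ∧ 1 / (2 * C2 * t) ≤ ρ / 2 ∧
      0 < 1 / (2 * C2 * t) / (4 * C1 * t) ∧ 1 / (2 * C2 * t) / (4 * C1 * t) ≤ 1 / 2 ∧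
      C2 * (1 / (2 * C2 * t)) * t ≤ 1 / 2 ∧
      C1 * (1 / (2 * C2 * t) / (4 * C1 * t)) * t ≤ 1 / (2 * C2 * t) / 4 := by
  have h1 : 0 < 1 / (2 * C2 * t) := by positivity
  have h2 : 1 / (2 * C2 * t) ≤ 1 / 2 := by
    rw [div_le_div_iff₀ (by positivity) (by norm_num)]; nlinarith
  refine ⟨h1, h2, ?_, by positivity, ?_, ?_, ?_⟩
  · rw [div_le_iff₀ hρ] at hτρ
    rw [div_le_div_iff₀ (by positivity) (by norm_num)]
    have : 0 ≤ ρ * t * (C2 - 1) := mul_nonneg (by positivity) (by linarith)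
    nlinarith
  · rw [div_le_iff₀ (by positivity)]; nlinarith
  · apply le_of_eq; field_simp
  · apply le_of_eq; field_simp

open Classical in
lemma window (l : ℕ) {η ρ C0 δ : ℝ} (hη : 0 < η) (hη1 : η ≤ 1) (hρ : 0 < ρ)
    (hρ1 : ρ ≤ 1) (hδ : 0 < δ) :
    ∃ τ0 : ℕ, ∀ τ : ℕ, τ0 ≤ τ → ∀ f : ℝ[X], Law f →
    (∀ i ≤ τ, ∀ k, ((pstep (l + 2))^[i] f).coeff k * ((l:ℝ) + 2) ^ k ≤ C0) →
    (l = 0 → ∀ i ≤ τ, ρ ≤ ((pstep (l + 2))^[i] f).coeff 0 ∨ ρ ≤ tl ((pstep (l + 2))^[i] f) 2) →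
    (((Finset.range τ).filter fun i => η ≤ us ((pstep (l + 2))^[i] f)).card : ℝ) ≤ δ * τ := by
  have hl : (0:ℝ) ≤ l := Nat.cast_nonneg l
  obtain ⟨CG, hCG⟩ : ∃ CG, ((l:ℝ) + 2) ^ 4 + 2 = CG := ⟨_, rfl⟩
  have hCG1 : 1 ≤ CG := by
    have : 0 ≤ ((l:ℝ) + 2) ^ 4 := by positivity
    linarith
  obtain ⟨γ, hγ⟩ : ∃ γ, ρ ^ 2 * η ^ 3 / (2 ^ 18 * CG ^ 2) = γ := ⟨_, rfl⟩
  have hγ0 : 0 < γ := by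
    rw [← hγ]
    exact div_pos (mul_pos (pow_pos hρ 2) (pow_pos hη 3))
      (mul_pos (by norm_num) (pow_pos (by linarith) 2))
  obtain ⟨C1, hC1⟩ : ∃ C1, CG ^ (l + 2) = C1 := ⟨_, rfl⟩
  obtain ⟨C2, hC2⟩ : ∃ C2, 1 + CG ^ l = C2 := ⟨_, rfl⟩
  have hC11 : 1 ≤ C1 := hC1 ▸ one_le_pow₀ hCG1
  have hC21 : 1 ≤ C2 := by
    have : 1 ≤ CG ^ l := one_le_pow₀ hCG1
    linarith
  obtain ⟨τ0, hτ0⟩ := exp_beats γ δ ((4 * ((l:ℝ) + 2) * (2 * C0 * ((l:ℝ) + 2) ^ 3 * (8 * C1 * C2) ^ 3) + 1) *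
      (4 * C2 * (((l:ℝ) + 2) * (2 * C0 * ((l:ℝ) + 2) ^ 3 * (8 * C1 * C2) ^ 3) + 1))) hγ0 hδ 13
  refine ⟨max τ0 (max 1 ⌈1 / ρ⌉₊), fun τ hτ f hf hb hcond => ?_⟩
  have hτ1 : 1 ≤ τ := by omega
  have hτρ : 1 / ρ ≤ τ := (Nat.le_ceil _).trans (by exact_mod_cast (by omega : ⌈1 / ρ⌉₊ ≤ τ))
  have ht1 : 1 ≤ (τ:ℝ) := by exact_mod_cast hτ1
  have hC0 : 0 ≤ C0 := le_trans (by have := hf.1 0; simpa using this) (hb 0 (by omega) 0)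
  obtain ⟨p1, p2, p3, p4, p5, p6, p7⟩ := window_par hρ hC11 hC21 ht1 hτρ
  obtain ⟨c1, c2, h1, h2, h3⟩ := window_core (τ := τ) hη hη1 hρ hρ1 hCG p1 p2 p3 p4 p5
    (by rw [hC2]; exact p6) (by rw [hC1]; exact p7) hτ1 hf hb hcond
  rw [hγ] at h2 h3
  have h4 := window_num hγ0.le hC0 hC11 hC21 (by linarith) ht1 h2 h3
  have h5 := hτ0 τ (by omega) (c1 + c2) h4
  refine le_trans ?_ h5
  exact_mod_cast h1

/-- condition that prevents degeneracy when `m = 2` -/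
def Cond (ρ : ℝ) (f : ℝ[X]) : Prop := ρ ≤ f.coeff 0 ∨ ρ ≤ tl f 2

lemma cond_pstep {f : ℝ[X]} (hf : Law f) {ρ : ℝ} (hρ : 0 < ρ) (hρ1 : ρ ≤ 1 / 16) (h : Cond ρ f) :
    Cond ρ (pstep 2 f) := by
  have hl := hf.pstep (m := 2)
  have h0 := hf.1 0
  have h1 := hf.1 1
  have h2 := hf.1 2
  have hr0 := tl_nonneg hf 2
  have h2r := coeff_le_tl hf 2
  have er : tl f 2 = 1 - f.coeff 0 - f.coeff 1 := by
    rw [tl, lowN_eq hf.1, Finset.sum_range_succ, Finset.sum_range_one]; ring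
  have er' : tl (pstep 2 f) 2 = 1 - (pstep 2 f).coeff 0 - (pstep 2 f).coeff 1 := by
    rw [tl, lowN_eq hl.1, Finset.sum_range_succ, Finset.sum_range_one]; ring
  have c0 : (f ^ 2).coeff 0 = f.coeff 0 ^ 2 := by rw [pow_two, mul_coeff_zero, pow_two]
  have c1 : (f ^ 2).coeff 1 = 2 * f.coeff 0 * f.coeff 1 := by
    rw [pow_two, mul_coeff_one]; ring
  have c2 : (f ^ 2).coeff 2 = 2 * f.coeff 0 * f.coeff 2 + f.coeff 1 ^ 2 := by
    rw [pow_two, coeff_mul]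
    have : Finset.HasAntidiagonal.antidiagonal 2 = {(0, 2), (1, 1), (2, 0)} := by decide
    rw [this]
    rw [Finset.sum_insert (by decide), Finset.sum_insert (by decide), Finset.sum_singleton]
    ring
  have e0 : (pstep 2 f).coeff 0 = f.coeff 0 ^ 2 + 2 * f.coeff 0 * f.coeff 1 := by
    rw [pstep_coeff]; simp [c0, c1]; ring
  have e1 : (pstep 2 f).coeff 1 = 2 * f.coeff 0 * f.coeff 2 + f.coeff 1 ^ 2 := by
    rw [pstep_coeff]; simp [c2]
  unfold Cond at h ⊢
  rw [er', e0, e1]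
  rw [er] at h h2r hr0
  generalize f.coeff 0 = q at *
  generalize f.coeff 1 = p at *
  generalize f.coeff 2 = w at *
  clear er er' c0 c1 c2 e0 e1 hl
  obtain ⟨r, hr⟩ : ∃ r, r = 1 - q - p := ⟨_, rfl⟩
  rw [← hr] at h h2r hr0
  have hp : p = 1 - q - r := by linarith
  subst hp
  have key : r * (2 * (1 - q) - r) ≤
      1 - (q ^ 2 + 2 * q * (1 - q - r)) - (2 * q * w + (1 - q - r) ^ 2) := by
    have := mul_le_mul_of_nonneg_left h2r h0
    nlinarith
  have key0 : q ^ 2 + 2 * q * (1 - q - r) = q * (2 - q - 2 * r) := by ring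
  rw [key0] at key ⊢
  by_cases hr4 : r ≤ 1 / 4
  · by_cases hq : ρ ≤ q
    · left
      have h3 : q * (3 / 2 - q) ≤ q * (2 - q - 2 * r) := mul_le_mul_of_nonneg_left (by linarith) h0
      have h4 : q ≤ 1 := by linarith
      rcases le_total q (1 / 2) with h5 | h5
      · have := mul_le_mul_of_nonneg_left (by linarith : 1 ≤ 3 / 2 - q) h0
        linarith
      · have : 1 / 2 * (1 / 2) ≤ q * (3 / 2 - q) := mul_le_mul h5 (by linarith) (by norm_num) h0
        linarith
    · right
      have hr : ρ ≤ r := h.resolve_left hq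
      push Not at hq
      refine le_trans ?_ key
      have := mul_le_mul_of_nonneg_left (by linarith : 1 ≤ 2 * (1 - q) - r) hr0
      linarith
  · right
    push Not at hr4
    refine le_trans ?_ key
    have : 1 / 4 * (1 / 4) ≤ r * (2 * (1 - q) - r) := mul_le_mul hr4.le (by linarith) (by norm_num) hr0
    linarith

lemma cond_iter {f : ℝ[X]} (hf : Law f) {ρ : ℝ} (hρ : 0 < ρ) (hρ1 : ρ ≤ 1 / 16) (h : Cond ρ f)
    (n : ℕ) : Cond ρ ((pstep 2)^[n] f) := by
  induction n with
  | zero => exact h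
  | succ n ih => rw [Function.iterate_succ_apply']; exact cond_pstep (hf.iter n) hρ hρ1 ih

lemma pstep_smul (m : ℕ) (c : ℝ) (f : ℝ[X]) : pstep m (C c * f) = C (c ^ m) * pstep m f := by
  ext k
  rw [pstep_coeff, coeff_C_mul, pstep_coeff, mul_pow, ← C_pow, coeff_C_mul, coeff_C_mul]
  split_ifs <;> ring

lemma pstep_iter_smul (m : ℕ) (c : ℝ) (f : ℝ[X]) (n : ℕ) :
    (pstep m)^[n] (C c * f) = C (c ^ (m ^ n)) * (pstep m)^[n] f := by
  induction n with
  | zero => simp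
  | succ n ih =>
    rw [Function.iterate_succ_apply', ih, pstep_smul, Function.iterate_succ_apply', ← pow_mul, pow_succ]

lemma coeff_mul_mono {f g f' g' : ℝ[X]} (hf : ∀ k, 0 ≤ f.coeff k) (hg' : ∀ k, 0 ≤ g'.coeff k)
    (h : ∀ k, f.coeff k ≤ f'.coeff k) (h2 : ∀ k, g.coeff k ≤ g'.coeff k) (k : ℕ) :
    (f * g).coeff k ≤ (f' * g').coeff k := by
  rw [coeff_mul, coeff_mul]
  refine Finset.sum_le_sum fun x _ => ?_
  exact (mul_le_mul_of_nonneg_left (h2 _) (hf _)).trans (mul_le_mul_of_nonneg_right (h _) (hg' _))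

lemma coeff_pow_mono {f g : ℝ[X]} (hf : ∀ k, 0 ≤ f.coeff k) 
    (h : ∀ k, f.coeff k ≤ g.coeff k) (m k : ℕ) : (f ^ m).coeff k ≤ (g ^ m).coeff k := by
  induction m generalizing k with
  | zero => simp
  | succ m ih =>
    rw [pow_succ, pow_succ]
    exact coeff_mul_mono (coeff_pow_nonneg' hf m) (fun k => (hf k).trans (h k)) ih h k

lemma pstep_mono {m : ℕ} {f g : ℝ[X]} (hf : ∀ k, 0 ≤ f.coeff k) 
    (h : ∀ k, f.coeff k ≤ g.coeff k) (k : ℕ) : (pstep m f).coeff k ≤ (pstep m g).coeff k := by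
  rw [pstep_coeff, pstep_coeff]
  have := coeff_pow_mono hf h m
  split_ifs
  · exact add_le_add (this _) (this _)
  · simpa using this _

lemma pstep_iter_nonneg {m : ℕ} {f : ℝ[X]} (hf : ∀ k, 0 ≤ f.coeff k) (n k : ℕ) :
    0 ≤ ((pstep m)^[n] f).coeff k := by
  induction n generalizing k with
  | zero => exact hf k
  | succ n ih => rw [Function.iterate_succ_apply']; exact pstep_nonneg ih k

lemma pstep_iter_mono {m : ℕ} {f g : ℝ[X]} (hf : ∀ k, 0 ≤ f.coeff k) 
    (h : ∀ k, f.coeff k ≤ g.coeff k) (n k : ℕ) :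
    ((pstep m)^[n] f).coeff k ≤ ((pstep m)^[n] g).coeff k := by
  induction n generalizing k with
  | zero => exact h k
  | succ n ih =>
    rw [Function.iterate_succ_apply', Function.iterate_succ_apply']
    exact pstep_mono (pstep_iter_nonneg hf n) ih k

lemma pstep_natDegree (m : ℕ) (f : ℝ[X]) : (pstep m f).natDegree ≤ m * f.natDegree := by
  rw [natDegree_le_iff_coeff_eq_zero]
  intro k hk
  rw [pstep_coeff]
  have h1 : (f ^ m).natDegree ≤ m * f.natDegree := natDegree_pow_le
  rw [coeff_eq_zero_of_natDegree_lt (by omega), if_neg (by omega), zero_add]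

lemma pstep_iter_natDegree (m : ℕ) (f : ℝ[X]) (n : ℕ) :
    ((pstep m)^[n] f).natDegree ≤ m ^ n * f.natDegree := by
  induction n with
  | zero => simp
  | succ n ih =>
    rw [Function.iterate_succ_apply']
    refine (pstep_natDegree _ _).trans ?_
    rw [pow_succ, mul_comm (m ^ n) m, mul_assoc]
    exact Nat.mul_le_mul_left _ ih

lemma ptr_natDegree (f : ℝ[X]) (K : ℕ) : (ptr f (K + 1)).natDegree ≤ K := by
  rw [natDegree_le_iff_coeff_eq_zero]
  intro k hk
  rw [ptr_coeff, if_neg (by omega)]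

open Classical in
lemma orbit_window (l : ℕ) {η ρ δ : ℝ} (hη : 0 < η) (hη1 : η ≤ 1) (hρ : 0 < ρ)
    (hρ1 : ρ ≤ 1 / 16) (hδ : 0 < δ) :
    ∃ τ K : ℕ, 1 ≤ τ ∧ ∀ μ : ℝ[X], Law μ → (l = 0 → Cond ρ μ) →
      (∀ i ≤ K, 1 / 4 < lowN ((pstep (l + 2))^[i] μ) 4) →
      (((Finset.range τ).filter fun i => η ≤ us ((pstep (l + 2))^[i] μ)).card : ℝ) ≤ δ * τ := by
  obtain ⟨M, hM⟩ : ∃ M, M = (l:ℝ) + 2 := ⟨_, rfl⟩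
  have hl : (0:ℝ) ≤ l := Nat.cast_nonneg l
  have hM2 : 2 ≤ M := by linarith
  have hMc : (((l + 2 : ℕ)) : ℝ) = M := by rw [hM]; push_cast; rfl
  obtain ⟨τ0, hτ0⟩ := window l (η := η / 2) (ρ := ρ / 2) (C0 := 6 * M ^ 4) (δ := δ) (by linarith)
    (by linarith) (by linarith) (by linarith) hδ
  obtain ⟨τ, hτd⟩ : ∃ τ, τ = max τ0 1 := ⟨_, rfl⟩
  -- ζ
  obtain ⟨ζ, hζ⟩ : ∃ ζ, ζ = min (η / 2) (ρ / 2) := ⟨_, rfl⟩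
  have hζ0 : 0 < ζ := by rw [hζ]; exact lt_min (by linarith) (by linarith)
  have hζη : ζ ≤ η / 2 := by rw [hζ]; exact min_le_left _ _
  have hζρ : ζ ≤ ρ / 2 := by rw [hζ]; exact min_le_right _ _
  obtain ⟨E, hE⟩ : ∃ E : ℕ, 3 / ζ < M ^ E := pow_unbounded_of_one_lt _ (by linarith)
  have hE' : 3 ≤ ζ * M ^ E := by rw [div_lt_iff₀ hζ0] at hE; linarith
  obtain ⟨Λ, hΛ⟩ : ∃ Λ, Λ = τ + E + 3 := ⟨_, rfl⟩
  refine ⟨τ, τ + (l + 2) ^ τ * Λ, by omega, fun μ hμ hc hgood => ?_⟩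
  obtain ⟨g, hg⟩ : ∃ g : ℕ → ℝ[X], ∀ i, (pstep (l + 2))^[i] μ = g i := ⟨_, fun _ => rfl⟩
  have hgl : ∀ i, Law (g i) := fun i => hg i ▸ hμ.iter i
  -- tails
  have htail : ∀ i k, i + k ≤ τ + (l + 2) ^ τ * Λ → tl (g i) (4 + k) * M ^ k ≤ 3 := by
    intro i k hik
    have := tl_bound (m := l + 2) (hgl i) k (by
      have h1 := hgood (i + k) hik
      rw [add_comm i k, Function.iterate_add_apply, hg] at h1; exact h1)
    rwa [hMc] at this
  have hΛle : Λ ≤ (l + 2) ^ τ * Λ := Nat.le_mul_of_pos_left _ (by positivity)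
  obtain ⟨σ, hσ⟩ : ∃ σ, σ = (ptr μ (Λ + 1)).eval 1 := ⟨_, rfl⟩
  have hσ1 : 1 - σ = tl μ (Λ + 1) := by
    rw [hσ, ptr_eval, tl, lowN_eq hμ.1]
  have hσt : (1 - σ) * M ^ τ ≤ ζ := by
    have h1 := htail 0 (τ + E) (by omega)
    have e : g 0 = μ := by rw [← hg]; rfl
    have e2 : 4 + (τ + E) = Λ + 1 := by omega
    rw [e, e2, ← hσ1, pow_add] at h1
    have hME : 0 < M ^ E := pow_pos (by linarith) E
    refine le_of_mul_le_mul_right ?_ hME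
    linarith
  have hMτ : 1 ≤ M ^ τ := one_le_pow₀ (by linarith)
  have hσ0 : 0 ≤ 1 - σ := hσ1 ▸ tl_nonneg hμ _
  have hσζ : 1 - σ ≤ ζ := by
    have := mul_le_mul_of_nonneg_left hMτ hσ0
    linarith
  have hσpos : 0 < σ := by linarith
  -- normalised
  obtain ⟨f, hf⟩ : ∃ f, f = C σ⁻¹ * ptr μ (Λ + 1) := ⟨_, rfl⟩
  have hfl : Law f := by
    constructor
    · intro k
      rw [hf, coeff_C_mul]
      exact mul_nonneg (inv_nonneg.2 hσpos.le) (ptr_nonneg hμ.1 _ _)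
    · rw [hf, eval_C_mul, ← hσ, inv_mul_cancel₀ hσpos.ne']
  have hσi : ∀ i ≤ τ, 1 - ζ ≤ σ ^ ((l + 2) ^ i) := by
    intro i hi
    have h1 := one_add_mul_le_pow (by linarith : -2 ≤ -(1 - σ)) ((l + 2) ^ i)
    have e : 1 + -(1 - σ) = σ := by ring
    rw [e] at h1
    push_cast at h1
    rw [← hM] at h1
    have h2 : M ^ i ≤ M ^ τ := pow_le_pow_right₀ (by linarith) hi
    have h3 := mul_le_mul_of_nonneg_left h2 hσ0
    linarith
  have hfi : ∀ i k, ((pstep (l + 2))^[i] f).coeff k =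
      (σ ^ ((l + 2) ^ i))⁻¹ * ((pstep (l + 2))^[i] (ptr μ (Λ + 1))).coeff k := by
    intro i k
    rw [hf, pstep_iter_smul, coeff_C_mul, inv_pow]
  have hpm : ∀ i k, ((pstep (l + 2))^[i] (ptr μ (Λ + 1))).coeff k ≤ (g i).coeff k := by
    intro i k
    rw [← hg]
    refine pstep_iter_mono (ptr_nonneg hμ.1 _) (fun k => ?_) i k
    rw [ptr_coeff]; split_ifs
    · exact le_rfl
    · exact hμ.1 k
  have hle : ∀ i ≤ τ, ∀ k, ((pstep (l + 2))^[i] f).coeff k ≤ (σ ^ ((l + 2) ^ i))⁻¹ * (g i).coeff k := by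
    intro i hi k
    rw [hfi]
    exact mul_le_mul_of_nonneg_left (hpm i k) (inv_nonneg.2 (pow_nonneg hσpos.le _))
  have key := hτ0 τ (by omega) f hfl (by
    intro i hi k
    have hM0 : 0 < M := by linarith
    have hM4 : 0 < M ^ 4 := pow_pos hM0 4
    rw [← hM]
    rcases Nat.lt_or_ge ((l + 2) ^ τ * Λ) k with hk | hk
    · have h1 := pstep_iter_natDegree (l + 2) (ptr μ (Λ + 1)) i
      have h2 := ptr_natDegree μ Λ
      have h3 : (l + 2) ^ i ≤ (l + 2) ^ τ := Nat.pow_le_pow_right (by omega) hi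
      have h4 : (l + 2) ^ i * (ptr μ (Λ + 1)).natDegree ≤ (l + 2) ^ τ * Λ := Nat.mul_le_mul h3 h2
      rw [hfi, coeff_eq_zero_of_natDegree_lt (by omega), mul_zero, zero_mul]
      linarith
    · have hinv : (σ ^ ((l + 2) ^ i))⁻¹ ≤ 2 := by
        have := hσi i hi
        rw [inv_le_comm₀ (by linarith) (by norm_num)]
        linarith
      have hg3 : (g i).coeff k * M ^ k ≤ 3 * M ^ 4 := by
        rcases Nat.lt_or_ge k 4 with h4 | h4
        · have h1 : (g i).coeff k ≤ 1 := (coeff_le_tl (hgl i) k).trans (tl_le_one _ _)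
          have h2 : M ^ k ≤ M ^ 4 := pow_le_pow_right₀ (by linarith) h4.le
          have h3 : (g i).coeff k * M ^ k ≤ 1 * M ^ 4 :=
            mul_le_mul h1 h2 (pow_nonneg hM0.le _) (by norm_num)
          linarith
        · obtain ⟨k', rfl⟩ := Nat.exists_eq_add_of_le h4
          have h1 := htail i k' (by omega)
          have h2 := coeff_le_tl (hgl i) (4 + k')
          have h3 := mul_le_mul_of_nonneg_right h2 (pow_nonneg hM0.le k')
          rw [pow_add]
          have := mul_le_mul_of_nonneg_left (h3.trans h1) hM4.le
          linarith
      have h5 : ((pstep (l + 2))^[i] f).coeff k ≤ 2 * (g i).coeff k :=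
        (hle i hi k).trans (mul_le_mul_of_nonneg_right hinv ((hgl i).1 k))
      have h6 := mul_le_mul_of_nonneg_right h5 (pow_nonneg hM0.le k)
      linarith) (by
    intro h0 i hi
    have hc0 := hc h0
    subst h0
    have : Cond (ρ / 2) f := by
      have hinv : 1 ≤ σ⁻¹ := (one_le_inv₀ hσpos).2 (by linarith)
      rcases hc0 with h | h
      · left
        rw [hf, coeff_C_mul, ptr_coeff, if_pos (by omega)]
        have := mul_le_mul_of_nonneg_right hinv (hμ.1 0)
        linarith
      · right
        rw [tl, lowN_eq hμ.1, Finset.sum_range_succ, Finset.sum_range_one] at h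
        rw [tl, lowN_eq hfl.1, Finset.sum_range_succ, Finset.sum_range_one, hf, coeff_C_mul,
          coeff_C_mul, ptr_coeff, ptr_coeff, if_pos (by omega), if_pos (by omega)]
        have h1 : 1 = σ⁻¹ * σ := by rw [inv_mul_cancel₀ hσpos.ne']
        have h2 := mul_le_mul_of_nonneg_right hinv (by linarith : 0 ≤ σ - (μ.coeff 0 + μ.coeff 1))
        linarith
    exact cond_iter hfl (by linarith) (by linarith) this i)
  refine le_trans ?_ key
  norm_cast
  refine Finset.card_le_card fun i hi => ?_
  rw [Finset.mem_filter, Finset.mem_range] at hi ⊢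
  refine ⟨hi.1, ?_⟩
  have h1 := hi.2
  rw [hg] at h1
  have h2 := hle i hi.1.le 0
  have h3 := hσi i hi.1.le
  have h4 : 0 < σ ^ ((l + 2) ^ i) := by linarith
  unfold us at h1 ⊢
  have h5 : (σ ^ ((l + 2) ^ i))⁻¹ * (g i).coeff 0 ≤ 1 - η / 2 := by
    rw [inv_mul_le_iff₀ h4]
    have h6 : (1 - η / 2) * (1 - η / 2) ≤ σ ^ ((l + 2) ^ i) * (1 - η / 2) :=
      mul_le_mul_of_nonneg_right (by linarith) (by linarith)
    nlinarith [sq_nonneg η]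
  linarith

open Classical in
/-- number of `η`-times before `i` -/
def cnt (η : ℝ) (g : ℕ → ℝ[X]) (i : ℕ) : ℕ := ((Finset.range i).filter fun j => η ≤ us (g j)).card

lemma cnt_le (η : ℝ) (g : ℕ → ℝ[X]) (i : ℕ) : cnt η g i ≤ i := by
  unfold cnt; refine (Finset.card_filter_le _ _).trans ?_; simp

open Classical in
lemma cnt_add (η : ℝ) (g : ℕ → ℝ[X]) (i j : ℕ) :
    cnt η g (i + j) = cnt η g i + cnt η (fun k => g (i + k)) j := by
  unfold cnt
  rw [Finset.card_filter, Finset.card_filter, Finset.card_filter, Finset.sum_range_add]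

lemma cnt_succ (η : ℝ) (g : ℕ → ℝ[X]) (i : ℕ) :
    cnt η g (i + 1) = cnt η g i + (open Classical in if η ≤ us (g i) then 1 else 0) := by
  classical
  unfold cnt
  rw [Finset.card_filter, Finset.card_filter, Finset.sum_range_succ]

lemma orbit_count (l : ℕ) {η ρ δ : ℝ} (hη : 0 < η) (hη1 : η ≤ 1) (hρ : 0 < ρ)
    (hρ1 : ρ ≤ 1 / 16) (hδ : 0 < δ) :
    ∃ K : ℕ, ∀ μ : ℝ[X], Law μ → (l = 0 → Cond ρ μ) → ∀ N : ℕ,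
      (∀ i ≤ N, 1 / 4 < lowN ((pstep (l + 2))^[i] μ) 4) → ∀ i ≤ N + 1,
      (cnt η (fun j => (pstep (l + 2))^[j] μ) i : ℝ) ≤ δ * i + K := by
  obtain ⟨τ, K, hτ, hw⟩ := orbit_window l hη hη1 hρ hρ1 hδ
  refine ⟨τ + K + 1, fun μ hμ hc N hgood => ?_⟩
  obtain ⟨g, hg⟩ : ∃ g : ℕ → ℝ[X], g = fun j => (pstep (l + 2))^[j] μ := ⟨_, rfl⟩
  rw [← hg]
  have hwin : ∀ j, j + K ≤ N → (cnt η (fun k => g (j + k)) τ : ℝ) ≤ δ * τ := by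
    intro j hj
    have e : ∀ i, (pstep (l + 2))^[i] ((pstep (l + 2))^[j] μ) = g (j + i) := by
      intro i; simp only [hg, ← Function.iterate_add_apply, add_comm i j]
    have := hw ((pstep (l + 2))^[j] μ) (hμ.iter j) (fun h0 => by
      have := hc h0
      subst h0
      exact cond_iter hμ hρ hρ1 this j) (fun i hi => by
        rw [e, hg]; exact hgood _ (by omega))
    simp only [e] at this
    exact this
  have claimA : ∀ i, i + K ≤ N + τ → (cnt η g i : ℝ) ≤ δ * i + τ := by
    intro i
    induction i using Nat.strong_induction_on with
    | _ i ih =>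
      intro hi
      rcases Nat.lt_or_ge i τ with h | h
      · have h1 : (cnt η g i : ℝ) ≤ τ := by exact_mod_cast (cnt_le η g i).trans h.le
        have : 0 ≤ δ * i := by positivity
        linarith
      · obtain ⟨j, rfl⟩ := Nat.exists_eq_add_of_le' h
        have h1 := ih j (by omega) (by omega)
        have h2 := hwin j (by omega)
        rw [cnt_add]
        push_cast
        linarith
  intro i hi
  rcases Nat.lt_or_ge i (K + 1) with h | h
  · have h1 : (cnt η g i : ℝ) ≤ ((τ + K + 1 : ℕ) : ℝ) := by
      exact_mod_cast (cnt_le η g i).trans (by omega)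
    have : 0 ≤ δ * i := by positivity
    linarith
  · obtain ⟨j, rfl⟩ := Nat.exists_eq_add_of_le' h
    have h1 := claimA j (by omega)
    have h2 : (cnt η (fun k => g (j + k)) (K + 1) : ℝ) ≤ ((K + 1 : ℕ) : ℝ) := by
      exact_mod_cast cnt_le _ _ _
    rw [cnt_add]
    push_cast at h2 ⊢
    have : 0 ≤ δ * ((K:ℝ) + 1) := by positivity
    linarith

section wnorm
variable {R : Type*} [NormedCommRing R]

/-- weighted norm of the coefficients -/
def wn (s : ℝ) (T : ℕ) (f : R[X]) : ℝ := ∑' k, ‖f.coeff k‖ * s ^ min k T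

/-- weighted norm of the coefficients of positive index -/
def wp (s : ℝ) (T : ℕ) (f : R[X]) : ℝ := ∑' k, ‖f.coeff (k + 1)‖ * s ^ min (k + 1) T

lemma coeff_zero_large (f : R[X]) (k : ℕ) (hk : k ∉ Finset.range (f.natDegree + 1)) :
    f.coeff k = 0 := coeff_eq_zero_of_natDegree_lt (by simpa using hk)

lemma wn_summable (s : ℝ) (T : ℕ) (f : R[X]) : Summable fun k => ‖f.coeff k‖ * s ^ min k T :=
  summable_of_ne_finset_zero (s := Finset.range (f.natDegree + 1)) fun k hk => by
    rw [coeff_zero_large f k hk]; simp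

lemma wp_summable (s : ℝ) (T : ℕ) (f : R[X]) :
    Summable fun k => ‖f.coeff (k + 1)‖ * s ^ min (k + 1) T :=
  (summable_nat_add_iff (f := fun k => ‖f.coeff k‖ * s ^ min k T) 1).2 (wn_summable s T f)

lemma wn_eq (s : ℝ) (T : ℕ) (f : R[X]) : wn s T f = ‖f.coeff 0‖ + wp s T f := by
  unfold wn wp
  rw [(wn_summable s T f).tsum_eq_zero_add]; simp

lemma wn_nonneg {s : ℝ} (hs : 1 ≤ s) (T : ℕ) (f : R[X]) : 0 ≤ wn s T f :=
  tsum_nonneg fun _ => mul_nonneg (norm_nonneg _) (pow_nonneg (by linarith) _)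

lemma wp_nonneg {s : ℝ} (hs : 1 ≤ s) (T : ℕ) (f : R[X]) : 0 ≤ wp s T f :=
  tsum_nonneg fun _ => mul_nonneg (norm_nonneg _) (pow_nonneg (by linarith) _)

lemma wp_le_wn (s : ℝ) (T : ℕ) (f : R[X]) : wp s T f ≤ wn s T f := by
  rw [wn_eq]; linarith [norm_nonneg (f.coeff 0)]

lemma coeff_zero_le_wn {s : ℝ} (hs : 1 ≤ s) (T : ℕ) (f : R[X]) : ‖f.coeff 0‖ ≤ wn s T f := by
  rw [wn_eq]; linarith [wp_nonneg hs T f]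

lemma wn_add_le {s : ℝ} (hs : 1 ≤ s) (T : ℕ) (f g : R[X]) :
    wn s T (f + g) ≤ wn s T f + wn s T g := by
  unfold wn
  rw [← (wn_summable s T f).tsum_add (wn_summable s T g)]
  refine (wn_summable s T (f + g)).tsum_le_tsum (fun k => ?_)
    ((wn_summable s T f).add (wn_summable s T g))
  rw [coeff_add, ← add_mul]
  exact mul_le_mul_of_nonneg_right (norm_add_le _ _) (pow_nonneg (by linarith) _)

lemma wp_add_le {s : ℝ} (hs : 1 ≤ s) (T : ℕ) (f g : R[X]) :
    wp s T (f + g) ≤ wp s T f + wp s T g := by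
  unfold wp
  rw [← (wp_summable s T f).tsum_add (wp_summable s T g)]
  refine (wp_summable s T (f + g)).tsum_le_tsum (fun k => ?_)
    ((wp_summable s T f).add (wp_summable s T g))
  rw [coeff_add, ← add_mul]
  exact mul_le_mul_of_nonneg_right (norm_add_le _ _) (pow_nonneg (by linarith) _)

lemma wn_mul_le {s : ℝ} (hs : 1 ≤ s) (T : ℕ) (f g : R[X]) :
    wn s T (f * g) ≤ wn s T f * wn s T g := by
  have hs0 : 0 ≤ s := by linarith
  have hnn : ∀ (h : R[X]) k, 0 ≤ ‖h.coeff k‖ * s ^ min k T := fun h k =>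
    mul_nonneg (norm_nonneg _) (pow_nonneg hs0 _)
  have hsum : ∀ h : R[X], Summable fun k => ‖‖h.coeff k‖ * s ^ min k T‖ := fun h =>
    (wn_summable s T h).norm
  unfold wn
  rw [tsum_mul_tsum_eq_tsum_sum_antidiagonal_of_summable_norm (hsum f) (hsum g)]
  refine (wn_summable s T (f * g)).tsum_le_tsum (fun k => ?_)
    (summable_norm_sum_mul_antidiagonal_of_summable_norm (hsum f) (hsum g)).of_norm
  rw [coeff_mul]
  refine (mul_le_mul_of_nonneg_right (norm_sum_le _ _) (pow_nonneg hs0 _)).trans ?_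
  rw [Finset.sum_mul]
  refine Finset.sum_le_sum fun x hx => ?_
  have hx' := Finset.HasAntidiagonal.mem_antidiagonal.1 hx
  have h1 : s ^ min k T ≤ s ^ min x.1 T * s ^ min x.2 T := by
    rw [← pow_add]; exact pow_le_pow_right₀ hs (by omega)
  calc ‖f.coeff x.1 * g.coeff x.2‖ * s ^ min k T
      ≤ (‖f.coeff x.1‖ * ‖g.coeff x.2‖) * (s ^ min x.1 T * s ^ min x.2 T) :=
        mul_le_mul (norm_mul_le _ _) h1 (pow_nonneg hs0 _)
          (mul_nonneg (norm_nonneg _) (norm_nonneg _))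
    _ = _ := by ring

lemma wp_C_mul_le {s : ℝ} (hs : 1 ≤ s) (T : ℕ) (c : R) (g : R[X]) :
    wp s T (C c * g) ≤ ‖c‖ * wp s T g := by
  unfold wp
  rw [← tsum_mul_left]
  refine (wp_summable s T _).tsum_le_tsum (fun k => ?_) ((wp_summable s T g).mul_left _)
  rw [coeff_C_mul, ← mul_assoc]
  exact mul_le_mul_of_nonneg_right (norm_mul_le _ _) (pow_nonneg (by linarith) _)

lemma wn_sub_C (s : ℝ) (T : ℕ) (f : R[X]) : wn s T (f - C (f.coeff 0)) = wp s T f := by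
  rw [wn_eq]
  simp [wp]

lemma wp_mul_le {s : ℝ} (hs : 1 ≤ s) (T : ℕ) (f g : R[X]) :
    wp s T (f * g) ≤ wp s T f * wn s T g + ‖f.coeff 0‖ * wp s T g := by
  have e : f * g = (f - C (f.coeff 0)) * g + C (f.coeff 0) * g := by ring
  rw [e]
  refine (wp_add_le hs T _ _).trans (add_le_add ?_ (wp_C_mul_le hs T _ _))
  refine (wp_le_wn s T _).trans ((wn_mul_le hs T _ _).trans ?_)
  rw [wn_sub_C]

lemma wn_one [NormOneClass R] (s : ℝ) (T : ℕ) : wn s T (1 : R[X]) = 1 := by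
  rw [wn_eq]
  simp [wp, coeff_one]

lemma wp_one (s : ℝ) (T : ℕ) : wp s T (1 : R[X]) = 0 := by
  simp [wp, coeff_one]

lemma coeff_zero_le_wp {s : ℝ} (hs : 1 ≤ s) (T : ℕ) (d : R[X]) (h : d.eval 1 = 0) :
    ‖d.coeff 0‖ ≤ wp s T d := by
  rw [eval_one_eq d (d.natDegree + 1) (by omega), Finset.sum_range_succ'] at h
  have : d.coeff 0 = -∑ k ∈ Finset.range d.natDegree, d.coeff (k + 1) := by
    rw [eq_neg_iff_add_eq_zero, add_comm]; exact h
  rw [this, norm_neg]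
  refine (norm_sum_le _ _).trans ?_
  refine le_trans ?_ ((wp_summable s T d).sum_le_tsum (Finset.range d.natDegree) fun k _ =>
    mul_nonneg (norm_nonneg _) (pow_nonneg (by linarith) _))
  refine Finset.sum_le_sum fun k _ => ?_
  exact le_mul_of_one_le_right (norm_nonneg _) (one_le_pow₀ hs)

lemma lowN_le_wn {s : ℝ} (hs : 1 ≤ s) (T : ℕ) (d : R[X]) (K : ℕ) : lowN d K ≤ wn s T d := by
  refine le_trans ?_ ((wn_summable s T d).sum_le_tsum (Finset.range K) fun k _ =>
    mul_nonneg (norm_nonneg _) (pow_nonneg (by linarith) _))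
  refine Finset.sum_le_sum fun k _ => ?_
  exact le_mul_of_one_le_right (norm_nonneg _) (one_le_pow₀ hs)

lemma lowN_add_le (f g : R[X]) (K : ℕ) : lowN (f + g) K ≤ lowN f K + lowN g K := by
  unfold lowN
  rw [← Finset.sum_add_distrib]
  exact Finset.sum_le_sum fun k _ => by rw [coeff_add]; exact norm_add_le _ _

lemma lowN_mono (f : R[X]) {j k : ℕ} (h : j ≤ k) : lowN f j ≤ lowN f k :=
  Finset.sum_le_sum_of_subset_of_nonneg (Finset.range_mono h) fun _ _ _ => norm_nonneg _

variable [NormOneClass R]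

lemma wn_prod_le {s : ℝ} (hs : 1 ≤ s) (T : ℕ) {a b : R[X]} {Γ : ℝ}
    (ha : wn s T a ≤ Γ) (hb : wn s T b ≤ Γ) (i j : ℕ) :
    wn s T (a ^ i * b ^ j) ≤ Γ ^ (i + j) := by
  have hΓ : 0 ≤ Γ := (wn_nonneg hs T a).trans ha
  induction i with
  | zero =>
    induction j with
    | zero => simp [wn_one]
    | succ j ih =>
      have e : a ^ 0 * b ^ (j + 1) = (a ^ 0 * b ^ j) * b := by ring
      rw [e, ← add_assoc, pow_succ]
      exact (wn_mul_le hs T _ _).trans (mul_le_mul ih hb (wn_nonneg hs T b) (pow_nonneg hΓ _))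
  | succ i ih =>
    have e : a ^ (i + 1) * b ^ j = (a ^ i * b ^ j) * a := by ring
    have e2 : i + 1 + j = i + j + 1 := by ring
    rw [e, e2, pow_succ]
    exact (wn_mul_le hs T _ _).trans (mul_le_mul ih ha (wn_nonneg hs T a) (pow_nonneg hΓ _))

lemma wp_prod_aux {s : ℝ} (hs : 1 ≤ s) (T : ℕ) {f a : R[X]} {Γ v : ℝ} (n : ℕ) (hv : 0 ≤ v)
    (h1 : 1 ≤ Γ) (ha : wn s T a ≤ Γ) (hva : wp s T a ≤ v) (hf : wn s T f ≤ Γ ^ n)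
    (hvf : wp s T f ≤ n * v * Γ ^ n) :
    wp s T (f * a) ≤ (n + 1 : ℕ) * v * Γ ^ (n + 1) := by
  have hΓ : 0 ≤ Γ := by linarith
  refine (wp_mul_le hs T f a).trans ?_
  have h2 : wp s T f * wn s T a ≤ (n * v * Γ ^ n) * Γ :=
    mul_le_mul hvf ha (wn_nonneg hs T a) (mul_nonneg (mul_nonneg (Nat.cast_nonneg _) hv)
      (pow_nonneg hΓ _))
  have h3 : ‖f.coeff 0‖ * wp s T a ≤ Γ ^ n * v :=
    mul_le_mul ((coeff_zero_le_wn hs T f).trans hf) hva (wp_nonneg hs T a) (pow_nonneg hΓ _)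
  have h4 : Γ ^ n * v ≤ Γ ^ n * v * Γ :=
    le_mul_of_one_le_right (mul_nonneg (pow_nonneg hΓ _) hv) h1
  push_cast
  rw [pow_succ]
  linarith

lemma wp_prod_le {s : ℝ} (hs : 1 ≤ s) (T : ℕ) {a b : R[X]} {Γ v : ℝ} (hv : 0 ≤ v)
    (h1 : 1 ≤ Γ) (ha : wn s T a ≤ Γ) (hb : wn s T b ≤ Γ)
    (hva : wp s T a ≤ v) (hvb : wp s T b ≤ v) (i j : ℕ) :
    wp s T (a ^ i * b ^ j) ≤ (i + j : ℕ) * v * Γ ^ (i + j) := by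
  induction i with
  | zero =>
    induction j with
    | zero => simp [wp_one]
    | succ j ih =>
      have e : a ^ 0 * b ^ (j + 1) = (a ^ 0 * b ^ j) * b := by ring
      rw [e, ← add_assoc]
      exact wp_prod_aux hs T _ hv h1 hb hvb (wn_prod_le hs T ha hb 0 j) ih
  | succ i ih =>
    have e : a ^ (i + 1) * b ^ j = (a ^ i * b ^ j) * a := by ring
    have e2 : i + 1 + j = i + j + 1 := by ring
    rw [e, e2]
    exact wp_prod_aux hs T _ hv h1 ha hva (wn_prod_le hs T ha hb i j) ih

lemma wn_sum_le {s : ℝ} (hs : 1 ≤ s) (T : ℕ) (n : ℕ) (f : ℕ → R[X]) {B : ℝ}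
    (h : ∀ i < n, wn s T (f i) ≤ B) : wn s T (∑ i ∈ Finset.range n, f i) ≤ n * B := by
  induction n with
  | zero => simp [wn]
  | succ n ih =>
    rw [Finset.sum_range_succ]
    refine (wn_add_le hs T _ _).trans ?_
    have := ih fun i hi => h i (by omega)
    have := h n (by omega)
    push_cast; linarith

lemma wp_sum_le {s : ℝ} (hs : 1 ≤ s) (T : ℕ) (n : ℕ) (f : ℕ → R[X]) {B : ℝ}
    (h : ∀ i < n, wp s T (f i) ≤ B) : wp s T (∑ i ∈ Finset.range n, f i) ≤ n * B := by
  induction n with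
  | zero => simp [wp]
  | succ n ih =>
    rw [Finset.sum_range_succ]
    refine (wp_add_le hs T _ _).trans ?_
    have := ih fun i hi => h i (by omega)
    have := h n (by omega)
    push_cast; linarith

lemma wp_pstep_sub {s : ℝ} (hs : 1 ≤ s) (T m : ℕ) (a b : R[X]) :
    s * wp s T (pstep m a - pstep m b) ≤ wp s (T + 1) (a ^ m - b ^ m) := by
  have hs0 : 0 ≤ s := by linarith
  have hS := wp_summable s (T + 1) (a ^ m - b ^ m)
  have h2 := hS.tsum_eq_zero_add
  unfold wp
  rw [h2, ← tsum_mul_left]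
  have : ∀ k, s * (‖(pstep m a - pstep m b).coeff (k + 1)‖ * s ^ min (k + 1) T)
      = ‖(a ^ m - b ^ m).coeff (k + 1 + 1)‖ * s ^ min (k + 1 + 1) (T + 1) := by
    intro k
    rw [coeff_sub, pstep_coeff, pstep_coeff, coeff_sub, if_neg (by omega), if_neg (by omega),
      add_zero, add_zero]
    have : min (k + 1 + 1) (T + 1) = min (k + 1) T + 1 := by omega
    rw [this, pow_succ]; ring
  simp only [this]
  linarith [mul_nonneg (norm_nonneg ((a ^ m - b ^ m).coeff (0 + 1)))
    (pow_nonneg hs0 (min (0 + 1) (T + 1)))]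

lemma wn_pstep_sub {s : ℝ} (hs : 1 ≤ s) (m : ℕ) (a b : R[X]) :
    wn s 0 (pstep m a - pstep m b) ≤ wn s 0 (a ^ m - b ^ m) := by
  rw [wn_eq, wn_eq]
  have h2 := (wp_summable s 0 (a ^ m - b ^ m)).tsum_eq_zero_add
  have h3 : wp s 0 (pstep m a - pstep m b)
      = ∑' k, ‖(a ^ m - b ^ m).coeff (k + 1 + 1)‖ * s ^ min (k + 1 + 1) 0 := by
    unfold wp
    refine tsum_congr fun k => ?_
    rw [coeff_sub, pstep_coeff, pstep_coeff, coeff_sub, if_neg (by omega), if_neg (by omega),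
      add_zero, add_zero]
    simp
  have h4 : ‖(pstep m a - pstep m b).coeff 0‖
      ≤ ‖(a ^ m - b ^ m).coeff (0 + 1)‖ + ‖(a ^ m - b ^ m).coeff 0‖ := by
    rw [coeff_sub, pstep_coeff, pstep_coeff, coeff_sub, coeff_sub, if_pos rfl, if_pos rfl]
    refine le_trans (le_of_eq ?_) (norm_add_le _ _)
    congr 1; ring
  rw [h3]
  unfold wp
  rw [h2]
  simp only [Nat.min_zero, pow_zero, mul_one] at *
  linarith

/-- one step of the perturbation estimate -/
lemma wp_step {s : ℝ} (hs : 1 ≤ s) (T n : ℕ) {a b : R[X]} {Γ v : ℝ} (hv : 0 ≤ v)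
    (h1 : 1 ≤ Γ) (ha : wn s (T + 1) a ≤ Γ) (hb : wn s (T + 1) b ≤ Γ)
    (hva : wp s (T + 1) a ≤ v) (hvb : wp s (T + 1) b ≤ v) (he : a.eval 1 = b.eval 1) :
    s * wp s T (pstep (n + 1) a - pstep (n + 1) b)
      ≤ (n + 1) * Γ ^ n * (1 + n * v) * wp s (T + 1) (a - b) := by
  refine (wp_pstep_sub hs T (n + 1) a b).trans ?_
  obtain ⟨W, hW⟩ : ∃ W, W = ∑ i ∈ Finset.range (n + 1), a ^ i * b ^ (n - i) := ⟨_, rfl⟩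
  have e : a ^ (n + 1) - b ^ (n + 1) = (a - b) * W := by
    rw [hW, ← (Commute.all a b).mul_geom_sum₂ (n + 1)]
    rfl
  have hWn : wn s (T + 1) W ≤ (n + 1 : ℕ) * Γ ^ n := by
    rw [hW]
    refine wn_sum_le hs _ _ _ fun i hi => ?_
    have := wn_prod_le hs (T + 1) ha hb i (n - i)
    rwa [show i + (n - i) = n by omega] at this
  have hWp : wp s (T + 1) W ≤ (n + 1 : ℕ) * (n * v * Γ ^ n) := by
    rw [hW]
    refine wp_sum_le hs _ _ _ fun i hi => ?_
    have := wp_prod_le hs (T + 1) hv h1 ha hb hva hvb i (n - i)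
    rwa [show i + (n - i) = n by omega] at this
  rw [e]
  refine (wp_mul_le hs _ _ _).trans ?_
  have h0 : ‖(a - b).coeff 0‖ ≤ wp s (T + 1) (a - b) :=
    coeff_zero_le_wp hs _ _ (by rw [eval_sub, he, sub_self])
  have hd := wp_nonneg hs (T + 1) (a - b)
  have h2 := mul_le_mul_of_nonneg_left hWn hd
  have h3 : ‖(a - b).coeff 0‖ * wp s (T + 1) W
      ≤ wp s (T + 1) (a - b) * ((n + 1 : ℕ) * (n * v * Γ ^ n)) :=
    mul_le_mul h0 hWp (wp_nonneg hs _ _) hd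
  refine (add_le_add h2 h3).trans (le_of_eq ?_)
  push_cast
  ring

lemma wn_step {s : ℝ} (hs : 1 ≤ s) (n : ℕ) {a b : R[X]} {Γ : ℝ}
    (ha : wn s 0 a ≤ Γ) (hb : wn s 0 b ≤ Γ) :
    wn s 0 (pstep (n + 1) a - pstep (n + 1) b) ≤ (n + 1) * Γ ^ n * wn s 0 (a - b) := by
  refine (wn_pstep_sub hs (n + 1) a b).trans ?_
  obtain ⟨W, hW⟩ : ∃ W, W = ∑ i ∈ Finset.range (n + 1), a ^ i * b ^ (n - i) := ⟨_, rfl⟩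
  have e : a ^ (n + 1) - b ^ (n + 1) = (a - b) * W := by
    rw [hW, ← (Commute.all a b).mul_geom_sum₂ (n + 1)]
    rfl
  have hWn : wn s 0 W ≤ (n + 1 : ℕ) * Γ ^ n := by
    rw [hW]
    refine wn_sum_le hs _ _ _ fun i hi => ?_
    have := wn_prod_le hs 0 ha hb i (n - i)
    rwa [show i + (n - i) = n by omega] at this
  rw [e]
  refine (wn_mul_le hs _ _ _).trans ?_
  have := mul_le_mul_of_nonneg_left hWn (wn_nonneg hs 0 (a - b))
  push_cast at this
  linarith

end wnorm

lemma wn_map (s : ℝ) (T : ℕ) (f : ℝ[X]) : wn s T (f.map Complex.ofRealHom) = wn s T f := by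
  unfold wn; refine tsum_congr fun k => ?_
  rw [coeff_map]; simp

lemma wp_map (s : ℝ) (T : ℕ) (f : ℝ[X]) : wp s T (f.map Complex.ofRealHom) = wp s T f := by
  unfold wp; refine tsum_congr fun k => ?_
  rw [coeff_map]; simp

lemma lowN_map (f : ℝ[X]) (K : ℕ) : lowN (f.map Complex.ofRealHom) K = lowN f K := by
  unfold lowN; refine Finset.sum_congr rfl fun k _ => ?_
  rw [coeff_map]; simp

lemma law_wn_zero {f : ℝ[X]} (hf : Law f) (s : ℝ) : wn s 0 f = 1 := by
  unfold wn
  rw [tsum_eq_sum (s := Finset.range (f.natDegree + 1)) (fun k hk => by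
    rw [coeff_zero_large f k hk]; simp), ← hf.2, eval_one_eq f (f.natDegree + 1) (by omega)]
  refine Finset.sum_congr rfl fun k _ => ?_
  rw [Real.norm_of_nonneg (hf.1 k)]; simp

lemma law_wn_succ {f : ℝ[X]} (hf : Law f) (s : ℝ) (T : ℕ) :
    wn s (T + 1) f = wn s T f + (s - 1) * s ^ T * tl f (T + 1) := by
  obtain ⟨D, hD⟩ : ∃ D, D = max (f.natDegree + 1) (T + 1) := ⟨_, rfl⟩
  have hw : ∀ T, wn s T f = ∑ k ∈ Finset.range D, f.coeff k * s ^ min k T := by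
    intro T
    unfold wn
    rw [tsum_eq_sum (s := Finset.range D) (fun k hk => by
      rw [coeff_eq_zero_of_natDegree_lt (by rw [Finset.mem_range] at hk; omega)]; simp)]
    exact Finset.sum_congr rfl fun k _ => by rw [Real.norm_of_nonneg (hf.1 k)]
  have h1 : (1 : ℝ) = ∑ k ∈ Finset.range D, f.coeff k := by
    rw [← hf.2, eval_one_eq f D (by omega)]
  have h2 : tl f (T + 1) = ∑ k ∈ Finset.range D, if T + 1 ≤ k then f.coeff k else 0 := by
    rw [tl, h1, lowN_eq hf.1, sub_eq_iff_eq_add]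
    have : ∑ k ∈ Finset.range (T + 1), f.coeff k
        = ∑ k ∈ Finset.range D, if T + 1 ≤ k then 0 else f.coeff k := by
      rw [← Finset.sum_subset (Finset.range_mono (show T + 1 ≤ D by omega))]
      · refine Finset.sum_congr rfl fun k hk => ?_
        rw [Finset.mem_range] at hk
        rw [if_neg (by omega)]
      · intro k _ hk
        rw [Finset.mem_range] at hk
        rw [if_pos (by omega)]
    rw [this, ← Finset.sum_add_distrib]
    refine Finset.sum_congr rfl fun k _ => ?_
    split_ifs <;> simp
  rw [hw, hw, h2, Finset.mul_sum, ← Finset.sum_add_distrib]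
  refine Finset.sum_congr rfl fun k _ => ?_
  split_ifs with h
  · rw [show min k (T + 1) = T + 1 by omega, show min k T = T by omega, pow_succ]; ring
  · rw [show min k (T + 1) = k by omega, show min k T = k by omega]; ring

lemma law_wn_bound {f : ℝ[X]} (hf : Law f) {s M : ℝ} (hs : 1 ≤ s) (hsM : s < M) (T : ℕ)
    (ht : ∀ k ≤ T, tl f (4 + k) * M ^ k ≤ 3) (k0 : ℕ) :
    wn s T f ≤ 1 + s ^ k0 * us f + 3 * M ^ 3 * (s - 1) * (s / M) ^ k0 / (1 - s / M) := by
  have hM : 1 < M := by linarith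
  have hM0 : 0 < M := by linarith
  have hs0 : 0 ≤ s := by linarith
  obtain ⟨r, hr⟩ : ∃ r, r = s / M := ⟨_, rfl⟩
  have hr0 : 0 ≤ r := by rw [hr]; exact div_nonneg hs0 hM0.le
  have hr1 : r < 1 := by rw [hr, div_lt_one hM0]; exact hsM
  have hrM : r * M = s := by rw [hr]; field_simp
  rw [← hr]
  have hu0 := us_nonneg hf
  have htl1 : tl f 1 = us f := by rw [tl, lowN_eq hf.1, Finset.sum_range_one, us]
  have htl : ∀ j < T, tl f (j + 1) * M ^ j ≤ 3 * M ^ 3 := by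
    intro j hj
    rcases Nat.lt_or_ge j 3 with h | h
    · have h1 : M ^ j ≤ M ^ 3 := pow_le_pow_right₀ hM.le h.le
      have h2 := mul_le_mul (tl_le_one f (j + 1)) h1 (pow_nonneg hM0.le _) zero_le_one
      linarith [pow_pos hM0 3]
    · obtain ⟨k, rfl⟩ := Nat.exists_eq_add_of_le h
      have h1 := ht k (by omega)
      rw [show 3 + k + 1 = 4 + k by omega, pow_add]
      have := mul_le_mul_of_nonneg_left h1 (pow_pos hM0 3).le
      linarith
  obtain ⟨B, hB⟩ : ∃ B, B = 3 * M ^ 3 * (s - 1) := ⟨_, rfl⟩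
  have hB0 : 0 ≤ B := by
    rw [hB]; exact mul_nonneg (mul_nonneg (by norm_num) (pow_nonneg hM0.le _)) (by linarith)
  rw [← hB]
  -- induction on T with a sharper claim
  have key : ∀ t ≤ T, wn s t f ≤ 1 + (s ^ min t k0 - 1) * us f
      + B * (r ^ k0 - r ^ max t k0) / (1 - r) := by
    intro t
    induction t with
    | zero => intro _; rw [law_wn_zero hf]; simp
    | succ t ih =>
      intro h
      have ih := ih (by omega)
      rw [law_wn_succ hf]
      rcases Nat.lt_or_ge t k0 with h0 | h0
      · rw [show min t k0 = t by omega, show max t k0 = k0 by omega] at ih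
        rw [show min (t + 1) k0 = t + 1 by omega, show max (t + 1) k0 = k0 by omega]
        have h1 : tl f (t + 1) ≤ us f := by rw [← htl1]; exact tl_anti (by omega)
        have h2 := mul_le_mul_of_nonneg_left h1
          (mul_nonneg (by linarith : 0 ≤ s - 1) (pow_nonneg hs0 t))
        rw [pow_succ]
        linarith
      · rw [show min t k0 = k0 by omega, show max t k0 = t by omega] at ih
        rw [show min (t + 1) k0 = k0 by omega, show max (t + 1) k0 = t + 1 by omega]
        have h1 := htl t (by omega)
        have h2 := mul_le_mul_of_nonneg_left h1
          (mul_nonneg (by linarith : 0 ≤ s - 1) (pow_nonneg hr0 t))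
        have e1 : (s - 1) * r ^ t * (tl f (t + 1) * M ^ t) = (s - 1) * s ^ t * tl f (t + 1) := by
          rw [← hrM, mul_pow]; ring
        have e2 : (s - 1) * r ^ t * (3 * M ^ 3) = B * r ^ t := by rw [hB]; ring
        rw [e1, e2] at h2
        have e3 : B * (r ^ k0 - r ^ (t + 1)) / (1 - r)
            = B * (r ^ k0 - r ^ t) / (1 - r) + B * r ^ t := by
          have : 1 - r ≠ 0 := by linarith
          field_simp
          ring
        rw [e3]; linarith
  refine (key T le_rfl).trans ?_
  have h1 : s ^ min T k0 ≤ s ^ k0 := pow_le_pow_right₀ hs (by omega)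
  have h2 := mul_le_mul_of_nonneg_right h1 hu0
  have h3 : B * (r ^ k0 - r ^ max T k0) / (1 - r) ≤ B * r ^ k0 / (1 - r) := by
    refine div_le_div_of_nonneg_right (mul_le_mul_of_nonneg_left ?_ hB0) (by linarith)
    linarith [pow_nonneg hr0 (max T k0)]
  linarith

lemma law_wn_unif {s M : ℝ} (hs : 1 ≤ s) (hsM : s < M) : ∃ C : ℝ, 1 ≤ C ∧
    ∀ (f : ℝ[X]) (T : ℕ), Law f → (∀ k ≤ T, tl f (4 + k) * M ^ k ≤ 3) → wn s T f ≤ C := by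
  have hM0 : 0 < M := by linarith
  have hB0 : 0 ≤ 3 * M ^ 3 * (s - 1) * (s / M) ^ 0 / (1 - s / M) := by
    have hr1 : s / M < 1 := by rw [div_lt_one hM0]; exact hsM
    refine div_nonneg (mul_nonneg (mul_nonneg (mul_nonneg (by norm_num) (pow_nonneg hM0.le _))
      (by linarith)) ?_) (by linarith)
    rw [pow_zero]; norm_num
  refine ⟨2 + 3 * M ^ 3 * (s - 1) * (s / M) ^ 0 / (1 - s / M), by linarith, fun f T hf ht => ?_⟩
  have := law_wn_bound hf hs hsM T ht 0
  have h1 : us f ≤ 1 := by unfold us; linarith [hf.1 0]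
  rw [pow_zero, one_mul] at this
  linarith

lemma law_wn_small {s M : ℝ} (hs : 1 ≤ s) (hsM : s < M) {ε : ℝ} (hε : 0 < ε) :
    ∃ η : ℝ, 0 < η ∧ η ≤ 1 ∧ η ≤ ε ∧
    ∀ (f : ℝ[X]) (T : ℕ), Law f → (∀ k ≤ T, tl f (4 + k) * M ^ k ≤ 3) → us f < η →
      wn s T f ≤ 1 + ε := by
  have hM0 : 0 < M := by linarith
  have hr1 : s / M < 1 := by rw [div_lt_one hM0]; exact hsM
  have hr0 : 0 ≤ s / M := div_nonneg (by linarith) hM0.le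
  have hlim : Tendsto (fun k => 3 * M ^ 3 * (s - 1) * (s / M) ^ k / (1 - s / M)) atTop
      (nhds (3 * M ^ 3 * (s - 1) * 0 / (1 - s / M))) :=
    ((tendsto_pow_atTop_nhds_zero_of_lt_one hr0 hr1).const_mul _).div_const _
  rw [mul_zero, zero_div] at hlim
  obtain ⟨k0, hk0⟩ := (hlim.eventually (gt_mem_nhds (half_pos hε))).exists
  have hsk : 0 < s ^ k0 := pow_pos (by linarith) _
  refine ⟨min (min 1 ε) (ε / 2 / s ^ k0), lt_min (lt_min one_pos hε) (div_pos (half_pos hε) hsk),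
    (min_le_left _ _).trans (min_le_left _ _), (min_le_left _ _).trans (min_le_right _ _),
    fun f T hf ht hu => ?_⟩
  have h1 := law_wn_bound hf hs hsM T ht k0
  have h2 : us f < ε / 2 / s ^ k0 := hu.trans_le (min_le_right _ _)
  rw [lt_div_iff₀ hsk] at h2
  linarith


lemma iter_eval_one {R : Type*} [CommRing R] (m : ℕ) (a : R[X]) (h : a.eval 1 = 1) (i : ℕ) :
    ((pstep m)^[i] a).eval 1 = 1 := by
  induction i with
  | zero => exact h
  | succ i ih => rw [Function.iterate_succ_apply', pstep_eval_one, ih, one_pow]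

lemma map_eval_one {f : ℝ[X]} (hf : Law f) : (f.map Complex.ofRealHom).eval 1 = 1 := by
  have := Polynomial.eval_map_apply (f := Complex.ofRealHom) (p := f) 1
  rw [hf.2] at this
  simpa using this

/-- parameters for the perturbation -/
lemma pert_param (l : ℕ) {θ : ℝ} (hθ : 1 < θ) (hθ2 : θ < 2) : ∃ s : ℝ, 1 ≤ s ∧ s < (l : ℝ) + 2 ∧
    ∃ ε : ℝ, 0 < ε ∧ ε ≤ 1 ∧
      ((l + 1 : ℕ) + 1) * (1 + 3 * ε) ^ (l + 1) * (1 + (l + 1 : ℕ) * (3 * ε)) ≤ s * θ := by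
  have hl : (0 : ℝ) ≤ l := Nat.cast_nonneg l
  obtain ⟨t, ht1, htθ⟩ : ∃ t : ℝ, 1 < t ∧ t < θ := exists_between hθ
  refine ⟨((l : ℝ) + 2) / t, ?_, ?_, ?_⟩
  · rw [le_div_iff₀ (by linarith)]; linarith
  · rw [div_lt_iff₀ (by linarith)]
    have := mul_lt_mul_of_pos_left ht1 (show (0 : ℝ) < l + 2 by linarith)
    linarith
  have hcont : Continuous fun ε : ℝ =>
      ((l + 1 : ℕ) + 1 : ℝ) * (1 + 3 * ε) ^ (l + 1) * (1 + (l + 1 : ℕ) * (3 * ε)) := by fun_prop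
  have hlim := hcont.tendsto 0
  have hlt : ((l + 1 : ℕ) + 1 : ℝ) * (1 + 3 * 0) ^ (l + 1) * (1 + (l + 1 : ℕ) * (3 * 0))
      < ((l : ℝ) + 2) / t * θ := by
    simp only [mul_zero, add_zero, one_pow, mul_one]
    rw [div_mul_eq_mul_div, lt_div_iff₀ (by linarith)]
    have := mul_lt_mul_of_pos_left htθ (show (0 : ℝ) < l + 2 by linarith)
    push_cast; linarith
  have hev := (hlim.eventually (gt_mem_nhds hlt)).filter_mono
    (nhdsWithin_le_nhds (s := Set.Ioi (0 : ℝ)))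
  have hev2 : ∀ᶠ ε : ℝ in nhdsWithin 0 (Set.Ioi 0), ε ∈ Set.Ioc (0 : ℝ) 1 :=
    Ioc_mem_nhdsGT one_pos
  obtain ⟨ε, h1, h2⟩ := (hev.and hev2).exists
  exact ⟨ε, h2.1, h2.2, h1.le⟩

lemma pert (l : ℕ) {θ : ℝ} (hθ : 1 < θ) (hθ2 : θ < 2) :
    ∃ s η C e : ℝ, 1 ≤ s ∧ s < (l : ℝ) + 2 ∧ 0 < η ∧ η ≤ 1 ∧ 1 ≤ C ∧ 0 < e ∧ e ≤ 1 ∧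
    ∀ (N : ℕ) (μ : ℝ[X]) (a : ℂ[X]), Law μ → a.eval 1 = 1 →
      (∀ i ≤ N, 1 / 4 < lowN ((pstep (l + 2))^[i] μ) 4) →
      (∀ i ≤ N, θ ^ i * C ^ (cnt η (fun j => (pstep (l + 2))^[j] μ) i)
        * wp s N (a - μ.map Complex.ofRealHom) ≤ e) →
      ∀ i ≤ N, wp s (N - i) ((pstep (l + 2))^[i] a
          - ((pstep (l + 2))^[i] μ).map Complex.ofRealHom)
        ≤ θ ^ i * C ^ (cnt η (fun j => (pstep (l + 2))^[j] μ) i)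
          * wp s N (a - μ.map Complex.ofRealHom) := by
  obtain ⟨s, hs, hsM, ε, hε, hε1, hpar⟩ := pert_param l hθ hθ2
  obtain ⟨C₁, hC1, hwC⟩ := law_wn_unif hs hsM
  obtain ⟨η, hη, hη1, hηε, hwη⟩ := law_wn_small hs hsM hε
  obtain ⟨C, hC⟩ : ∃ C : ℝ, C = ((l + 1 : ℕ) + 1) * (C₁ + 2) ^ (l + 1)
    * (1 + (l + 1 : ℕ) * (C₁ + 2)) := ⟨_, rfl⟩
  have hC1' : 1 ≤ C := by
    rw [hC]
    have h1 : (1 : ℝ) ≤ ((l + 1 : ℕ) + 1) := by linarith [Nat.cast_nonneg (α := ℝ) (l + 1)]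
    have h2 : 1 ≤ (C₁ + 2) ^ (l + 1) := one_le_pow₀ (by linarith)
    have h3 : (1 : ℝ) ≤ 1 + (l + 1 : ℕ) * (C₁ + 2) := by
      have := mul_nonneg (Nat.cast_nonneg (α := ℝ) (l + 1)) (show 0 ≤ C₁ + 2 by linarith)
      linarith
    exact one_le_mul_of_one_le_of_one_le (one_le_mul_of_one_le_of_one_le h1 h2) h3
  refine ⟨s, η, C, ε, hs, hsM, hη, hη1, hC1', hε, hε1, fun N μ a hμ ha hgood hsmall => ?_⟩
  obtain ⟨g, hg⟩ : ∃ g : ℕ → ℝ[X], g = fun j => (pstep (l + 2))^[j] μ := ⟨_, rfl⟩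
  obtain ⟨A, hA⟩ : ∃ A : ℕ → ℂ[X], A = fun j => (pstep (l + 2))^[j] a := ⟨_, rfl⟩
  obtain ⟨w, hw⟩ : ∃ w, w = wp s N (a - μ.map Complex.ofRealHom) := ⟨_, rfl⟩
  have hgi : ∀ i, (pstep (l + 2))^[i] μ = g i := fun i => by rw [hg]
  have hAi : ∀ i, (pstep (l + 2))^[i] a = A i := fun i => by rw [hA]
  have hgl : ∀ i, Law (g i) := fun i => by rw [← hgi]; exact hμ.iter i
  rw [← hg, ← hw] at hsmall
  rw [← hg, ← hw]
  simp only [hgi] at hgood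
  simp only [hgi, hAi]
  have hA1 : ∀ i, (A i).eval 1 = 1 := fun i => by rw [← hAi]; exact iter_eval_one _ _ ha i
  have hgs : ∀ i, g (i + 1) = pstep (l + 2) (g i) := fun i => by
    rw [← hgi, ← hgi, Function.iterate_succ_apply']
  have hAs : ∀ i, A (i + 1) = pstep (l + 2) (A i) := fun i => by
    rw [← hAi, ← hAi, Function.iterate_succ_apply']
  have htail : ∀ i k, i + k ≤ N → tl (g i) (4 + k) * ((l : ℝ) + 2) ^ k ≤ 3 := by
    intro i k hik
    have := tl_bound (m := l + 2) (hgl i) k (by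
      have h1 := hgood (i + k) hik
      rw [← hgi, add_comm i k, Function.iterate_add_apply, hgi] at h1; exact h1)
    push_cast at this
    exact this
  intro i
  induction i with
  | zero =>
    intro _
    have e1 : A 0 = a := by rw [hA]; rfl
    have e2 : g 0 = μ := by rw [hg]; rfl
    rw [e1, e2, Nat.sub_zero, ← hw]
    have : 1 ≤ θ ^ 0 * C ^ cnt η g 0 := by
      rw [pow_zero, one_mul]; exact one_le_pow₀ hC1'
    exact le_mul_of_one_le_left (hw ▸ wp_nonneg hs _ _) this
  | succ i ih =>
    intro hi
    have ih := ih (by omega)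
    have hsm := hsmall i (by omega)
    obtain ⟨T, hT⟩ : ∃ T, N - i = T + 1 := ⟨N - i - 1, by omega⟩
    have hT' : N - (i + 1) = T := by omega
    rw [hT] at ih
    rw [hT']
    obtain ⟨b, hb⟩ : ∃ b, b = (g i).map Complex.ofRealHom := ⟨_, rfl⟩
    rw [hgs, hAs, pstep_map, ← hb]
    rw [← hb] at ih
    obtain ⟨d, hd⟩ : ∃ d, d = wp s (T + 1) (A i - b) := ⟨_, rfl⟩
    have hd0 : 0 ≤ d := hd ▸ wp_nonneg hs _ _
    have hdε : d ≤ ε := hd ▸ ih.trans hsm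
    have hb1 : b.eval 1 = 1 := by rw [hb]; exact map_eval_one (hgl i)
    have hwnb : wn s (T + 1) b = wn s (T + 1) (g i) := by rw [hb, wn_map]
    have hAb : A i = b + (A i - b) := by ring
    have hpA : wp s (T + 1) (A i) ≤ wp s (T + 1) b + d := by
      rw [hd]; conv_lhs => rw [hAb]
      exact wp_add_le hs _ _ _
    have hnA : wn s (T + 1) (A i) ≤ wn s (T + 1) b + 2 * d := by
      conv_lhs => rw [hAb]
      refine (wn_add_le hs _ _ _).trans ?_
      have h0 : ‖(A i - b).coeff 0‖ ≤ d := by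
        rw [hd]; exact coeff_zero_le_wp hs _ _ (by rw [eval_sub, hA1, hb1, sub_self])
      rw [wn_eq s (T + 1) (A i - b), ← hd]
      linarith
    have hpb : wp s (T + 1) b = wn s (T + 1) b - (1 - us (g i)) := by
      rw [wn_eq, hb, coeff_map, us]
      have : ‖Complex.ofRealHom ((g i).coeff 0)‖ = (g i).coeff 0 := by
        rw [Complex.ofRealHom_eq_coe, Complex.norm_real, Real.norm_of_nonneg ((hgl i).1 0)]
      rw [this]; ring
    have hu1 : us (g i) ≤ 1 := by unfold us; linarith [(hgl i).1 0]
    have htl := fun k (hk : k ≤ T + 1) => htail i k (by omega)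
    have hstep := fun (Γ v : ℝ) hv h1 h2 h3 h4 h5 =>
      wp_step hs T (l + 1) (a := A i) (b := b) (Γ := Γ) (v := v) hv h1 h2 h3 h4 h5
        (by rw [hA1, hb1])
    rw [← hd] at hstep ih
    have hwl := wp_nonneg hs T (pstep (l + 1 + 1) (A i) - pstep (l + 1 + 1) b)
    rw [cnt_succ, pow_succ θ i, pow_add]
    by_cases hui : η ≤ us (g i)
    · rw [if_pos hui, pow_one]
      have hwb := hwC (g i) (T + 1) (hgl i) htl
      rw [← hwnb] at hwb
      have h := hstep (C₁ + 2) (C₁ + 2) (by linarith) (by linarith) (by linarith) (by linarith)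
        (by linarith) (by linarith)
      rw [← hC] at h
      have h2 : wp s T (pstep (l + 1 + 1) (A i) - pstep (l + 1 + 1) b)
          ≤ s * wp s T (pstep (l + 1 + 1) (A i) - pstep (l + 1 + 1) b) :=
        le_mul_of_one_le_left hwl hs
      have h3 : C * d ≤ θ * (C * d) :=
        le_mul_of_one_le_left (mul_nonneg (by linarith) hd0) hθ.le
      have h4 := mul_le_mul_of_nonneg_left ih (show 0 ≤ θ * C by
        exact mul_nonneg (by linarith) (by linarith))
      calc wp s T (pstep (l + 1 + 1) (A i) - pstep (l + 1 + 1) b) ≤ C * d := h2.trans h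
        _ ≤ θ * C * d := by linarith
        _ ≤ _ := h4
        _ = _ := by ring
    · rw [if_neg hui, pow_zero, mul_one]
      push Not at hui
      have hwb := hwη (g i) (T + 1) (hgl i) htl hui
      rw [← hwnb] at hwb
      have h := hstep (1 + 3 * ε) (3 * ε) (by linarith) (by linarith) (by linarith) (by linarith)
        (by linarith) (by linarith)
      have h2 := h.trans (mul_le_mul_of_nonneg_right hpar hd0)
      have h3 : wp s T (pstep (l + 1 + 1) (A i) - pstep (l + 1 + 1) b) ≤ θ * d := by
        rw [mul_assoc] at h2
        exact le_of_mul_le_mul_left h2 (by linarith)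
      have h4 := mul_le_mul_of_nonneg_left ih (show 0 ≤ θ by linarith)
      calc wp s T (pstep (l + 1 + 1) (A i) - pstep (l + 1 + 1) b) ≤ θ * d := h3
        _ ≤ _ := h4
        _ = _ := by ring

/-- growth of the total variation distance -/
lemma tv_iter (l : ℕ) {f : ℝ[X]} (hf : Law f) {a : ℂ[X]} {D : ℝ}
    (hD : D = ((l + 1 : ℕ) + 1) * 2 ^ (l + 1)) (j : ℕ)
    (h : D ^ j * wn 1 0 (a - f.map Complex.ofRealHom) ≤ 1) :
    wn 1 0 ((pstep (l + 2))^[j] a - ((pstep (l + 2))^[j] f).map Complex.ofRealHom)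
      ≤ D ^ j * wn 1 0 (a - f.map Complex.ofRealHom) := by
  have hD1 : 1 ≤ D := by
    rw [hD]
    exact one_le_mul_of_one_le_of_one_le (by linarith [Nat.cast_nonneg (α := ℝ) (l + 1)])
      (one_le_pow₀ (by norm_num))
  induction j with
  | zero => simp
  | succ j ih =>
    have hw := wn_nonneg le_rfl 0 (a - f.map Complex.ofRealHom)
    have h0 : D ^ j * wn 1 0 (a - f.map Complex.ofRealHom) ≤ 1 :=
      (mul_le_mul_of_nonneg_right (pow_le_pow_right₀ hD1 (by omega)) hw).trans h
    have ih := ih h0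
    rw [Function.iterate_succ_apply', Function.iterate_succ_apply', pstep_map]
    obtain ⟨A, hA⟩ : ∃ A, A = (pstep (l + 2))^[j] a := ⟨_, rfl⟩
    obtain ⟨b, hb⟩ : ∃ b, b = ((pstep (l + 2))^[j] f).map Complex.ofRealHom := ⟨_, rfl⟩
    rw [← hA, ← hb] at ih ⊢
    have hb1 : wn 1 0 b = 1 := by rw [hb, wn_map, law_wn_zero (hf.iter j)]
    have hA2 : wn 1 0 A ≤ 2 := by
      have e : A = b + (A - b) := by ring
      rw [e]
      refine (wn_add_le le_rfl _ _ _).trans ?_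
      linarith
    have := wn_step le_rfl (l + 1) hA2 (by linarith : wn 1 0 b ≤ 2)
    rw [← hD] at this
    refine this.trans ?_
    rw [pow_succ, mul_comm (D ^ j) D, mul_assoc]
    exact mul_le_mul_of_nonneg_left ih (by linarith)

lemma coeff_zero_le_of_tv {f : ℝ[X]} (hf : Law f) {a : ℂ[X]} {x : ℝ}
    (h : wn 1 0 (a - f.map Complex.ofRealHom) ≤ x) : ‖a.coeff 0‖ ≤ 1 + x := by
  have e : a = f.map Complex.ofRealHom + (a - f.map Complex.ofRealHom) := by ring
  have h1 := coeff_zero_le_wn le_rfl 0 a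
  have h2 := wn_add_le le_rfl 0 (f.map Complex.ofRealHom) (a - f.map Complex.ofRealHom)
  rw [← e, wn_map, law_wn_zero hf] at h2
  linarith

lemma after_exit (l : ℕ) {f : ℝ[X]} (hf : Law f) {a : ℂ[X]} {D : ℝ}
    (hD : D = ((l + 1 : ℕ) + 1) * 2 ^ (l + 1)) (hlow : lowN f 4 ≤ 1 / 4) (L n : ℕ)
    (hL : n ≤ 2 ^ L) (h : D ^ (2 * L) * wn 1 0 (a - f.map Complex.ofRealHom) ≤ 1 / 4) :
    ‖((pstep (l + 2))^[n] a).coeff 0‖ ≤ 2 := by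
  have hD1 : 1 ≤ D := by
    rw [hD]
    exact one_le_mul_of_one_le_of_one_le (by linarith [Nat.cast_nonneg (α := ℝ) (l + 1)])
      (one_le_pow₀ (by norm_num))
  have hw := wn_nonneg le_rfl 0 (a - f.map Complex.ofRealHom)
  have htv : ∀ j ≤ 2 * L, wn 1 0 ((pstep (l + 2))^[j] a
      - ((pstep (l + 2))^[j] f).map Complex.ofRealHom) ≤ 1 / 4 := by
    intro j hj
    have h0 : D ^ j * wn 1 0 (a - f.map Complex.ofRealHom) ≤ 1 / 4 :=
      (mul_le_mul_of_nonneg_right (pow_le_pow_right₀ hD1 hj) hw).trans h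
    exact (tv_iter l hf hD j (by linarith)).trans h0
  rcases Nat.lt_or_ge (2 * L) n with hn | hn
  · obtain ⟨r, rfl⟩ := Nat.exists_eq_add_of_le hn.le
    rw [add_comm (2 * L) r, Function.iterate_add_apply]
    have h1 := low_grow (m := l + 2) (by omega) hf hlow L
    have h2 := htv (2 * L) le_rfl
    obtain ⟨A, hA⟩ : ∃ A, A = (pstep (l + 2))^[2 * L] a := ⟨_, rfl⟩
    obtain ⟨b, hb⟩ : ∃ b, b = (pstep (l + 2))^[2 * L] f := ⟨_, rfl⟩
    rw [← hA, ← hb] at h2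
    rw [← hA]
    rw [← hb] at h1
    have h3 : lowN A (2 ^ L + 3) ≤ 1 := by
      have e : A = b.map Complex.ofRealHom + (A - b.map Complex.ofRealHom) := by ring
      rw [e]
      refine (lowN_add_le _ _ _).trans ?_
      have := lowN_le_wn le_rfl 0 (A - b.map Complex.ofRealHom) (2 ^ L + 3)
      rw [lowN_map]
      linarith
    have h4 := lowN_iter (l + 2) A r 0
    have h5 : lowN A (0 + 1 + r) ≤ 1 := (lowN_mono A (by omega)).trans h3
    have h6 := h4.trans (pow_le_one₀ (lowN_nonneg _ _) h5)
    simp only [lowN, zero_add, Finset.sum_range_one] at h6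
    linarith
  · have := coeff_zero_le_of_tv (hf.iter n) (htv n hn)
    linarith


/-- the mixture `(1-z)δ₀ + zν` over any ring -/
def mixP {R : Type*} [CommRing R] (ν : R[X]) (z : R) : R[X] := C (1 - z) + C z * ν

lemma mixP_law {ν : ℝ[X]} (hν : Law ν) {p : ℝ} (h0 : 0 ≤ p) (h1 : p ≤ 1) : Law (mixP ν p) := by
  constructor
  · intro k
    rw [mixP, coeff_add, coeff_C_mul, coeff_C]
    have := mul_nonneg h0 (hν.1 k)
    split_ifs <;> linarith
  · simp [mixP, hν.2]

lemma mixP_cond {ν : ℝ[X]} (hν : Law ν) (hν0 : ν.coeff 0 = 0) {ρ0 ρ p : ℝ} (h0 : 0 ≤ p)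
    (h1 : p ≤ 1) (hρ : ρ ≤ 1 / 16) (hρ' : ρ ≤ ρ0 / 2) (hρ0 : 0 < ρ0) (ht : ρ0 ≤ tl ν 2) :
    Cond ρ (mixP ν p) := by
  have hc0 : (mixP ν p).coeff 0 = 1 - p := by
    rw [mixP, coeff_add, coeff_C_mul, coeff_C, hν0]; simp
  have hc1 : (mixP ν p).coeff 1 = p * ν.coeff 1 := by
    rw [mixP, coeff_add, coeff_C_mul, coeff_C]; simp
  rcases le_total p (1 / 2) with h | h
  · left; rw [hc0]; linarith
  · right
    rw [tl, lowN_eq hν.1, Finset.sum_range_succ, Finset.sum_range_one, hν0] at ht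
    rw [tl, lowN_eq (mixP_law hν h0 h1).1, Finset.sum_range_succ, Finset.sum_range_one, hc0, hc1]
    have h2 := mul_le_mul_of_nonneg_left ht h0
    have h3 := mul_le_mul_of_nonneg_right h hρ0.le
    linarith

lemma mixP_map {R S : Type*} [CommRing R] [CommRing S] (φ : R →+* S) (ν : R[X]) (z : R) :
    (mixP ν z).map φ = mixP (ν.map φ) (φ z) := by
  simp [mixP]

lemma mixP_sub (ν : ℝ[X]) (p : ℝ) (z : ℂ) :
    mixP (ν.map Complex.ofRealHom) z - (mixP ν p).map Complex.ofRealHom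
      = C (z - p) * (ν.map Complex.ofRealHom - 1) := by
  rw [mixP_map, mixP, mixP, Complex.ofRealHom_eq_coe]
  simp only [C_sub, C_1]; ring

lemma wp_sub_one {R : Type*} [NormedCommRing R] (s : ℝ) (T : ℕ) (f : R[X]) :
    wp s T (f - 1) = wp s T f := by
  simp [wp, coeff_one]

lemma wn_C_mul_le {R : Type*} [NormedCommRing R] {s : ℝ} (hs : 1 ≤ s) (T : ℕ) (c : R) (g : R[X]) :
    wn s T (C c * g) ≤ ‖c‖ * wn s T g := by
  rw [wn_eq, wn_eq s T g, mul_add, coeff_C_mul]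
  exact add_le_add (norm_mul_le _ _) (wp_C_mul_le hs T c g)

lemma wn_zero_irrel {R : Type*} [NormedCommRing R] (s t : ℝ) (f : R[X]) : wn s 0 f = wn t 0 f := by
  simp [wn]

lemma log_steps {D t : ℝ} (hD : 1 ≤ D) (ht : 1 < t) :
    ∃ K : ℝ, 1 ≤ K ∧ ∀ n : ℕ, D ^ (2 * (Nat.log 2 n + 1)) ≤ K * t ^ n := by
  obtain ⟨e, he⟩ := pow_unbounded_of_one_lt D (show (1 : ℝ) < 2 by norm_num)
  have hlim := tendsto_pow_const_div_const_pow_of_one_lt (2 * e) ht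
  obtain ⟨B, hB⟩ := hlim.bddAbove_range
  have hB' : ∀ n : ℕ, (n : ℝ) ^ (2 * e) ≤ B * t ^ n := by
    intro n
    have := hB ⟨n, rfl⟩
    rw [div_le_iff₀ (pow_pos (by linarith) n)] at this
    exact this
  refine ⟨max 1 (2 ^ (2 * e) * max 1 B), le_max_left _ _, fun n => ?_⟩
  have htn : 1 ≤ t ^ n := one_le_pow₀ ht.le
  refine le_trans ?_ (mul_le_mul_of_nonneg_right (le_max_right _ _) (by linarith))
  have h1 : D ^ (2 * (Nat.log 2 n + 1)) ≤ (2 ^ e) ^ (2 * (Nat.log 2 n + 1)) :=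
    pow_le_pow_left₀ (by linarith) he.le _
  refine h1.trans ?_
  have e1 : ((2 : ℝ) ^ e) ^ (2 * (Nat.log 2 n + 1)) = 2 ^ (2 * e) * ((2 : ℝ) ^ Nat.log 2 n) ^ (2 * e) := by
    rw [← pow_mul, ← pow_mul, ← pow_add]; congr 1; ring
  rw [e1, mul_assoc]
  refine mul_le_mul_of_nonneg_left ?_ (pow_nonneg (by norm_num) _)
  rcases Nat.eq_zero_or_pos n with rfl | hn
  · simp
  · have h2 : ((2 : ℝ) ^ Nat.log 2 n) ≤ n := by exact_mod_cast Nat.pow_log_le_self 2 hn.ne'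
    have h3 : ((2 : ℝ) ^ Nat.log 2 n) ^ (2 * e) ≤ (n : ℝ) ^ (2 * e) :=
      pow_le_pow_left₀ (pow_nonneg (by norm_num) _) h2 _
    exact h3.trans ((hB' n).trans (mul_le_mul_of_nonneg_right (le_max_right _ _) (by linarith)))

lemma cnt_pow {C t : ℝ} (hC : 1 ≤ C) (ht : 1 < t) : ∃ δ : ℝ, 0 < δ ∧ ∀ (K i j : ℕ),
    (j : ℝ) ≤ δ * i + K → C ^ j ≤ t ^ i * C ^ K := by
  have hlt : 0 < Real.log t := Real.log_pos ht
  have hlC : 0 ≤ Real.log C := Real.log_nonneg hC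
  have hC0 : 0 < C := by linarith
  refine ⟨Real.log t / (Real.log C + 1), div_pos hlt (by linarith), fun K i j h => ?_⟩
  have h1 : Real.log t / (Real.log C + 1) * Real.log C ≤ Real.log t := by
    rw [div_mul_eq_mul_div, div_le_iff₀ (by linarith)]
    exact mul_le_mul_of_nonneg_left (by linarith) hlt.le
  rw [← Real.log_le_log_iff (pow_pos hC0 _) (mul_pos (pow_pos (by linarith) _) (pow_pos hC0 _)),
    Real.log_mul (pow_pos (by linarith) _).ne' (pow_pos hC0 _).ne', Real.log_pow, Real.log_pow,
    Real.log_pow]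
  have h2 := mul_le_mul_of_nonneg_right h hlC
  have h3 := mul_le_mul_of_nonneg_right h1 (Nat.cast_nonneg (α := ℝ) i)
  linarith

lemma root_four {θ : ℝ} (hθ : 1 < θ) : ∃ t : ℝ, 1 < t ∧ t < 2 ∧ t ^ 4 ≤ θ := by
  have hcont : Continuous fun t : ℝ => t ^ 4 := by fun_prop
  have hlim := hcont.tendsto 1
  have hev := (hlim.eventually (gt_mem_nhds (show (1 : ℝ) ^ 4 < θ by simpa using hθ))).filter_mono
    (nhdsWithin_le_nhds (s := Set.Ioi (1 : ℝ)))
  have hev2 : ∀ᶠ ε : ℝ in nhdsWithin 1 (Set.Ioi 1), ε ∈ Set.Ioo (1 : ℝ) 2 :=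
    Ioo_mem_nhdsGT (by norm_num)
  obtain ⟨ε, h1, h2⟩ := (hev.and hev2).exists
  exact ⟨ε, h2.1, h2.2, h1.le⟩

theorem main_est (l : ℕ) {ρ0 : ℝ} (hρ0 : 0 < ρ0) (Mf : ℝ → ℝ) {θ : ℝ} (hθ : 1 < θ) :
    ∃ c : ℝ, 0 < c ∧ ∀ (n : ℕ) (ν : ℝ[X]), Law ν → ν.coeff 0 = 0 → ρ0 ≤ tl ν 2 →
      (∀ s : ℝ, 1 ≤ s → s < (l : ℝ) + 2 → ∀ T, wn s T ν ≤ Mf s) →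
      ∀ p : ℝ, 0 ≤ p → p ≤ 1 → ∀ z : ℂ, ‖z - p‖ * θ ^ n ≤ c →
      ‖((pstep (l + 2))^[n] (mixP (ν.map Complex.ofRealHom) z)).coeff 0‖ ≤ 2 := by
  obtain ⟨t, ht1, ht2, htθ⟩ := root_four hθ
  have ht0 : 0 < t := by linarith
  obtain ⟨s, η, C, e, hs, hsM, hη, hη1, hC1, he, he1, hpert⟩ := pert l ht1 ht2
  obtain ⟨δ, hδ, hcp⟩ := cnt_pow hC1 ht1
  obtain ⟨ρ, hρ⟩ : ∃ ρ, ρ = min (1 / 16) (ρ0 / 2) := ⟨_, rfl⟩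
  have hρpos : 0 < ρ := by rw [hρ]; exact lt_min (by norm_num) (by linarith)
  have hρ1 : ρ ≤ 1 / 16 := hρ ▸ min_le_left _ _
  have hρ2 : ρ ≤ ρ0 / 2 := hρ ▸ min_le_right _ _
  obtain ⟨K, hK⟩ := orbit_count l hη hη1 hρpos hρ1 hδ
  obtain ⟨D, hD⟩ : ∃ D : ℝ, D = ((l + 1 : ℕ) + 1) * 2 ^ (l + 1) := ⟨_, rfl⟩
  have hD1 : 1 ≤ D := by
    rw [hD]
    exact one_le_mul_of_one_le_of_one_le (by linarith [Nat.cast_nonneg (α := ℝ) (l + 1)])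
      (one_le_pow₀ (by norm_num))
  obtain ⟨K2, hK2, hlog⟩ := log_steps hD1 ht1
  obtain ⟨Q, hQ⟩ : ∃ Q : ℝ, Q = C ^ K * max 1 (Mf s) := ⟨_, rfl⟩
  have hCK : 1 ≤ C ^ K := one_le_pow₀ hC1
  have hQ1 : 1 ≤ Q := by rw [hQ]; exact one_le_mul_of_one_le_of_one_le hCK (le_max_left _ _)
  obtain ⟨Z, hZ⟩ : ∃ Z : ℝ, Z = K2 * D * Q := ⟨_, rfl⟩
  have hKD1 : 1 ≤ K2 * D := one_le_mul_of_one_le_of_one_le hK2 hD1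
  have hZ1 : 1 ≤ Z := by rw [hZ]; exact one_le_mul_of_one_le_of_one_le hKD1 hQ1
  refine ⟨e / (8 * Z), div_pos he (by linarith), fun n ν hν hν0 hνt hνM p hp0 hp1 z hz => ?_⟩
  rw [le_div_iff₀ (by linarith)] at hz
  obtain ⟨x, hx⟩ : ∃ x, x = ‖z - p‖ := ⟨_, rfl⟩
  have hx0 : 0 ≤ x := hx ▸ norm_nonneg _
  rw [← hx] at hz
  obtain ⟨τ, hτ⟩ : ∃ τ, τ = t ^ n := ⟨_, rfl⟩
  have hτ1 : 1 ≤ τ := hτ ▸ one_le_pow₀ ht1.le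
  have hτ4 : τ ^ 4 ≤ θ ^ n := by
    rw [hτ, ← pow_mul, mul_comm, pow_mul]; exact pow_le_pow_left₀ (pow_nonneg ht0.le _) htθ _
  -- the basic smallness
  have hbase : x * τ ^ 4 * (8 * Z) ≤ e :=
    (mul_le_mul_of_nonneg_right (mul_le_mul_of_nonneg_left hτ4 hx0) (by linarith)).trans hz
  have hτ3 : x * τ ^ 3 * (8 * Z) ≤ e :=
    (mul_le_mul_of_nonneg_right (mul_le_mul_of_nonneg_left
      (pow_le_pow_right₀ hτ1 (by norm_num)) hx0) (by linarith)).trans hbase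
  have hτ2 : x * τ ^ 2 * (8 * Z) ≤ e :=
    (mul_le_mul_of_nonneg_right (mul_le_mul_of_nonneg_left
      (pow_le_pow_right₀ hτ1 (by norm_num)) hx0) (by linarith)).trans hbase
  have hQZ : Q ≤ Z := by rw [hZ]; exact le_mul_of_one_le_left (by linarith) hKD1
  have hxτ : 0 ≤ x * τ ^ 2 := mul_nonneg hx0 (pow_nonneg (by linarith) _)
  have hq : x * τ ^ 2 * (8 * Q) ≤ e :=
    (mul_le_mul_of_nonneg_left (by linarith) hxτ).trans hτ2
  obtain ⟨μ, hμ⟩ : ∃ μ, μ = mixP ν p := ⟨_, rfl⟩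
  obtain ⟨a, ha⟩ : ∃ a, a = mixP (ν.map Complex.ofRealHom) z := ⟨_, rfl⟩
  have hμl : Law μ := hμ ▸ mixP_law hν hp0 hp1
  have ha1 : a.eval 1 = 1 := by
    rw [ha, mixP]; simp only [eval_add, eval_C, eval_mul, map_eval_one hν]; ring
  have hcond : Cond ρ μ := hμ ▸ mixP_cond hν hν0 hp0 hp1 hρ1 hρ2 hρ0 hνt
  have hsub : a - μ.map Complex.ofRealHom = Polynomial.C (z - p) * (ν.map Complex.ofRealHom - 1) := by
    rw [ha, hμ]; exact mixP_sub ν p z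
  have hwp0 : ∀ T, wp s T (a - μ.map Complex.ofRealHom) ≤ x * max 1 (Mf s) := by
    intro T
    rw [hsub]
    refine (wp_C_mul_le hs T _ _).trans ?_
    rw [← hx, wp_sub_one, wp_map]
    exact mul_le_mul_of_nonneg_left
      ((wp_le_wn _ _ _).trans ((hνM s hs hsM T).trans (le_max_right _ _))) hx0
  rw [← ha]
  have hTV : ∀ N ≤ n, (∀ i ≤ N, 1 / 4 < lowN ((pstep (l + 2))^[i] μ) 4) →
      wn 1 0 ((pstep (l + 2))^[N] a - ((pstep (l + 2))^[N] μ).map Complex.ofRealHom)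
        ≤ 2 * (x * τ ^ 2 * Q) := by
    intro N hN hgood
    have hcount := hK μ hμl (fun _ => hcond) N hgood
    have hb : ∀ i ≤ N, t ^ i * C ^ (cnt η (fun j => (pstep (l + 2))^[j] μ) i)
        * wp s N (a - μ.map Complex.ofRealHom) ≤ x * τ ^ 2 * Q := by
      intro i hi
      have h1 := hcp K i _ (hcount i (by omega))
      have h2 : t ^ i ≤ τ := by rw [hτ]; exact pow_le_pow_right₀ ht1.le (by omega)
      have hti : 0 ≤ t ^ i := pow_nonneg ht0.le _
      have h3 : t ^ i * C ^ (cnt η (fun j => (pstep (l + 2))^[j] μ) i) ≤ τ * (τ * C ^ K) := by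
        refine mul_le_mul h2 (h1.trans ?_) (pow_nonneg (by linarith) _) (by linarith)
        exact mul_le_mul_of_nonneg_right h2 (by linarith)
      have h4 := mul_le_mul h3 (hwp0 N) (wp_nonneg hs _ _)
        (mul_nonneg (by linarith) (mul_nonneg (by linarith) (by linarith)))
      refine h4.trans (le_of_eq ?_)
      rw [hQ]; ring
    have h5 := hpert N μ a hμl ha1 hgood (fun i hi => (hb i hi).trans (by linarith)) N le_rfl
    rw [Nat.sub_self] at h5
    have h6 := h5.trans (hb N le_rfl)
    rw [wn_zero_irrel 1 s, wn_eq]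
    have h7 := coeff_zero_le_wp hs 0 ((pstep (l + 2))^[N] a
      - ((pstep (l + 2))^[N] μ).map Complex.ofRealHom) (by
        rw [eval_sub, iter_eval_one _ _ ha1, map_eval_one (hμl.iter N), sub_self])
    linarith
  classical
  by_cases hex : ∃ i, i ≤ n ∧ lowN ((pstep (l + 2))^[i] μ) 4 ≤ 1 / 4
  · obtain ⟨hi0n, hi0⟩ := Nat.find_spec hex
    have hmin : ∀ j < Nat.find hex, 1 / 4 < lowN ((pstep (l + 2))^[j] μ) 4 := by
      intro j hj
      have := Nat.find_min hex hj
      by_contra hcon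
      exact this ⟨by omega, not_lt.1 hcon⟩
    obtain ⟨i0, hi0e⟩ : ∃ i0, i0 = Nat.find hex := ⟨_, rfl⟩
    rw [← hi0e] at hi0n hi0 hmin
    have hDL := hlog n
    rw [← hτ] at hDL
    have hL : n ≤ 2 ^ (Nat.log 2 n + 1) := (Nat.lt_pow_succ_log_self (by norm_num) n).le
    -- total variation at time `i0`
    have htv : wn 1 0 ((pstep (l + 2))^[i0] a - ((pstep (l + 2))^[i0] μ).map Complex.ofRealHom)
        ≤ D * (2 * (x * τ ^ 2 * Q)) := by
      have hxQ : 0 ≤ x * τ ^ 2 * Q := mul_nonneg hxτ (by linarith)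
      rcases Nat.eq_zero_or_pos i0 with h0 | h0
      · rw [h0]
        have h1 : wn 1 0 (a - μ.map Complex.ofRealHom) ≤ x * 2 := by
          rw [hsub]
          refine (wn_C_mul_le le_rfl _ _ _).trans ?_
          rw [← hx]
          refine mul_le_mul_of_nonneg_left ?_ hx0
          rw [wn_eq, wp_sub_one, coeff_sub, coeff_map, hν0, wp_map]
          have := wp_le_wn 1 0 ν
          rw [law_wn_zero hν] at this
          simp only [map_zero, coeff_one_zero, zero_sub, norm_neg, norm_one]
          linarith
        have h2 : x ≤ x * τ ^ 2 := le_mul_of_one_le_right hx0 (one_le_pow₀ hτ1)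
        have h3 : x * τ ^ 2 ≤ x * τ ^ 2 * Q := le_mul_of_one_le_right hxτ hQ1
        have h4 : 2 * (x * τ ^ 2 * Q) ≤ D * (2 * (x * τ ^ 2 * Q)) :=
          le_mul_of_one_le_left (by linarith) hD1
        simp only [Function.iterate_zero, id]
        linarith
      · obtain ⟨N, rfl⟩ : ∃ N, i0 = N + 1 := ⟨i0 - 1, by omega⟩
        have h1 := hTV N (by omega) (fun i hi => hmin i (by omega))
        have h2 := mul_le_mul_of_nonneg_left h1 (show 0 ≤ D by linarith)
        have hDZ : D * Q ≤ Z := by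
          rw [hZ, mul_assoc]
          exact le_mul_of_one_le_left (mul_nonneg (by linarith) (by linarith)) hK2
        have h3 : x * τ ^ 2 * (8 * (D * Q)) ≤ e :=
          (mul_le_mul_of_nonneg_left (by linarith) hxτ).trans hτ2
        have h4 := tv_iter l (hμl.iter N) (a := (pstep (l + 2))^[N] a) hD 1
          (by rw [pow_one]; linarith)
        rw [pow_one] at h4
        rw [Function.iterate_succ_apply', Function.iterate_succ_apply']
        exact h4.trans h2
    have hfin := after_exit l (hμl.iter i0) (a := (pstep (l + 2))^[i0] a) hD hi0
      (Nat.log 2 n + 1) (n - i0) (by omega) (by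
        have h1 := mul_le_mul hDL htv (wn_nonneg le_rfl _ _)
          (mul_nonneg (by linarith) (by linarith))
        have e2 : K2 * τ * (D * (2 * (x * τ ^ 2 * Q))) = x * τ ^ 3 * (2 * Z) := by
          rw [hZ]; ring
        rw [e2] at h1
        linarith)
    rw [← Function.iterate_add_apply, Nat.sub_add_cancel hi0n] at hfin
    exact hfin
  · push Not at hex
    have h1 := hTV n le_rfl hex
    have := coeff_zero_le_of_tv (hμl.iter n) h1
    linarith


lemma ps_coeff_pow (m : ℕ) (μ : ℕ → ℝ) (n : ℕ) :
    PowerSeries.coeff n (PowerSeries.mk μ ^ m)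
      = ∑ x ∈ Finset.piAntidiag (Finset.univ : Finset (Fin m)) n, ∏ i, μ (x i) := by
  have h : PowerSeries.mk μ ^ m = ∏ _i : Fin m, PowerSeries.mk μ := by simp
  rw [h, PowerSeries.coeff_prod]
  refine Finset.sum_nbij' (fun l => ⇑l) (fun x => Finsupp.equivFunOnFinite.symm x) ?_ ?_ ?_ ?_ ?_
  · intro l hl
    rw [Finset.mem_finsuppAntidiag] at hl
    simp [hl.1]
  · intro x hx
    rw [Finset.mem_piAntidiag] at hx
    rw [Finset.mem_finsuppAntidiag]
    simp [hx.1]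
  · intro l _; ext; simp
  · intro x _; ext; simp
  · intro l _; simp

lemma drStep_eq (m : ℕ) (μ : ℕ → ℝ) (j : ℕ) :
    drStep m μ j = PowerSeries.coeff (j + 1) (PowerSeries.mk μ ^ m)
      + if j = 0 then PowerSeries.coeff 0 (PowerSeries.mk μ ^ m) else 0 := by
  classical
  unfold drStep
  rw [tsum_eq_sum (s := Finset.piAntidiag (Finset.univ : Finset (Fin m)) (j + 1)
    ∪ Finset.piAntidiag (Finset.univ : Finset (Fin m)) 0)]
  · rw [Finset.sum_union]
    · congr 1
      · rw [ps_coeff_pow]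
        refine Finset.sum_congr rfl fun x hx => ?_
        rw [Finset.mem_piAntidiag] at hx
        rw [if_pos (by rw [hx.1]; rfl)]
      · split_ifs with h
        · rw [ps_coeff_pow]
          refine Finset.sum_congr rfl fun x hx => ?_
          rw [Finset.mem_piAntidiag] at hx
          rw [if_pos (by rw [hx.1, h])]
        · refine Finset.sum_eq_zero fun x hx => ?_
          rw [Finset.mem_piAntidiag] at hx
          rw [if_neg (by rw [hx.1]; omega)]
    · rw [Finset.disjoint_left]
      intro x hx hx'
      rw [Finset.mem_piAntidiag] at hx hx'
      omega
  · intro x hx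
    rw [Finset.mem_union, not_or, Finset.mem_piAntidiag, Finset.mem_piAntidiag] at hx
    simp only [Finset.mem_univ, implies_true, and_true] at hx
    rw [if_neg]
    intro h
    have e : Finset.univ.sum x = ∑ i, x i := rfl
    rw [e] at hx
    omega

lemma ps_coeff_congr (m : ℕ) (μ ν : ℕ → ℝ) (n : ℕ) (h : ∀ k ≤ n, μ k = ν k) :
    PowerSeries.coeff n (PowerSeries.mk μ ^ m) = PowerSeries.coeff n (PowerSeries.mk ν ^ m) := by
  rw [ps_coeff_pow, ps_coeff_pow]
  refine Finset.sum_congr rfl fun x hx => Finset.prod_congr rfl fun i _ => h _ ?_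
  rw [Finset.mem_piAntidiag] at hx
  rw [← hx.1]
  exact Finset.single_le_sum (f := x) (fun _ _ => Nat.zero_le _) (Finset.mem_univ i)

lemma ps_poly (m : ℕ) (g : ℝ[X]) (n : ℕ) :
    PowerSeries.coeff n (PowerSeries.mk (fun k => g.coeff k) ^ m) = (g ^ m).coeff n := by
  have : PowerSeries.mk (fun k => g.coeff k) = (g : PowerSeries ℝ) := by
    ext k; simp
  rw [this, ← Polynomial.coe_pow, Polynomial.coeff_coe]

lemma drStep_poly (m : ℕ) (μ : ℕ → ℝ) (g : ℝ[X]) (j : ℕ) (h : ∀ k ≤ j + 1, μ k = g.coeff k) :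
    drStep m μ j = (pstep m g).coeff j := by
  rw [drStep_eq, pstep_coeff, ps_coeff_congr m μ (fun k => g.coeff k) (j + 1) h,
    ps_coeff_congr m μ (fun k => g.coeff k) 0 (fun k hk => h k (by omega)), ps_poly, ps_poly]

lemma drStep_iter_poly (m n : ℕ) : ∀ (μ : ℕ → ℝ) (g : ℝ[X]) (j : ℕ),
    (∀ k ≤ j + n, μ k = g.coeff k) → (drStep m)^[n] μ j = ((pstep m)^[n] g).coeff j := by
  induction n with
  | zero => intro μ g j h; exact h j (by omega)
  | succ n ih =>
    intro μ g j h
    rw [Function.iterate_succ_apply, Function.iterate_succ_apply]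
    refine ih _ _ j fun k hk => drStep_poly m μ g k fun i hi => h i (by omega)

/-- the law `ν` with the mass above `n + 2` moved to `n + 2` -/
def capP (ν : ℕ → ℝ) (n : ℕ) : ℝ[X] :=
  ∑ k ∈ Finset.range (n + 2), C (ν k) * X ^ k + C (∑' k, ν (k + (n + 2))) * X ^ (n + 2)

lemma capP_coeff (ν : ℕ → ℝ) (n k : ℕ) : (capP ν n).coeff k =
    (if k < n + 2 then ν k else 0) + if k = n + 2 then ∑' k, ν (k + (n + 2)) else 0 := by
  simp only [capP, coeff_add, finsetSum_coeff, coeff_C_mul, coeff_X_pow, mul_ite, mul_one,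
    mul_zero, Finset.sum_ite_eq, Finset.mem_range]

lemma capP_law {ν : ℕ → ℝ} (hnn : ∀ k, 0 ≤ ν k) (hs : Summable ν) (h1 : ∑' k, ν k = 1) (n : ℕ) :
    Law (capP ν n) := by
  constructor
  · intro k
    rw [capP_coeff]
    have : 0 ≤ ∑' k, ν (k + (n + 2)) := tsum_nonneg fun k => hnn _
    have := hnn k
    split_ifs <;> linarith
  · have := hs.sum_add_tsum_nat_add (n + 2)
    rw [h1] at this
    simpa [capP, eval_finsetSum] using this

lemma capP_tl {ν : ℕ → ℝ} (hnn : ∀ k, 0 ≤ ν k) (hs : Summable ν) (h1 : ∑' k, ν k = 1) (n : ℕ) :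
    tl (capP ν n) 2 = ∑' k, ν (k + 2) := by
  rw [tl, lowN_eq (capP_law hnn hs h1 n).1, ← h1, ← hs.sum_add_tsum_nat_add 2,
    Finset.sum_range_succ, Finset.sum_range_succ, Finset.sum_range_succ, Finset.sum_range_succ,
    capP_coeff, capP_coeff]
  simp

lemma capP_wn {ν : ℕ → ℝ} (hnn : ∀ k, 0 ≤ ν k) (hs : Summable ν) (h1 : ∑' k, ν k = 1) (n : ℕ)
    {s : ℝ} (hs1 : 1 ≤ s) (hsum : Summable fun k => ν k * s ^ k) (T : ℕ) :
    wn s T (capP ν n) ≤ ∑' k, ν k * s ^ k := by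
  have hs0 : 0 ≤ s := by linarith
  have hl := capP_law hnn hs h1 n
  unfold wn
  rw [tsum_eq_sum (s := Finset.range (n + 2 + 1)) (fun k hk => by
    rw [Finset.mem_range] at hk
    rw [capP_coeff, if_neg (by omega), if_neg (by omega)]; simp),
    ← hsum.sum_add_tsum_nat_add (n + 2), Finset.sum_range_succ]
  refine add_le_add (Finset.sum_le_sum fun k hk => ?_) ?_
  · rw [Finset.mem_range] at hk
    rw [Real.norm_of_nonneg (hl.1 k), capP_coeff, if_pos hk, if_neg (by omega), add_zero]
    exact mul_le_mul_of_nonneg_left (pow_le_pow_right₀ hs1 (by omega)) (hnn k)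
  · rw [Real.norm_of_nonneg (hl.1 _), capP_coeff, if_neg (by omega), if_pos rfl, zero_add,
      ← tsum_mul_right]
    refine Summable.tsum_le_tsum (fun k => ?_)
      (((summable_nat_add_iff (n + 2)).2 hs).mul_right _)
      ((summable_nat_add_iff (f := fun k => ν k * s ^ k) (n + 2)).2 hsum)
    exact mul_le_mul_of_nonneg_left (pow_le_pow_right₀ hs1 (by omega)) (hnn _)

/-- the polynomial in `p` giving `P(X_n = 0)` -/
def zeroP (m : ℕ) (ν : ℕ → ℝ) (n : ℕ) : ℝ[X] :=
  ((pstep m)^[n] (mixP ((capP ν n).map C) (X : ℝ[X]))).coeff 0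

lemma zeroP_hom {S : Type*} [CommRing S] (m : ℕ) (ν : ℕ → ℝ) (n : ℕ) (φ : ℝ →+* S) (z : S) :
    (zeroP m ν n).eval₂ φ z = ((pstep m)^[n] (mixP ((capP ν n).map φ) z)).coeff 0 := by
  have h := pstep_iter_map (eval₂RingHom φ z) m (mixP ((capP ν n).map C) (X : ℝ[X])) n
  have h2 := congrArg (fun f => Polynomial.coeff f 0) h
  simp only [coeff_map] at h2
  rw [mixP_map, Polynomial.map_map] at h2
  have e : (eval₂RingHom φ z).comp C = φ := by ext x; simp
  rw [e] at h2
  simpa [zeroP] using h2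

lemma zeroP_eval (m : ℕ) {ν : ℕ → ℝ} (n : ℕ) (q : ℝ) :
    drLaw m ν q n 0 = (zeroP m ν n).eval q := by
  have h := zeroP_hom m ν n (RingHom.id ℝ) q
  rw [eval₂_id, Polynomial.map_id] at h
  rw [h, drLaw]
  refine drStep_iter_poly m n _ _ 0 fun k hk => ?_
  rw [mix, mixP, coeff_add, coeff_C_mul, coeff_C, capP_coeff, if_pos (by omega : k < n + 2),
    if_neg (by omega : ¬ k = n + 2)]
  split_ifs <;> ring

lemma poly_iteratedDeriv {𝕜 : Type*} [NontriviallyNormedField 𝕜] (f : 𝕜[X]) (k : ℕ) :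
    iteratedDeriv k (fun x => f.eval x) = fun x => (derivative^[k] f).eval x := by
  induction k with
  | zero => simp
  | succ k ih =>
    rw [iteratedDeriv_succ, ih, Function.iterate_succ_apply']
    ext x; exact Polynomial.deriv _

/-- Cauchy estimate -/
lemma poly_cauchy (f : ℝ[X]) (k : ℕ) (p r B : ℝ) (hr : 0 < r)
    (h : ∀ z : ℂ, ‖z - p‖ ≤ r → ‖f.eval₂ Complex.ofRealHom z‖ ≤ B) :
    |(derivative^[k] f).eval p| ≤ k.factorial * B / r ^ k := by
  have h1 := Complex.norm_iteratedDeriv_le_of_forall_mem_sphere_norm_le (c := (p : ℂ)) (R := r)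
    (C := B) (f := fun z => (f.map Complex.ofRealHom).eval z) k hr
    ((f.map Complex.ofRealHom).differentiable.diffContOnCl) (fun z hz => by
      rw [eval_map]; exact h z (by rw [mem_sphere_iff_norm] at hz; exact hz.le))
  rw [poly_iteratedDeriv, Polynomial.iterate_derivative_map] at h1
  have : ((derivative^[k] f).map Complex.ofRealHom).eval (p : ℂ)
      = ((derivative^[k] f).eval p : ℝ) := by
    exact Polynomial.eval_map_apply (f := Complex.ofRealHom) p
  simp only at h1
  rw [this, Complex.norm_real, Real.norm_eq_abs] at h1
  exact h1

lemma theta_exists {M : ℝ} (hM : 1 < M) (k : ℕ) : ∃ θ : ℝ, 1 < θ ∧ θ ^ k < M := by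
  have hcont : Continuous fun t : ℝ => t ^ k := by fun_prop
  have hlim := hcont.tendsto 1
  have hev := (hlim.eventually (gt_mem_nhds (show (1 : ℝ) ^ k < M by simpa using hM))).filter_mono
    (nhdsWithin_le_nhds (s := Set.Ioi (1 : ℝ)))
  have hev2 : ∀ᶠ ε : ℝ in nhdsWithin 1 (Set.Ioi 1), ε ∈ Set.Ioi (1 : ℝ) :=
    eventually_mem_nhdsWithin
  obtain ⟨ε, h1, h2⟩ := (hev.and hev2).exists
  exact ⟨ε, h2, h1⟩

lemma deriv_summable (m : ℕ) (hm : 2 ≤ m) (ν : ℕ → ℝ)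
    (hν0 : ν 0 = 0) (hνnn : ∀ k, 0 ≤ ν k) (hνsum : ∑' k, ν k = 1)
    (hc1 : 0 < ∑' k, ν (k + 2))
    (hint : ∀ s : ℝ, 0 ≤ s → s < (m : ℝ) → Summable fun k : ℕ => ν k * s ^ k) (k : ℕ) :
    ∃ u : ℕ → ℝ, Summable u ∧ ∀ n, ∀ p ∈ Set.Icc (0 : ℝ) 1,
      |(1 / (m : ℝ) ^ (n + 1)) * (derivative^[k] (zeroP m ν n ^ m)).eval p| ≤ u n := by
  have hm' : (2 : ℝ) ≤ m := by exact_mod_cast hm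
  have hm0 : (0 : ℝ) < m := by linarith
  have hs : Summable ν := by simpa using hint 1 (by norm_num) (by linarith)
  obtain ⟨l, rfl⟩ : ∃ l, m = l + 2 := ⟨m - 2, by omega⟩
  obtain ⟨θ, hθ, hθm⟩ := theta_exists (show (1 : ℝ) < ((l + 2 : ℕ) : ℝ) by linarith) k
  obtain ⟨c, hc, hest⟩ := main_est l hc1 (fun s => ∑' k, ν k * s ^ k) hθ
  have hθ0 : 0 < θ := by linarith
  obtain ⟨M, hM⟩ : ∃ M : ℝ, M = ((l + 2 : ℕ) : ℝ) := ⟨_, rfl⟩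
  rw [← hM] at hm' hm0 hθm ⊢
  refine ⟨fun n => (k.factorial * 2 ^ (l + 2) / c ^ k / M) * (θ ^ k / M) ^ n, ?_, ?_⟩
  · refine (summable_geometric_of_lt_one (div_nonneg (pow_nonneg hθ0.le _) hm0.le) ?_).mul_left _
    rw [div_lt_one hm0]; exact hθm
  · intro n p hp
    have h1 := poly_cauchy (zeroP (l + 2) ν n ^ (l + 2)) k p (c / θ ^ n) (2 ^ (l + 2))
      (div_pos hc (pow_pos hθ0 n)) (by
        intro z hz
        rw [le_div_iff₀ (pow_pos hθ0 n)] at hz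
        rw [eval₂_pow, norm_pow, zeroP_hom]
        refine pow_le_pow_left₀ (norm_nonneg _) ?_ _
        refine hest n (capP ν n) (capP_law hνnn hs hνsum n) ?_ (capP_tl hνnn hs hνsum n).ge ?_
          p hp.1 hp.2 z hz
        · rw [capP_coeff, if_pos (by omega), if_neg (by omega), hν0, add_zero]
        · intro s hs1 hsM T
          exact capP_wn hνnn hs hνsum n hs1 (hint s (by linarith) (by push_cast; exact hsM)) T)
    have hpos : 0 < 1 / M ^ (n + 1) := div_pos one_pos (pow_pos hm0 _)
    rw [abs_mul, abs_of_pos hpos]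
    refine (mul_le_mul_of_nonneg_left h1 hpos.le).trans (le_of_eq ?_)
    have e1 : (c / θ ^ n) ^ k = c ^ k / (θ ^ k) ^ n := by
      rw [div_pow, ← pow_mul, ← pow_mul, mul_comm]
    beta_reduce
    rw [e1, div_pow, pow_succ]
    have := pow_pos hθ0 k
    field_simp


lemma hasSum_of_eq {f g : ℕ → ℝ} {a : ℝ} (h : HasSum f a) (e : ∀ k, g k = f k) : HasSum g a := by
  have : g = f := funext e
  rw [this]; exact h

/-- a probability mass function with mean `e` -/
structure MeanLaw (f : ℕ → ℝ) (e : ℝ) : Prop where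
  nn : ∀ k, 0 ≤ f k
  one : HasSum f 1
  mean : HasSum (fun k : ℕ => (k : ℝ) * f k) e

lemma hasSum_conv {f g : ℕ → ℝ} {a b : ℝ}
    (hf : HasSum f a) (hg : HasSum g b) :
    HasSum (fun n => ∑ kl ∈ Finset.HasAntidiagonal.antidiagonal n, f kl.1 * g kl.2) (a * b) := by
  have hf' : Summable fun x => ‖f x‖ := hf.summable.norm
  have hg' : Summable fun x => ‖g x‖ := hg.summable.norm
  have h1 := tsum_mul_tsum_eq_tsum_sum_antidiagonal_of_summable_norm hf' hg'
  rw [hf.tsum_eq, hg.tsum_eq] at h1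
  rw [h1]
  exact (summable_norm_sum_mul_antidiagonal_of_summable_norm hf' hg').of_norm.hasSum

lemma MeanLaw.mul {F G : PowerSeries ℝ} {a b : ℝ}
    (hf : MeanLaw (fun k => PowerSeries.coeff k F) a)
    (hg : MeanLaw (fun k => PowerSeries.coeff k G) b) :
    MeanLaw (fun k => PowerSeries.coeff k (F * G)) (a + b) := by
  refine ⟨fun k => ?_, ?_, ?_⟩
  · beta_reduce
    rw [PowerSeries.coeff_mul]
    exact Finset.sum_nonneg fun x _ => mul_nonneg (hf.nn _) (hg.nn _)
  · have h := hasSum_conv hf.one hg.one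
    rw [one_mul] at h
    simpa only [PowerSeries.coeff_mul] using h
  · have h1 := hasSum_conv hf.mean hg.one
    have h2 := hasSum_conv hf.one hg.mean
    have h3 := h1.add h2
    rw [one_mul, mul_one] at h3
    refine hasSum_of_eq h3 ?_
    intro n
    rw [PowerSeries.coeff_mul, Finset.mul_sum, ← Finset.sum_add_distrib]
    refine Finset.sum_congr rfl fun x hx => ?_
    rw [Finset.HasAntidiagonal.mem_antidiagonal] at hx
    rw [← hx]; push_cast; ring

lemma MeanLaw.pow {F : PowerSeries ℝ} {a : ℝ}
    (hf : MeanLaw (fun k => PowerSeries.coeff k F) a) (m : ℕ) :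
    MeanLaw (fun k => PowerSeries.coeff k (F ^ m)) (m * a) := by
  induction m with
  | zero =>
    have e : (fun k => PowerSeries.coeff k (F ^ 0)) = fun k : ℕ => if k = 0 then (1 : ℝ) else 0 := by
      ext k; rw [pow_zero, PowerSeries.coeff_one]
    rw [e]
    refine ⟨fun k => by beta_reduce; split_ifs <;> norm_num, hasSum_ite_eq 0 1, ?_⟩
    have : (fun k : ℕ => (k : ℝ) * if k = 0 then (1 : ℝ) else 0) = fun _ => 0 := by
      ext k; split_ifs with h <;> simp [h]
    rw [this]; simpa using hasSum_zero
  | succ m ih =>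
    have := ih.mul hf
    rw [← pow_succ] at this
    convert this using 1
    push_cast; ring

lemma MeanLaw.step {μ : ℕ → ℝ} {e : ℝ} (h : MeanLaw μ e) (m : ℕ) :
    MeanLaw (drStep m μ) (m * e - 1 + μ 0 ^ m) := by
  have h0 : MeanLaw (fun k => PowerSeries.coeff k (PowerSeries.mk μ)) e := by
    simpa only [PowerSeries.coeff_mk] using h
  have hp := h0.pow m
  have c0 : PowerSeries.coeff 0 (PowerSeries.mk μ ^ m) = μ 0 ^ m := by
    simp [PowerSeries.coeff_zero_eq_constantCoeff_apply]
  have e1 : drStep m μ = fun j => PowerSeries.coeff (j + 1) (PowerSeries.mk μ ^ m)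
      + if j = 0 then μ 0 ^ m else 0 := by
    ext j; rw [drStep_eq, c0]
  have hs := (hasSum_nat_add_iff' (f := fun k => PowerSeries.coeff k (PowerSeries.mk μ ^ m)) 1).2
    hp.one
  have hk := (hasSum_nat_add_iff'
    (f := fun k : ℕ => (k : ℝ) * PowerSeries.coeff k (PowerSeries.mk μ ^ m)) 1).2 hp.mean
  simp only [Finset.sum_range_one, c0, Nat.cast_zero, zero_mul, sub_zero] at hs hk
  rw [e1]
  refine ⟨fun k => ?_, ?_, ?_⟩
  · have h1 := hp.nn (k + 1)
    have h2 := pow_nonneg (h.nn 0) m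
    beta_reduce at h1 ⊢
    split_ifs <;> linarith
  · have := hs.add (hasSum_ite_eq 0 (μ 0 ^ m))
    rwa [sub_add_cancel] at this
  · have h3 := hk.sub hs
    have e2 : (m : ℝ) * e - (1 - μ 0 ^ m) = m * e - 1 + μ 0 ^ m := by ring
    rw [e2] at h3
    refine hasSum_of_eq h3 ?_
    intro k
    split_ifs with h
    · subst h; simp
    · push_cast; ring

lemma mean_mix {ν : ℕ → ℝ} {e p : ℝ} (h : MeanLaw ν e) (hp : p ∈ Set.Icc (0 : ℝ) 1) :
    MeanLaw (mix ν p) (p * e) := by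
  have hp1 : 0 ≤ 1 - p := by linarith [hp.2]
  refine ⟨fun k => ?_, ?_, ?_⟩
  · refine add_nonneg (mul_nonneg hp1 ?_) (mul_nonneg hp.1 (h.nn k))
    split_ifs <;> norm_num
  · have := ((hasSum_ite_eq 0 (1 : ℝ)).mul_left (1 - p)).add (h.one.mul_left p)
    rw [mul_one, mul_one, sub_add_cancel] at this
    exact this
  · refine hasSum_of_eq (h.mean.mul_left p) fun k => ?_
    unfold mix
    split_ifs with hk
    · subst hk; simp
    · ring

lemma mean_drLaw {m : ℕ} (hm : 2 ≤ m) {ν : ℕ → ℝ} {e p : ℝ} (h : MeanLaw ν e)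
    (hp : p ∈ Set.Icc (0 : ℝ) 1) (n : ℕ) :
    MeanLaw (drLaw m ν p n) ((m : ℝ) ^ n * (p * e - ∑ j ∈ Finset.range n, 1 / (m : ℝ) ^ (j + 1)
      + ∑ j ∈ Finset.range n, 1 / (m : ℝ) ^ (j + 1) * drLaw m ν p j 0 ^ m)) := by
  have hm0 : (m : ℝ) ≠ 0 := by
    have : m ≠ 0 := by omega
    exact_mod_cast this
  induction n with
  | zero => simpa [drLaw] using mean_mix h hp
  | succ n ih =>
    have h1 := ih.step m
    have e1 : drStep m (drLaw m ν p n) = drLaw m ν p (n + 1) := by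
      rw [drLaw, drLaw, Function.iterate_succ_apply']
    rw [e1] at h1
    convert h1 using 1
    rw [Finset.sum_range_succ, Finset.sum_range_succ]
    field_simp
    ring

lemma mean_nu {m : ℕ} (hm : 2 ≤ m) {ν : ℕ → ℝ}
    (hνnn : ∀ k, 0 ≤ ν k) (hνsum : ∑' k, ν k = 1)
    (hint : ∀ s : ℝ, 0 ≤ s → s < (m : ℝ) → Summable fun k : ℕ => ν k * s ^ k) :
    MeanLaw ν (∑' j : ℕ, (j : ℝ) * ν j) := by
  have hm' : (2 : ℝ) ≤ m := by exact_mod_cast hm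
  have hs : Summable ν := by simpa using hint 1 (by norm_num) (by linarith)
  refine ⟨hνnn, by rw [← hνsum]; exact hs.hasSum, Summable.hasSum ?_⟩
  refine Summable.of_nonneg_of_le (fun k => mul_nonneg (Nat.cast_nonneg _) (hνnn k)) (fun k => ?_)
    ((hint (3 / 2) (by norm_num) (by linarith)).mul_left 2)
  have hb := one_add_mul_le_pow (show (-2 : ℝ) ≤ 1 / 2 by norm_num) k
  have hb' : (k : ℝ) ≤ 2 * (3 / 2) ^ k := by
    have e : (1 : ℝ) + 1 / 2 = 3 / 2 := by norm_num
    rw [e] at hb; linarith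
  calc (k : ℝ) * ν k ≤ (2 * (3 / 2) ^ k) * ν k := mul_le_mul_of_nonneg_right hb' (hνnn k)
    _ = _ := by ring

lemma geom_m {m : ℕ} (hm : 2 ≤ m) :
    HasSum (fun j : ℕ => 1 / (m : ℝ) ^ (j + 1)) (1 / ((m : ℝ) - 1)) := by
  have hm' : (2 : ℝ) ≤ m := by exact_mod_cast hm
  have h := (hasSum_geometric_of_lt_one (r := 1 / (m : ℝ)) (by positivity)
    (by rw [div_lt_one (by linarith)]; linarith)).mul_left (1 / (m : ℝ))
  have e1 : 1 / (m : ℝ) * (1 - 1 / (m : ℝ))⁻¹ = 1 / ((m : ℝ) - 1) := by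
    have : (m : ℝ) - 1 ≠ 0 := by linarith
    have : (m : ℝ) ≠ 0 := by linarith
    field_simp
  rw [e1] at h
  refine hasSum_of_eq h fun k => ?_
  rw [one_div_pow, pow_succ]; field_simp

lemma free_energy_formula {m : ℕ} (hm : 2 ≤ m) {ν : ℕ → ℝ}
    (hνnn : ∀ k, 0 ≤ ν k) (hνsum : ∑' k, ν k = 1)
    (hint : ∀ s : ℝ, 0 ≤ s → s < (m : ℝ) → Summable fun k : ℕ => ν k * s ^ k)
    {p f : ℝ} (hp : p ∈ Set.Icc (0 : ℝ) 1)
    (hsum : Summable fun n : ℕ => 1 / (m : ℝ) ^ (n + 1) * drLaw m ν p n 0 ^ m)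
    (hF : Tendsto (fun n : ℕ => (∑' k : ℕ, (k : ℝ) * drLaw m ν p n k) / (m : ℝ) ^ n)
        atTop (nhds f)) :
    f = p * (∑' j : ℕ, (j : ℝ) * ν j) - 1 / ((m : ℝ) - 1)
      + ∑' n : ℕ, 1 / (m : ℝ) ^ (n + 1) * drLaw m ν p n 0 ^ m := by
  have hm0 : (m : ℝ) ≠ 0 := by
    have : m ≠ 0 := by omega
    exact_mod_cast this
  refine tendsto_nhds_unique hF ?_
  have h1 := ((geom_m hm).tendsto_sum_nat.const_sub (p * (∑' j : ℕ, (j : ℝ) * ν j))).add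
    hsum.hasSum.tendsto_sum_nat
  refine h1.congr fun n => ?_
  rw [(mean_drLaw hm (mean_nu hm hνnn hνsum hint) hp n).mean.tsum_eq,
    mul_div_cancel_left₀ _ (pow_ne_zero n hm0)]


lemma extend_deriv (f : ℝ[X]) (c u : ℝ)
    (hu : ∀ p ∈ Set.Icc (0 : ℝ) 1, |c * (derivative f).eval p| ≤ u) :
    ∃ H H' : ℝ → ℝ, (∀ x, HasDerivAt H (H' x) x) ∧ (∀ x, ‖H' x‖ ≤ u) ∧
      (∀ x ∈ Set.Icc (0 : ℝ) 1, H x = c * f.eval x) ∧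
      ∀ x ∈ Set.Icc (0 : ℝ) 1, H' x = c * (derivative f).eval x := by
  obtain ⟨H', hH'⟩ : ∃ H' : ℝ → ℝ, H' = fun t =>
    c * (derivative f).eval (Set.projIcc (0 : ℝ) 1 zero_le_one t : ℝ) := ⟨_, rfl⟩
  have hc : Continuous H' := by
    rw [hH']
    exact continuous_const.mul ((derivative f).continuous.comp
      (continuous_subtype_val.comp continuous_projIcc))
  have heq : ∀ x ∈ Set.Icc (0 : ℝ) 1, H' x = c * (derivative f).eval x := by
    intro x hx
    rw [hH']; beta_reduce
    rw [Set.projIcc_of_mem zero_le_one hx]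
  refine ⟨fun x => c * f.eval 0 + ∫ t in (0 : ℝ)..x, H' t, H', fun x => ?_, fun x => ?_,
    fun x hx => ?_, heq⟩
  · exact (intervalIntegral.integral_hasDerivAt_right (hc.intervalIntegrable _ _)
      (hc.stronglyMeasurableAtFilter _ _) hc.continuousAt).const_add _
  · rw [hH']; exact hu _ (Set.projIcc (0 : ℝ) 1 zero_le_one x).2
  · have : ∫ t in (0 : ℝ)..x, H' t = c * f.eval x - c * f.eval 0 := by
      refine intervalIntegral.integral_eq_sub_of_hasDerivAt (f := fun t => c * f.eval t)
        (fun t ht => ?_) (hc.intervalIntegrable _ _)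
      rw [Set.uIcc_of_le hx.1] at ht
      rw [heq t ⟨ht.1, ht.2.trans hx.2⟩]
      exact (f.hasDerivAt t).const_mul c
    beta_reduce
    rw [this]; ring

lemma series_deriv (f : ℕ → ℝ[X]) (w u v : ℕ → ℝ) (hu : Summable u) (hv : Summable v)
    (h0 : ∀ n, ∀ p ∈ Set.Icc (0 : ℝ) 1, |w n * (f n).eval p| ≤ v n)
    (h1 : ∀ n, ∀ p ∈ Set.Icc (0 : ℝ) 1, |w n * (derivative (f n)).eval p| ≤ u n)
    {p : ℝ} (hp : p ∈ Set.Icc (0 : ℝ) 1) :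
    HasDerivWithinAt (fun x => ∑' n, w n * (f n).eval x)
      (∑' n, w n * (derivative (f n)).eval p) (Set.Icc 0 1) p := by
  choose H H' hd hb he he' using fun n => extend_deriv (f n) (w n) (u n) (h1 n)
  have hs : Summable fun n => H n 0 := by
    have : (0 : ℝ) ∈ Set.Icc (0 : ℝ) 1 := by simp
    refine Summable.of_norm_bounded hv fun n => ?_
    rw [he n 0 this]; exact h0 n 0 this
  have h := hasDerivAt_tsum hu hd hb hs p
  have e1 : (∑' n, H' n p) = ∑' n, w n * (derivative (f n)).eval p :=
    tsum_congr fun n => he' n p hp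
  rw [e1] at h
  refine h.hasDerivWithinAt.congr (fun x hx => ?_) ?_
  · exact tsum_congr fun n => (he n x hx).symm
  · exact tsum_congr fun n => (he n p hp).symm

lemma chain_smooth (F : ℝ → ℝ) (T : ℕ → ℝ → ℝ)
    (h0 : ∀ p ∈ Set.Icc (0 : ℝ) 1, F p = T 0 p)
    (hT : ∀ k, ∀ p ∈ Set.Icc (0 : ℝ) 1, HasDerivWithinAt (T k) (T (k + 1) p) (Set.Icc 0 1) p) :
    ContDiffOn ℝ (⊤ : ℕ∞) F (Set.Icc 0 1) ∧
      ∀ k, ∀ p ∈ Set.Icc (0 : ℝ) 1, iteratedDerivWithin k F (Set.Icc 0 1) p = T k p := by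
  have key : ∀ k, ∀ p ∈ Set.Icc (0 : ℝ) 1, iteratedDerivWithin k F (Set.Icc 0 1) p = T k p := by
    intro k
    induction k with
    | zero => intro p hp; rw [iteratedDerivWithin_zero]; exact h0 p hp
    | succ k ih =>
      intro p hp
      rw [iteratedDerivWithin_succ]
      exact ((hT k p hp).congr (fun x hx => ih x hx) (ih p hp)).derivWithin
        (uniqueDiffOn_Icc zero_lt_one p hp)
  refine ⟨contDiffOn_of_differentiableOn_deriv fun k _ p hp => ?_, key⟩
  exact ((hT k p hp).congr (fun x hx => key k x hx) (key k p hp)).differentiableWithinAt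


end helpers

/-- If `E(s^{X_0^*}) < ∞` for all `0 ≤ s < m` (and `P(X_0^* ≥ 2) > 0`),
then the free energy `F` is infinitely differentiable on `[0,1]` (one-sided derivatives at
the endpoints), and for each `k ≥ 0`,
`F^{(k)}(p) = dᵏ/dpᵏ (E X_0 - 1/(m-1)) + ∑_n m^{-(n+1)} dᵏ/dpᵏ P(X_n = 0)^m`,
the series converging uniformly on `[0,1]`. -/
theorem free_energy_smooth
    (m : ℕ) (hm : 2 ≤ m) (ν : ℕ → ℝ)
    (hν0 : ν 0 = 0) (hνnn : ∀ k, 0 ≤ ν k) (hνsum : ∑' k, ν k = 1)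
    (hc1 : 0 < ∑' k, ν (k + 2))
    (hint : ∀ s : ℝ, 0 ≤ s → s < (m : ℝ) → Summable fun k : ℕ => ν k * s ^ k)
    (F : ℝ → ℝ)
    (hF : ∀ p ∈ Set.Icc (0 : ℝ) 1,
      Tendsto (fun n : ℕ => (∑' k : ℕ, (k : ℝ) * drLaw m ν p n k) / (m : ℝ) ^ n)
        atTop (nhds (F p))) :
    ContDiffOn ℝ (⊤ : ℕ∞) F (Set.Icc 0 1) ∧
    ∀ k : ℕ,
      (∀ p ∈ Set.Icc (0 : ℝ) 1,
        iteratedDerivWithin k F (Set.Icc 0 1) p =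
          iteratedDeriv k (fun q => q * (∑' j : ℕ, (j : ℝ) * ν j) - 1 / ((m : ℝ) - 1)) p +
          ∑' n : ℕ, (1 / (m : ℝ) ^ (n + 1)) *
            iteratedDeriv k (fun q => (drLaw m ν q n 0) ^ m) p) ∧
      TendstoUniformlyOn
        (fun N p => ∑ n ∈ Finset.range N, (1 / (m : ℝ) ^ (n + 1)) *
          iteratedDeriv k (fun q => (drLaw m ν q n 0) ^ m) p)
        (fun p => ∑' n : ℕ, (1 / (m : ℝ) ^ (n + 1)) *
          iteratedDeriv k (fun q => (drLaw m ν q n 0) ^ m) p)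
        atTop (Set.Icc 0 1) := by
  have hd : ∀ (k n : ℕ) (p : ℝ), iteratedDeriv k (fun q => (drLaw m ν q n 0) ^ m) p
      = (Polynomial.derivative^[k] (zeroP m ν n ^ m)).eval p := by
    intro k n p
    have e : (fun q => (drLaw m ν q n 0) ^ m) = fun q => (zeroP m ν n ^ m).eval q := by
      funext q
      rw [zeroP_eval, Polynomial.eval_pow]
    rw [e, poly_iteratedDeriv]
  have hL : ∀ k, iteratedDeriv k (fun q : ℝ => q * (∑' j : ℕ, (j : ℝ) * ν j) - 1 / ((m : ℝ) - 1))
      = fun p => (Polynomial.derivative^[k] (Polynomial.X * Polynomial.C (∑' j : ℕ, (j : ℝ) * ν j)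
        - Polynomial.C (1 / ((m : ℝ) - 1)))).eval p := by
    intro k
    rw [← poly_iteratedDeriv]
    congr 1
    funext q
    simp
    exact mul_comm _ _
  simp only [hd, hL]
  have hsum := deriv_summable m hm ν hν0 hνnn hνsum hc1 hint
  choose u hu hb using hsum
  have hmain := chain_smooth F (fun k p =>
    (Polynomial.derivative^[k] (Polynomial.X * Polynomial.C (∑' j : ℕ, (j : ℝ) * ν j)
        - Polynomial.C (1 / ((m : ℝ) - 1)))).eval p
      + ∑' n : ℕ, (1 / (m : ℝ) ^ (n + 1)) *
        (Polynomial.derivative^[k] (zeroP m ν n ^ m)).eval p) ?_ ?_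
  · refine ⟨hmain.1, fun k => ⟨fun p hp => hmain.2 k p hp, ?_⟩⟩
    exact tendstoUniformlyOn_tsum_nat (hu k) fun n x hx => hb k n x hx
  · intro p hp
    have ht : ∀ n : ℕ, 1 / (m : ℝ) ^ (n + 1) * drLaw m ν p n 0 ^ m
        = (1 / (m : ℝ) ^ (n + 1)) * (Polynomial.derivative^[0] (zeroP m ν n ^ m)).eval p := by
      intro n
      rw [zeroP_eval, Function.iterate_zero, id, Polynomial.eval_pow]
    have h := free_energy_formula hm hνnn hνsum hint hp
      (Summable.of_norm_bounded (hu 0) fun n => by rw [ht]; exact hb 0 n p hp) (hF p hp)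
    rw [h]
    congr 1
    · simp
      exact mul_comm _ _
    · exact tsum_congr ht
  · intro k p hp
    have h1 := series_deriv (fun n => Polynomial.derivative^[k] (zeroP m ν n ^ m))
      (fun n => 1 / (m : ℝ) ^ (n + 1)) (u (k + 1)) (u k) (hu (k + 1)) (hu k) (hb k)
      (fun n p hp => by
        have := hb (k + 1) n p hp
        rw [Function.iterate_succ_apply'] at this
        exact this) hp
    have h2 := ((Polynomial.derivative^[k] (Polynomial.X * Polynomial.C (∑' j : ℕ, (j : ℝ) * ν j)
        - Polynomial.C (1 / ((m : ℝ) - 1)))).hasDerivAt p).hasDerivWithinAt (s := Set.Icc 0 1)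
    simp only [Function.iterate_succ_apply']
    exact h2.add h1
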